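/- (q-envelope theorem, dense-subspace form) Let 0 < p < q < 1. Let B = {f ∈ E^p : ‖f‖_{E^p} ≤ 1}, regarded as a subset of the complex vector space of functions ℂ → ℂ, let C_q = {Σ_{i=1}^n a_i f_i : n ∈ ℕ, f_i ∈ B, a_i ∈ ℂ, Σ_{i=1}^n |a_i|^q ≤ 1} be the q-convex hull of B, and let μ_q be the Minkowski functional (gauge) of C_q. Then there exist constants c, C > 0 such that for every f ∈ E^p: c·μ_q(f) ≤ (∫_ℂ e^{-qπ|Im z|} |Im z|^{q/p-2} |f(z)|^q dA(z))^{1/q} ≤ C·μ_q(f); that is, the q-Banach envelope quasi-norm of E^p is equivalent on E^p to the quasi-norm (∫_ℂ e^{-qπ|Im z|} |Im z|^{q/p-2} |f(z)|^q dA(z))^{1/q}. -/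

import Mathlib

open MeasureTheory Real Complex
open scoped ENNReal NNReal

/-- An entire function of exponential type `π`. -/
def ExpTypePi (f : ℂ → ℂ) : Prop :=
  Differentiable ℂ f ∧
    ∀ ε > 0, ∃ C > 0, ∀ z : ℂ, ‖f z‖ ≤ C * Real.exp ((Real.pi + ε) * ‖z‖)

/-- The `q`-convex hull of a set of functions: finite combinations `Σ aᵢ • fᵢ`
with `fᵢ ∈ B`, `aᵢ ∈ ℂ`, `Σ ‖aᵢ‖^q ≤ 1`. -/
def qConvexHull (q : ℝ) (B : Set (ℂ → ℂ)) : Set (ℂ → ℂ) :=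
  {h : ℂ → ℂ | ∃ (n : ℕ) (f : Fin n → ℂ → ℂ) (a : Fin n → ℂ),
    (∀ i, f i ∈ B) ∧ (∑ i, ‖a i‖ ^ q) ≤ 1 ∧ h = ∑ i, a i • f i}

section
open MeasureTheory Real Complex
open scoped ENNReal NNReal

open MeromorphicOn in
theorem log_submean {g : ℂ → ℂ} {c : ℂ} {R : ℝ} (hR : 0 < R)
    (hg : AnalyticOnNhd ℂ g (Metric.closedBall c R)) (h0 : g c ≠ 0) :
    Real.log ‖g c‖ ≤ circleAverage (fun z => Real.log ‖g z‖) c R := by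
  have habs : |R| = R := abs_of_pos hR
  have hg' : AnalyticOnNhd ℂ g (Metric.closedBall c |R|) := by rwa [habs]
  have := hg'.circleAverage_log_norm hR.ne' h0
  rw [this]
  have : 0 ≤ ∑ᶠ u, divisor g (Metric.closedBall c |R|) u * Real.log (R * ‖c - u‖⁻¹) := by
    apply finsum_nonneg
    intro u
    by_cases hu : u ∈ Metric.closedBall c |R|
    · apply mul_nonneg
      · exact_mod_cast (hg'.divisor_nonneg u)
      · by_cases hcu : c = u
        · simp [hcu]
        apply Real.log_nonneg
        have h1 : 0 < ‖c - u‖ := norm_pos_iff.2 (sub_ne_zero.2 hcu)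
        have h2 : ‖c - u‖ ≤ R := by
          rw [habs] at hu; simpa [dist_eq_norm, norm_sub_rev] using hu
        rw [← div_eq_mul_inv]
        exact (one_le_div h1).2 h2
    · simp [hu]
  linarith

theorem rpow_tangent {A x r : ℝ} (hA : 0 < A) (hr : 0 < r) (hAr : 1 ≤ r * Real.log A) (hx : 0 ≤ x) :
    A ^ r * (1 + r * (Real.log x - Real.log A)) ≤ x ^ r := by
  rcases hx.eq_or_lt with rfl | hx
  · rw [Real.zero_rpow hr.ne', Real.log_zero]
    have : 0 < A ^ r := Real.rpow_pos_of_pos hA r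
    nlinarith
  · have h1 : x ^ r = A ^ r * Real.exp (r * (Real.log x - Real.log A)) := by
      rw [Real.rpow_def_of_pos hx, Real.rpow_def_of_pos hA, ← Real.exp_add]
      ring_nf
    rw [h1]
    have : 0 < A ^ r := Real.rpow_pos_of_pos hA r
    gcongr
    linarith [Real.add_one_le_exp (r * (Real.log x - Real.log A))]

theorem rpow_submean {g : ℂ → ℂ} {c : ℂ} {R r : ℝ} (hR : 0 < R) (hr : 0 < r)
    (hg : AnalyticOnNhd ℂ g (Metric.closedBall c R)) :
    ‖g c‖ ^ r ≤ circleAverage (fun z => ‖g z‖ ^ r) c R := by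
  by_cases h0 : g c = 0
  · rw [h0, norm_zero, Real.zero_rpow hr.ne']
    apply circleAverage_nonneg_of_nonneg
    intro x _
    positivity
  -- scale
  obtain ⟨k, hk0, hk⟩ : ∃ k : ℝ, 0 < k ∧ 1 ≤ r * Real.log (k * ‖g c‖) := by
    refine ⟨Real.exp (1 / r) / ‖g c‖, by positivity, ?_⟩
    have : ‖g c‖ ≠ 0 := norm_ne_zero_iff.2 h0
    rw [div_mul_cancel₀ _ this, Real.log_exp]
    field_simp
    rfl
  have key : ∀ G : ℂ → ℂ, AnalyticOnNhd ℂ G (Metric.closedBall c R) → G c ≠ 0 →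
      1 ≤ r * Real.log ‖G c‖ → ‖G c‖ ^ r ≤ circleAverage (fun z => ‖G z‖ ^ r) c R := by
    intro G hG hG0 hGr
    have hlog := log_submean hR hG hG0
    have hIntg : CircleIntegrable (fun z => Real.log ‖G z‖) c R := by
      apply MeromorphicOn.circleIntegrable_log_norm
      apply AnalyticOnNhd.meromorphicOn
      intro z hz
      apply hG z
      rw [abs_of_pos hR] at hz
      exact Metric.sphere_subset_closedBall hz
    have hA : 0 < ‖G c‖ := norm_pos_iff.2 hG0
    have hcont : CircleIntegrable (fun z => ‖G z‖ ^ r) c R := by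
      apply ContinuousOn.circleIntegrable hR.le
      intro z hz
      have := (hG z (Metric.sphere_subset_closedBall hz)).continuousAt
      exact ((this.norm).rpow_const (Or.inr hr.le)).continuousWithinAt
    have heq : (fun z => ‖G c‖ ^ r * (1 + r * (Real.log ‖G z‖ - Real.log ‖G c‖))) =
        (fun z => (‖G c‖ ^ r * r) • Real.log ‖G z‖ +
          (‖G c‖ ^ r * (1 - r * Real.log ‖G c‖))) := by
      ext z; simp only [smul_eq_mul]; ring
    have hi2 : CircleIntegrable (fun z => (‖G c‖ ^ r * r) • Real.log ‖G z‖) c R :=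
      hIntg.const_fun_smul
    have hi3 : CircleIntegrable (fun z : ℂ => (‖G c‖ ^ r * (1 - r * Real.log ‖G c‖))) c R :=
      circleIntegrable_const _ _ _
    have hm := circleAverage_mono (c := c) (R := R)
      (f₁ := fun z => (‖G c‖ ^ r * r) • Real.log ‖G z‖ + (‖G c‖ ^ r * (1 - r * Real.log ‖G c‖)))
      (f₂ := fun z => ‖G z‖ ^ r) (hi2.add hi3) hcont (by
        intro z _
        have := congrFun heq z

        rw [← this]
        exact rpow_tangent hA hr hGr (norm_nonneg _))
    rw [circleAverage_fun_add hi2 hi3, circleAverage_fun_smul, circleAverage_const] at hm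
    have hp : 0 < ‖G c‖ ^ r := Real.rpow_pos_of_pos hA r
    have h4 : (‖G c‖ ^ r * r) * Real.log ‖G c‖ ≤
      (‖G c‖ ^ r * r) * circleAverage (fun z => Real.log ‖G z‖) c R := by gcongr
    simp only [smul_eq_mul] at hm
    linarith
  have h5 := key (fun z => (k : ℂ) * g z) (fun z hz => analyticAt_const.mul (hg z hz))
    (mul_ne_zero (by exact_mod_cast hk0.ne') h0) (by simpa [abs_of_pos hk0] using hk)
  simp only [norm_mul, norm_real, Real.norm_eq_abs, abs_of_pos hk0] at h5
  have h6 : (fun z => (k * ‖g z‖) ^ r) = fun z => (k ^ r) • ‖g z‖ ^ r := by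
    ext z; rw [Real.mul_rpow hk0.le (norm_nonneg _)]; rfl
  rw [h6, circleAverage_fun_smul, Real.mul_rpow hk0.le (norm_nonneg _), smul_eq_mul] at h5
  exact le_of_mul_le_mul_left h5 (Real.rpow_pos_of_pos hk0 r)

end

section
open MeasureTheory Real Complex
open scoped ENNReal NNReal

theorem enorm_rpow_eq_ofReal {z : ℂ} {r : ℝ} (hr : 0 ≤ r) : ‖z‖ₑ ^ r = ENNReal.ofReal (‖z‖ ^ r) := by
  rw [← ofReal_norm, ENNReal.ofReal_rpow_of_nonneg (norm_nonneg _) hr]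

theorem lint_submean {g : ℂ → ℂ} {c : ℂ} {R r : ℝ} (hR : 0 < R) (hr : 0 < r)
    (hg : AnalyticOnNhd ℂ g (Metric.closedBall c R)) :
    ENNReal.ofReal (2 * π) * ‖g c‖ₑ ^ r ≤
      ∫⁻ θ in Set.Ioc (-π) π, ‖g (circleMap c R θ)‖ₑ ^ r := by
  have h := rpow_submean hR hr hg
  rw [circleAverage_eq_integral_add (-π)] at h
  have h2 : (∫ θ in (0)..(2 * π), (fun z => ‖g z‖ ^ r) (circleMap c R (θ + -π))) =
      ∫ θ in (-π)..π, ‖g (circleMap c R θ)‖ ^ r := by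
    rw [intervalIntegral.integral_comp_add_right (fun θ => ‖g (circleMap c R θ)‖ ^ r)]
    congr 1 <;> ring
  rw [h2, intervalIntegral.integral_of_le (by linarith [Real.pi_pos]), smul_eq_mul] at h
  have hcont : Continuous (fun θ : ℝ => ‖g (circleMap c R θ)‖ ^ r) := by
    rw [continuous_iff_continuousAt]
    intro θ
    have h1 : ContinuousAt g (circleMap c R θ) :=
      (hg _ (Metric.sphere_subset_closedBall (circleMap_mem_sphere c hR.le θ))).continuousAt
    exact ((ContinuousAt.comp (f := circleMap c R) h1
      (continuous_circleMap c R).continuousAt).norm).rpow_const (Or.inr hr.le)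
  have hIntg : IntegrableOn (fun θ : ℝ => ‖g (circleMap c R θ)‖ ^ r) (Set.Ioc (-π) π) :=
    (hcont.integrableOn_Icc).mono_set Set.Ioc_subset_Icc_self
  have h3 := ofReal_integral_eq_lintegral_ofReal hIntg
    (Filter.Eventually.of_forall fun θ => by positivity)
  calc ENNReal.ofReal (2 * π) * ‖g c‖ₑ ^ r = ENNReal.ofReal (2 * π * ‖g c‖ ^ r) := by
        rw [enorm_rpow_eq_ofReal hr.le, ← ENNReal.ofReal_mul (by positivity)]
    _ ≤ ENNReal.ofReal (∫ θ in Set.Ioc (-π) π, ‖g (circleMap c R θ)‖ ^ r) := by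
        apply ENNReal.ofReal_le_ofReal
        have hpi : (0:ℝ) < 2 * π := by positivity
        rw [inv_mul_eq_div, le_div_iff₀ hpi] at h
        linarith
    _ = _ := by
        rw [h3]
        congr 1; ext θ; rw [enorm_rpow_eq_ofReal hr.le]

theorem area_submean {g : ℂ → ℂ} {c : ℂ} {R r : ℝ} (hR : 0 < R) (hr : 0 < r)
    (hg : Differentiable ℂ g) :
    ENNReal.ofReal (π * R ^ 2) * ‖g c‖ₑ ^ r ≤ ∫⁻ z in Metric.ball c R, ‖g z‖ₑ ^ r := by
  have hmeas : Measurable (fun z : ℂ => ‖g z‖ₑ ^ r) := by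
    have := hg.continuous.measurable; fun_prop
  have e1 : ∫⁻ z in Metric.ball c R, ‖g z‖ₑ ^ r =
      ∫⁻ z : ℂ, (Metric.ball (0:ℂ) R).indicator (fun z => ‖g (c + z)‖ₑ ^ r) z := by
    rw [← lintegral_indicator Metric.isOpen_ball.measurableSet,
      ← lintegral_add_left_eq_self (μ := (volume : Measure ℂ)) _ c]
    congr 1; ext z
    simp [Set.indicator, dist_eq_norm]
  rw [e1, ← Complex.lintegral_comp_polarCoord_symm, polarCoord_target, Measure.volume_eq_prod,
    ← Measure.prod_restrict, lintegral_prod]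
  swap
  · apply Measurable.aemeasurable
    apply Measurable.mul (by fun_prop)
    apply Measurable.comp (g := (Metric.ball (0:ℂ) R).indicator (fun z => ‖g (c + z)‖ₑ ^ r))
    · apply Measurable.indicator _ Metric.isOpen_ball.measurableSet
      exact hmeas.comp (measurable_const_add c)
    · have : Measurable fun p : ℝ × ℝ => (p.1 : ℂ) * (Real.cos p.2 + Real.sin p.2 * I) := by
        fun_prop
      convert this using 2 with p
      rw [Complex.polarCoord_symm_apply]
  calc ENNReal.ofReal (π * R ^ 2) * ‖g c‖ₑ ^ r
      = ∫⁻ ρ in Set.Ioo 0 R, ENNReal.ofReal ρ * (ENNReal.ofReal (2 * π) * ‖g c‖ₑ ^ r) := by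
        rw [lintegral_mul_const _ (by fun_prop), ← mul_assoc]
        congr 1
        have h1 : ∫⁻ ρ in Set.Ioo 0 R, ENNReal.ofReal ρ = ENNReal.ofReal (R ^ 2 / 2) := by
          rw [restrict_Ioo_eq_restrict_Ioc, ← ofReal_integral_eq_lintegral_ofReal]
          · rw [← intervalIntegral.integral_of_le hR.le, integral_id]; simp
          · exact (continuous_id.integrableOn_Icc).mono_set Set.Ioc_subset_Icc_self
          · filter_upwards [ae_restrict_mem measurableSet_Ioc] with x hx using hx.1.le
        rw [h1, ← ENNReal.ofReal_mul (by positivity)]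
        congr 1; ring
    _ ≤ ∫⁻ ρ in Set.Ioo 0 R, ∫⁻ θ in Set.Ioo (-π) π, ENNReal.ofReal ρ •
          (Metric.ball (0:ℂ) R).indicator (fun z => ‖g (c + z)‖ₑ ^ r)
            (Complex.polarCoord.symm (ρ, θ)) := by
        apply setLIntegral_mono' measurableSet_Ioo
        intro ρ hρ
        simp only [smul_eq_mul]
        rw [lintegral_const_mul' _ _ ENNReal.ofReal_ne_top]
        gcongr
        rw [restrict_Ioo_eq_restrict_Ioc]
        refine (lint_submean hρ.1 hr (fun z _ => hg.analyticAt z)).trans (le_of_eq ?_)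
        congr 1; ext θ
        have h1 : Complex.polarCoord.symm (ρ, θ) = circleMap 0 ρ θ := by
          rw [Complex.polarCoord_symm_apply, circleMap, Complex.exp_mul_I]; simp
        have h2 : circleMap 0 ρ θ ∈ Metric.ball (0:ℂ) R := by
          simp [abs_of_pos hρ.1, hρ.2]
        rw [h1, Set.indicator_of_mem h2]
        congr 3
        simp [circleMap]
    _ ≤ _ := by
        apply lintegral_mono_set
        intro x hx; exact hx.1

end

section
open MeasureTheory Real Complex
open scoped ENNReal NNReal Topology
open Filter

/-- normalized Poisson kernel -/
noncomputable def pker (t : ℝ) : ℝ≥0∞ := ENNReal.ofReal ((π * (1 + t ^ 2))⁻¹)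

theorem cayley_bdry (t : ℝ) :
    I * (1 - circleMap 0 1 (2 * Real.arctan t)) / (1 + circleMap 0 1 (2 * Real.arctan t)) = (t : ℂ) := by
  set a := Real.arctan t with ha
  have hC : 0 < Real.cos a := Real.cos_arctan_pos t
  have ht : t = Real.sin a / Real.cos a := by
    rw [← Real.tan_eq_sin_div_cos, ha, Real.tan_arctan]
  have hcm : circleMap 0 1 (2 * a) = ((Real.cos a : ℂ) + Real.sin a * I) ^ 2 := by
    rw [circleMap]
    have : ((2 * a : ℝ) : ℂ) * I = a * I + a * I := by push_cast; ring
    rw [this, Complex.exp_add, Complex.exp_mul_I]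
    push_cast; ring
  have hsc : ((Real.cos a : ℂ)) ^ 2 + (Real.sin a : ℂ) ^ 2 = 1 := by
    exact_mod_cast Real.cos_sq_add_sin_sq a
  rw [hcm, ht]
  push_cast
  rw [← ofReal_cos, ← ofReal_sin]
  set C : ℂ := (Real.cos a : ℂ)
  set S : ℂ := (Real.sin a : ℂ)
  have hC0 : C ≠ 0 := by simp only [C]; exact_mod_cast hC.ne'
  have h1 : 1 + (C + S * I) ^ 2 = 2 * C * (C + S * I) := by
    rw [← hsc]; linear_combination (S ^ 2) * I_sq
  have h2 : C + S * I ≠ 0 := by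
    intro h
    have h3 := congrArg Complex.re h
    simp [C, S] at h3
    rw [← ofReal_cos, ofReal_re] at h3
    exact hC.ne' h3
  rw [div_eq_div_iff (by rw [h1]; exact mul_ne_zero (mul_ne_zero two_ne_zero hC0) h2) hC0]
  rw [← hsc]
  linear_combination (-2 * C ^ 2 * S - S^2 * C * I - S^3) * I_sq

theorem cayley_im {w : ℂ} (hw : 1 + w ≠ 0) :
    (I * (1 - w) / (1 + w)).im = (1 - ‖w‖ ^ 2) / normSq (1 + w) := by
  rw [Complex.div_im, ← Complex.normSq_eq_norm_sq]
  have : normSq (1 + w) ≠ 0 := by simpa using hw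
  simp only [mul_re, mul_im, I_re, I_im, sub_re, sub_im, one_re, one_im, add_re, add_im, normSq_apply] at this ⊢
  field_simp
  ring

theorem one_add_ne {w : ℂ} (hw : ‖w‖ < 1) : 1 + w ≠ 0 := by
  intro h
  have : w = -1 := by linear_combination h
  rw [this] at hw; simp at hw

theorem poisson_bdd {H : ℂ → ℂ} {M : ℝ} (hd : DifferentiableOn ℂ H {z | 0 < z.im})
    (hc : ContinuousOn H {z | 0 ≤ z.im}) (hb : ∀ z : ℂ, 0 ≤ z.im → ‖H z‖ ≤ M)
    {x₀ y₀ r : ℝ} (hy : 0 < y₀) (hr : 0 < r) :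
    ‖H (x₀ + y₀ * I)‖ₑ ^ r ≤ ∫⁻ t : ℝ, pker t * ‖H ((x₀ + y₀ * t : ℝ))‖ₑ ^ r := by
  set c : ℂ → ℂ := fun w => x₀ + y₀ * (I * (1 - w) / (1 + w)) with hcdef
  have hcim : ∀ w : ℂ, 1 + w ≠ 0 → (c w).im = y₀ * ((1 - ‖w‖ ^ 2) / normSq (1 + w)) := by
    intro w hw
    have := cayley_im hw
    simp only [hcdef, add_im, ofReal_im, zero_add, im_ofReal_mul]
    rw [this]
  have hcd : ∀ w : ℂ, 1 + w ≠ 0 → DifferentiableAt ℂ c w := by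
    intro w hw
    simp only [hcdef]
    fun_prop (disch := assumption)
  set G : ℂ → ℂ := fun w => H (c w) with hG
  have hGd : DifferentiableOn ℂ G (Metric.ball 0 1) := by
    intro w hw
    have hw1 : ‖w‖ < 1 := by simpa using hw
    have hne := one_add_ne hw1
    apply DifferentiableAt.differentiableWithinAt
    have h1 : 0 < (c w).im := by
      rw [hcim w hne]
      have : 0 < normSq (1 + w) := by simpa [normSq_pos] using hne
      have : 0 < 1 - ‖w‖ ^ 2 := by nlinarith [norm_nonneg w]
      positivity
    have h2 : DifferentiableAt ℂ H (c w) :=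
      (hd _ h1).differentiableAt ((isOpen_lt continuous_const continuous_im).mem_nhds h1)
    exact h2.comp w (hcd w hne)
  have hGa : AnalyticOnNhd ℂ G (Metric.ball 0 1) := hGd.analyticOnNhd Metric.isOpen_ball
  set ρ : ℕ → ℝ := fun n => 1 - 1 / ((n : ℝ) + 2) with hρ
  have hρ0 : ∀ n, 0 < ρ n := by
    intro n; simp only [hρ]
    have : (1:ℝ) / ((n : ℝ) + 2) < 1 := by rw [div_lt_one (by positivity)]; linarith [n.cast_nonneg (α := ℝ)]
    linarith
  have hρ1 : ∀ n, ρ n < 1 := by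
    intro n; simp only [hρ]
    have : (0:ℝ) < 1 / ((n : ℝ) + 2) := by positivity
    linarith
  have hρt : Tendsto ρ atTop (𝓝 1) := by
    have : Tendsto (fun n : ℕ => (1:ℝ) / ((n : ℝ) + 2)) atTop (𝓝 0) := by
      apply Tendsto.div_atTop tendsto_const_nhds
      exact tendsto_atTop_add_const_right _ _ tendsto_natCast_atTop_atTop
    simpa [hρ] using (tendsto_const_nhds (x := (1:ℝ))).sub this
  have hsub : ∀ n, ENNReal.ofReal (2 * π) * ‖G 0‖ₑ ^ r ≤
      ∫⁻ θ in Set.Ioo (-π) π, ‖G (circleMap 0 (ρ n) θ)‖ₑ ^ r := by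
    intro n
    rw [restrict_Ioo_eq_restrict_Ioc]
    apply lint_submean (hρ0 n) hr
    exact hGa.mono (Metric.closedBall_subset_ball (hρ1 n))
  have hmem : ∀ n θ, circleMap 0 (ρ n) θ ∈ Metric.ball (0:ℂ) 1 := by
    intro n θ; simp [abs_of_pos (hρ0 n), hρ1 n]
  have hlim : Tendsto (fun n => ∫⁻ θ in Set.Ioo (-π) π, ‖G (circleMap 0 (ρ n) θ)‖ₑ ^ r) atTop
      (𝓝 (∫⁻ θ in Set.Ioo (-π) π, ‖G (circleMap 0 1 θ)‖ₑ ^ r)) := by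
    apply tendsto_lintegral_of_dominated_convergence (fun _ => ENNReal.ofReal (M ^ r))
    · intro n
      have : Continuous fun θ => ‖G (circleMap 0 (ρ n) θ)‖ₑ ^ r := by
        have h1 : Continuous fun θ => G (circleMap 0 (ρ n) θ) := by
          rw [continuous_iff_continuousAt]
          intro θ
          exact ContinuousAt.comp (f := circleMap 0 (ρ n)) (hGa _ (hmem n θ)).continuousAt
            (continuous_circleMap _ _).continuousAt
        exact (ENNReal.continuous_rpow_const).comp h1.enorm
      exact this.measurable
    · intro n
      apply Eventually.of_forall
      intro θ
      simp only
      rw [enorm_rpow_eq_ofReal hr.le]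
      apply ENNReal.ofReal_le_ofReal
      apply Real.rpow_le_rpow (norm_nonneg _) _ hr.le
      apply hb
      have hw1 : ‖circleMap 0 (ρ n) θ‖ < 1 := by simpa using hmem n θ
      have hne := one_add_ne hw1
      rw [hcim _ hne]
      have : 0 < 1 - ‖circleMap 0 (ρ n) θ‖ ^ 2 := by nlinarith [norm_nonneg (circleMap 0 (ρ n) θ)]
      have := normSq_nonneg (1 + circleMap 0 (ρ n) θ)
      positivity
    · simp [ENNReal.mul_eq_top]
    · filter_upwards [ae_restrict_mem measurableSet_Ioo] with θ hθ
      have hne : 1 + circleMap 0 1 θ ≠ 0 := by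
        have hcos : 0 < Real.cos (θ / 2) := Real.cos_pos_of_mem_Ioo ⟨by linarith [hθ.1], by linarith [hθ.2]⟩
        intro h
        have h3 := congrArg Complex.re h
        simp [circleMap, Complex.exp_mul_I] at h3
        rw [← ofReal_cos, ofReal_re] at h3
        have h4 : Real.cos θ = 2 * Real.cos (θ / 2) ^ 2 - 1 := by
          rw [← Real.cos_two_mul]; congr 1; ring
        nlinarith
      have h1 : Tendsto (fun n => circleMap 0 (ρ n) θ) atTop (𝓝 (circleMap 0 1 θ)) := by
        simp only [circleMap]
        have : Tendsto (fun n => ((ρ n : ℝ) : ℂ)) atTop (𝓝 ((1:ℝ) : ℂ)) :=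
          (continuous_ofReal.tendsto 1).comp hρt
        exact (tendsto_const_nhds.add (this.mul_const _))
      have h2 : Tendsto (fun n => c (circleMap 0 (ρ n) θ)) atTop (𝓝 (c (circleMap 0 1 θ))) :=
        ((hcd _ hne).continuousAt.tendsto).comp h1
      have h3 : Tendsto (fun n => c (circleMap 0 (ρ n) θ)) atTop
          (𝓝[{z | 0 ≤ z.im}] (c (circleMap 0 1 θ))) := by
        rw [tendsto_nhdsWithin_iff]
        refine ⟨h2, Eventually.of_forall fun n => ?_⟩
        have hw1 : ‖circleMap 0 (ρ n) θ‖ < 1 := by simpa using hmem n θ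
        have hne := one_add_ne hw1
        simp only [Set.mem_ofPred_eq]
        rw [hcim _ hne]
        have : 0 < 1 - ‖circleMap 0 (ρ n) θ‖ ^ 2 := by nlinarith [norm_nonneg (circleMap 0 (ρ n) θ)]
        have := normSq_nonneg (1 + circleMap 0 (ρ n) θ)
        positivity
      have h4 : ContinuousWithinAt H {z | 0 ≤ z.im} (c (circleMap 0 1 θ)) := by
        apply hc
        simp only [Set.mem_ofPred_eq]
        rw [hcim _ hne]
        simp
      have h5 : Tendsto (fun n => G (circleMap 0 (ρ n) θ)) atTop (𝓝 (G (circleMap 0 1 θ))) :=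
        h4.tendsto.comp h3
      exact (ENNReal.continuous_rpow_const.tendsto _).comp ((continuous_enorm.tendsto _).comp h5)
  have hfin := ge_of_tendsto' hlim hsub
  have himg : Set.Ioo (-π) π = (fun t => 2 * Real.arctan t) '' Set.univ := by
    ext θ
    simp only [Set.mem_image, Set.mem_univ, true_and]
    constructor
    · intro h
      exact ⟨Real.tan (θ / 2), by rw [Real.arctan_tan (by linarith [h.1]) (by linarith [h.2])]; ring⟩
    · rintro ⟨t, rfl⟩
      constructor
      · linarith [Real.neg_pi_div_two_lt_arctan t]
      · linarith [Real.arctan_lt_pi_div_two t]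
  rw [himg, lintegral_image_eq_lintegral_abs_deriv_mul MeasurableSet.univ
    (f' := fun t => 2 * (1 / (1 + t ^ 2)))
    (fun t _ => ((Real.hasDerivAt_arctan t).const_mul 2).hasDerivWithinAt)
    (fun a _ b _ h => Real.arctan_injective (by simpa using h))] at hfin
  have hG0 : G 0 = H (x₀ + y₀ * I) := by simp [hG, hcdef]
  rw [hG0] at hfin
  have hpi : ENNReal.ofReal (2 * π) ≠ 0 := by simp [Real.pi_pos]
  rw [← ENNReal.mul_le_mul_iff_right hpi ENNReal.ofReal_ne_top]
  refine hfin.trans (le_of_eq ?_)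
  rw [← lintegral_const_mul' _ _ ENNReal.ofReal_ne_top, Measure.restrict_univ]
  congr 1; ext t
  rw [← mul_assoc]
  congr 1
  · rw [pker, ← ENNReal.ofReal_mul (by positivity), abs_of_pos (by positivity)]
    congr 1
    field_simp
  · simp only [hG, hcdef]
    rw [cayley_bdry]
    push_cast; rfl

theorem re_cpow_ge {z : ℂ} (hz : 0 ≤ z.im) :
    ‖z‖ ^ (3/4 : ℝ) * Real.cos (3 * π / 8) ≤ ((-I * z) ^ ((3/4 : ℝ) : ℂ)).re := by
  rw [Complex.cpow_ofReal_re]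
  have h0 : ‖-I * z‖ = ‖z‖ := by simp
  rw [h0]
  gcongr
  have h1 : |arg (-I * z)| ≤ π / 2 := by
    rw [Complex.abs_arg_le_pi_div_two_iff]; simpa using hz
  rw [← Real.cos_abs (arg (-I * z) * (3/4))]
  apply Real.cos_le_cos_of_nonneg_of_le_pi (abs_nonneg _)
  · linarith [Real.pi_pos]
  · rw [abs_mul, abs_of_pos (by norm_num : (0:ℝ) < 3/4)]; linarith

theorem cos_three_pi_eight_pos : 0 < Real.cos (3 * π / 8) :=
  Real.cos_pos_of_mem_Ioo ⟨by linarith [Real.pi_pos], by linarith [Real.pi_pos]⟩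

theorem poisson_growth {H : ℂ → ℂ} {C : ℝ} (hd : DifferentiableOn ℂ H {z | 0 < z.im})
    (hc : ContinuousOn H {z | 0 ≤ z.im}) (hC : 0 < C)
    (hb : ∀ z : ℂ, 0 ≤ z.im → ‖H z‖ ≤ C * Real.exp (C * ‖z‖ ^ (1/2 : ℝ)))
    {x₀ y₀ r : ℝ} (hy : 0 < y₀) (hr : 0 < r) :
    ‖H (x₀ + y₀ * I)‖ₑ ^ r ≤ ∫⁻ t : ℝ, pker t * ‖H ((x₀ + y₀ * t : ℝ))‖ₑ ^ r := by
  set W : ℂ → ℂ := fun z => (-I * z) ^ ((3/4 : ℝ) : ℂ) with hW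
  have hWre : ∀ z : ℂ, 0 ≤ z.im → 0 ≤ (W z).re := fun z hz =>
    le_trans (by have := cos_three_pi_eight_pos; positivity) (re_cpow_ge hz)
  have key : ∀ ε > 0, ‖Complex.exp (-(ε:ℝ) * W (x₀ + y₀ * I)) * H (x₀ + y₀ * I)‖ₑ ^ r ≤
      ∫⁻ t : ℝ, pker t * ‖H ((x₀ + y₀ * t : ℝ))‖ₑ ^ r := by
    intro ε hε
    have hnorm : ∀ z : ℂ, ‖Complex.exp (-(ε:ℝ) * W z)‖ = Real.exp (-(ε * (W z).re)) := by
      intro z; rw [Complex.norm_exp]; simp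
    set b := ε * Real.cos (3 * π / 8) with hb'
    have hbpos : 0 < b := mul_pos hε cos_three_pi_eight_pos
    refine (poisson_bdd (H := fun z => Complex.exp (-(ε:ℝ) * W z) * H z)
      (M := C * Real.exp (C * (C / b) ^ 2)) ?_ ?_ ?_ hy hr).trans ?_
    · intro z hz
      have hz' : 0 < z.im := hz
      have : DifferentiableAt ℂ W z := by
        simp only [hW]
        apply DifferentiableAt.cpow_const (by fun_prop)
        left; simpa using hz'
      exact ((this.const_mul _).cexp.differentiableWithinAt).mul (hd z hz)
    · intro z hz
      have hz' : 0 ≤ z.im := hz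
      have : ContinuousAt W z := by
        simp only [hW]
        by_cases h0 : z = 0
        · have h1 : ContinuousAt (fun w : ℂ => w ^ ((3/4 : ℝ) : ℂ)) (-I * z) :=
            Complex.continuousAt_cpow_const_of_re_pos (by left; simpa using hz') (by simp)
          exact ContinuousAt.comp (f := fun z => -I * z) h1 (by fun_prop)
        · have h1 : ContinuousAt (fun w : ℂ => w ^ ((3/4 : ℝ) : ℂ)) (-I * z) :=
            Complex.continuousAt_cpow_const_of_re_pos (by left; simpa using hz') (by simp)
          exact ContinuousAt.comp (f := fun z => -I * z) h1 (by fun_prop)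
      exact ((this.const_mul _).cexp.continuousWithinAt).mul (hc z hz)
    · intro z hz
      rw [norm_mul, hnorm]
      have h1 := re_cpow_ge hz
      set u := ‖z‖ ^ (1/4 : ℝ) with hu
      have hu0 : 0 ≤ u := by positivity
      have hu2 : ‖z‖ ^ (1/2 : ℝ) = u ^ 2 := by
        rw [hu, ← Real.rpow_natCast, ← Real.rpow_mul (norm_nonneg _)]; norm_num
      have hu3 : ‖z‖ ^ (3/4 : ℝ) = u ^ 3 := by
        rw [hu, ← Real.rpow_natCast, ← Real.rpow_mul (norm_nonneg _)]; norm_num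
      have h2 := hb z hz
      rw [hu2] at h2
      rw [hu3] at h1
      have h3 : b * u ^ 3 ≤ ε * (W z).re := by
        calc b * u ^ 3 = ε * (u ^ 3 * Real.cos (3 * π / 8)) := by rw [hb']; ring
          _ ≤ _ := by gcongr
      have h4 : C * u ^ 2 - b * u ^ 3 ≤ C * (C / b) ^ 2 := by
        rcases le_total u (C / b) with h | h
        · have : C * u ^ 2 ≤ C * (C / b) ^ 2 := by gcongr
          have : 0 ≤ b * u ^ 3 := by positivity
          linarith
        · have h5 : C ≤ b * u := by rw [div_le_iff₀ hbpos] at h; linarith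
          have : 0 ≤ (b * u - C) * u ^ 2 := mul_nonneg (by linarith) (by positivity)
          have : 0 ≤ C * (C / b) ^ 2 := by positivity
          nlinarith
      calc Real.exp (-(ε * (W z).re)) * ‖H z‖ ≤ Real.exp (-(b * u ^ 3)) * (C * Real.exp (C * u ^ 2)) := by
            gcongr
        _ = C * Real.exp (C * u ^ 2 - b * u ^ 3) := by
            rw [sub_eq_neg_add, Real.exp_add]; ring
        _ ≤ _ := by gcongr
    · apply lintegral_mono
      intro t
      simp only
      gcongr
      rw [enorm_mul]
      have : ‖Complex.exp (-(ε:ℝ) * W ((x₀ + y₀ * t : ℝ)))‖ₑ ≤ 1 := by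
        rw [← ofReal_norm, hnorm]
        apply ENNReal.ofReal_le_one.2
        apply Real.exp_le_one_iff.2
        have := hWre ((x₀ + y₀ * t : ℝ)) (by rw [ofReal_im])
        nlinarith
      exact mul_le_of_le_one_left' this
  have hlim : Tendsto (fun ε : ℝ => ‖Complex.exp (-(ε:ℝ) * W (x₀ + y₀ * I)) * H (x₀ + y₀ * I)‖ₑ ^ r)
      (𝓝[>] 0) (𝓝 (‖Complex.exp (-((0:ℝ):ℂ) * W (x₀ + y₀ * I)) * H (x₀ + y₀ * I)‖ₑ ^ r)) := by
    apply Tendsto.mono_left _ nhdsWithin_le_nhds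
    have : Continuous (fun ε : ℝ => ‖Complex.exp (-(ε:ℝ) * W (x₀ + y₀ * I)) * H (x₀ + y₀ * I)‖ₑ ^ r) := by
      apply ENNReal.continuous_rpow_const.comp
      apply Continuous.enorm
      fun_prop
    exact this.tendsto 0
  have := le_of_tendsto hlim (by filter_upwards [self_mem_nhdsWithin] with ε hε using key ε hε)
  simpa using this

end

section
open MeasureTheory Real Complex
open scoped ENNReal NNReal Topology
open Filter

theorem pl_upper {g : ℂ → ℂ} (hg : ExpTypePi g) {M : ℝ} (hM : ∀ x : ℝ, ‖g x‖ ≤ M) {z : ℂ}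
    (hz : 0 ≤ z.im) : ‖g z‖ ≤ M * Real.exp (π * z.im) := by
  have key : ∀ ε > 0, ‖g z‖ ≤ M * Real.exp ((π + ε) * z.im) := by
    intro ε hε
    obtain ⟨C, hC, hb⟩ := hg.2 ε hε
    have hnorm : ∀ w : ℂ, ‖Complex.exp (-((π + ε : ℝ) : ℂ) * w)‖ = Real.exp (-(π + ε) * w.re) := by
      intro w; rw [Complex.norm_exp]; congr 1; simp
    have h := PhragmenLindelof.right_half_plane_of_bounded_on_real (C := M)
      (f := fun w => Complex.exp (-((π + ε : ℝ) : ℂ) * w) * g (I * w)) (z := -I * z) ?_ ?_ ?_ ?_ ?_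
    · simp only [norm_mul, hnorm] at h
      have e1 : I * (-I * z) = z := by rw [← mul_assoc]; simp
      have e2 : (-I * z).re = z.im := by simp
      rw [e1, e2] at h
      calc ‖g z‖ = Real.exp ((π + ε) * z.im) * (Real.exp (-(π + ε) * z.im) * ‖g z‖) := by
            rw [← mul_assoc, ← Real.exp_add, show (π + ε) * z.im + -(π + ε) * z.im = 0 by ring, Real.exp_zero,
              one_mul]
        _ ≤ Real.exp ((π + ε) * z.im) * M := by gcongr
        _ = _ := mul_comm _ _
    · apply Differentiable.diffContOnCl
      have := hg.1
      exact (by fun_prop : Differentiable ℂ fun w => Complex.exp (-((π + ε : ℝ) : ℂ) * w)).mul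
        (this.comp (by fun_prop))
    · refine ⟨1, by norm_num, π + ε, ?_⟩
      apply Asymptotics.IsBigO.of_bound C
      rw [eventually_inf_principal]
      apply Eventually.of_forall
      intro w hw
      have hw' : 0 < w.re := hw
      rw [norm_mul, hnorm, Real.norm_eq_abs, Real.abs_exp, Real.rpow_one]
      have h1 : Real.exp (-(π + ε) * w.re) ≤ 1 := by
        apply Real.exp_le_one_iff.2
        have := Real.pi_pos
        nlinarith
      have h2 := hb (I * w)
      have h3 : ‖I * w‖ = ‖w‖ := by simp
      rw [h3] at h2
      calc _ ≤ 1 * ‖g (I * w)‖ := by gcongr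
        _ ≤ _ := by linarith
    · refine ⟨C, ?_⟩
      rw [eventually_map]
      filter_upwards [eventually_ge_atTop 0] with x hx
      rw [norm_mul, hnorm]
      have h2 := hb (I * x)
      have h3 : ‖I * (x:ℂ)‖ = x := by simp [abs_of_nonneg hx]
      rw [h3] at h2
      calc _ ≤ Real.exp (-(π + ε) * (x:ℂ).re) * (C * Real.exp ((π + ε) * x)) := by gcongr
        _ = C * (Real.exp (-(π + ε) * x) * Real.exp ((π + ε) * x)) := by rw [ofReal_re]; ring
        _ = C := by
            rw [← Real.exp_add, show -(π + ε) * x + (π + ε) * x = 0 by ring, Real.exp_zero, mul_one]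
        _ ≤ C := le_rfl
    · intro x
      rw [norm_mul, hnorm]
      have : I * ((x:ℂ) * I) = ((-x : ℝ) : ℂ) := by push_cast; linear_combination (x:ℂ) * I_sq
      rw [this]
      simpa using hM (-x)
    · simpa using hz
  have hlim : Tendsto (fun ε : ℝ => M * Real.exp ((π + ε) * z.im)) (𝓝[>] 0)
      (𝓝 (M * Real.exp ((π + 0) * z.im))) := by
    apply Tendsto.mono_left _ nhdsWithin_le_nhds
    exact (by fun_prop : Continuous fun ε : ℝ => M * Real.exp ((π + ε) * z.im)).tendsto 0
  have := ge_of_tendsto hlim (by filter_upwards [self_mem_nhdsWithin] with ε hε using key ε hε)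
  simpa using this

theorem ExpTypePi.comp_neg {g : ℂ → ℂ} (hg : ExpTypePi g) : ExpTypePi (fun z => g (-z)) := by
  refine ⟨hg.1.comp (by fun_prop), fun ε hε => ?_⟩
  obtain ⟨C, hC, h⟩ := hg.2 ε hε
  exact ⟨C, hC, fun z => by simpa using h (-z)⟩

theorem ExpTypePi.comp_add {g : ℂ → ℂ} (hg : ExpTypePi g) (a : ℂ) : ExpTypePi (fun z => g (z + a)) := by
  refine ⟨hg.1.comp (by fun_prop), fun ε hε => ?_⟩
  obtain ⟨C, hC, h⟩ := hg.2 ε hε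
  refine ⟨C * Real.exp ((π + ε) * ‖a‖), by positivity, fun z => (h (z + a)).trans ?_⟩
  rw [mul_assoc, ← Real.exp_add, ← mul_add]
  have := norm_add_le z a
  have := Real.pi_pos
  gcongr
  linarith

theorem pl_all {g : ℂ → ℂ} (hg : ExpTypePi g) {M : ℝ} (hM : ∀ x : ℝ, ‖g x‖ ≤ M) (z : ℂ) :
    ‖g z‖ ≤ M * Real.exp (π * |z.im|) := by
  rcases le_total 0 z.im with h | h
  · rw [abs_of_nonneg h]; exact pl_upper hg hM h
  · rw [abs_of_nonpos h]
    have := pl_upper hg.comp_neg (M := M) (fun x => by simpa using hM (-x)) (z := -z) (by simpa using h)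
    simpa using this

theorem ExpTypePi.conj_conj {g : ℂ → ℂ} (hg : ExpTypePi g) :
    ExpTypePi (fun z => (starRingEnd ℂ) (g ((starRingEnd ℂ) z))) := by
  refine ⟨fun z => ?_, fun ε hε => ?_⟩
  · exact differentiableAt_conj_conj_iff.2 (hg.1 _)
  obtain ⟨C, hC, h⟩ := hg.2 ε hε
  exact ⟨C, hC, fun z => by simpa using h ((starRingEnd ℂ) z)⟩

/-- square root on the closed upper half plane -/
noncomputable def usqrt (z : ℂ) : ℂ := (1 + I) / (Real.sqrt 2 : ℝ) * (-I * z) ^ ((1/2 : ℝ) : ℂ)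

theorem usqrt_sq (z : ℂ) : usqrt z ^ 2 = z := by
  have h1 : ((-I * z) ^ ((1/2 : ℝ) : ℂ)) ^ 2 = -I * z := by
    have := Complex.cpow_nat_inv_pow (-I * z) (n := 2) two_ne_zero
    convert this using 3
    push_cast; ring
  have h2 : ((Real.sqrt 2 : ℝ) : ℂ) ^ 2 = 2 := by
    exact_mod_cast Real.sq_sqrt (by norm_num : (0:ℝ) ≤ 2)
  rw [usqrt, mul_pow, h1, div_pow, h2]
  linear_combination (- z / 2 * I - z) * I_sq

theorem usqrt_quad {z : ℂ} (hz : 0 ≤ z.im) : 0 ≤ (usqrt z).re ∧ 0 ≤ (usqrt z).im := by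
  set v := (-I * z) ^ ((1/2 : ℝ) : ℂ) with hv
  have h1 : v ^ 2 = -I * z := by
    have := Complex.cpow_nat_inv_pow (-I * z) (n := 2) two_ne_zero
    convert this using 3
    push_cast; ring
  have h2 : 0 ≤ v.re := by
    rw [hv, Complex.cpow_ofReal_re]
    apply mul_nonneg (by positivity)
    apply Real.cos_nonneg_of_mem_Icc
    have := Complex.arg_le_pi (-I * z)
    have := Complex.neg_pi_lt_arg (-I * z)
    constructor <;> linarith
  have h3 : v.im ^ 2 ≤ v.re ^ 2 := by
    have := congrArg Complex.re h1
    rw [sq] at this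
    simp at this
    nlinarith
  have h4 : |v.im| ≤ v.re := by
    have := abs_le_of_sq_le_sq' h3 h2
    exact abs_le.2 this
  have h5 := abs_le.1 h4
  have e : usqrt z = (((Real.sqrt 2)⁻¹ : ℝ) : ℂ) * ((1 + I) * v) := by
    rw [usqrt, hv]; push_cast; ring
  rw [e, re_ofReal_mul, im_ofReal_mul]
  constructor
  · apply mul_nonneg (by positivity); simp; linarith
  · apply mul_nonneg (by positivity); simp; linarith

theorem usqrt_unique {z w : ℂ} (hz : 0 ≤ z.im) (hw : w ^ 2 = z) (h1 : 0 ≤ w.re) (h2 : 0 ≤ w.im) :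
    usqrt z = w := by
  have h := usqrt_sq z
  obtain ⟨a, b⟩ := usqrt_quad hz
  rw [← hw] at h
  rcases sq_eq_sq_iff_eq_or_eq_neg.1 h with h | h
  · rw [hw] at h; exact h
  · rw [hw] at h
    rw [h] at a b
    simp at a b
    have : w = 0 := Complex.ext (le_antisymm a h1) (le_antisymm b h2)
    rw [h, this, neg_zero]

theorem usqrt_norm (z : ℂ) : ‖usqrt z‖ = ‖z‖ ^ (1/2 : ℝ) := by
  have h := congrArg norm (usqrt_sq z)
  rw [norm_pow] at h
  rw [← Real.sqrt_eq_rpow, ← h, Real.sqrt_sq (norm_nonneg _)]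

theorem usqrt_cont {z : ℂ} (hz : 0 ≤ z.im) : ContinuousAt usqrt z := by
  unfold usqrt
  apply ContinuousAt.mul continuousAt_const
  have h1 : ContinuousAt (fun w : ℂ => w ^ ((1/2 : ℝ) : ℂ)) (-I * z) :=
    Complex.continuousAt_cpow_const_of_re_pos (by left; simpa using hz) (by simp)
  exact ContinuousAt.comp (f := fun z => -I * z) h1 (by fun_prop)

theorem usqrt_diff {z : ℂ} (hz : 0 < z.im) : DifferentiableAt ℂ usqrt z := by
  unfold usqrt
  apply DifferentiableAt.const_mul
  apply DifferentiableAt.cpow_const (by fun_prop)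
  left; simpa using hz

theorem lintegral_pker : ∫⁻ t, pker t = 1 := by
  have h : ∀ t : ℝ, pker t = ENNReal.ofReal (π⁻¹ * (1 + t ^ 2)⁻¹) := by
    intro t; rw [pker, mul_inv]
  simp_rw [h]
  rw [← ofReal_integral_eq_lintegral_ofReal]
  · rw [integral_const_mul, integral_univ_inv_one_add_sq, inv_mul_cancel₀ Real.pi_ne_zero,
      ENNReal.ofReal_one]
  · exact integrable_inv_one_add_sq.const_mul _
  · exact Eventually.of_forall fun t => by simp only [Pi.zero_apply]; positivity

theorem measurable_pker : Measurable pker := by unfold pker; fun_prop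

theorem quad_bound {f : ℂ → ℂ} (hf : ExpTypePi f) {p : ℝ} (hp : 0 < p) {C : ℝ} (hC : 0 < C)
    (hb : ∀ z : ℂ, ‖f z‖ ≤ C * Real.exp ((π + 1) * ‖z‖)) {x : ℝ} (hx : 0 < x) :
    ‖Complex.exp (I * ((π + 1 : ℝ) : ℂ) * (x + I)) * f (x + I)‖ₑ ^ p ≤
      ENNReal.ofReal (C ^ p) + ∫⁻ x : ℝ, ‖f x‖ₑ ^ p := by
  set F : ℂ → ℂ := fun z => Complex.exp (I * ((π + 1 : ℝ) : ℂ) * z) * f z with hF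
  have hnorm : ∀ z : ℂ, ‖F z‖ = Real.exp (-((π + 1) * z.im)) * ‖f z‖ := by
    intro z; simp only [hF]; rw [norm_mul, Complex.norm_exp]; congr 2; simp
  have hFd : Differentiable ℂ F := by
    have := hf.1
    exact (by fun_prop : Differentiable ℂ fun z => Complex.exp (I * ((π + 1 : ℝ) : ℂ) * z)).mul this
  have hpi := Real.pi_pos
  set C' := max C (π + 1) with hC'
  have hC'0 : 0 < C' := lt_of_lt_of_le hC (le_max_left _ _)
  have hpo := poisson_growth (H := fun z => F (usqrt z)) (C := C') ?_ ?_ hC'0 ?_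
    (x₀ := x ^ 2 - 1) (y₀ := 2 * x) (by positivity) hp
  · have e1 : usqrt (((x ^ 2 - 1 : ℝ) : ℂ) + ((2 * x : ℝ) : ℂ) * I) = x + I := by
      apply usqrt_unique
      · rw [add_im, ofReal_im, im_ofReal_mul]; simp; exact hx.le
      · push_cast; linear_combination I_sq
      · simp; exact hx.le
      · simp
    rw [e1] at hpo
    refine hpo.trans ?_
    have hpt : ∀ t : ℝ, pker t * ‖F (usqrt ((x ^ 2 - 1 + 2 * x * t : ℝ)))‖ₑ ^ p ≤
        pker t * ENNReal.ofReal (C ^ p) +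
        ((fun s : ℝ => (s ^ 2 - (x ^ 2 - 1)) / (2 * x)) '' (Set.Ioi 0)).indicator
          (fun t => pker t * ‖f (Real.sqrt (x ^ 2 - 1 + 2 * x * t))‖ₑ ^ p) t := by
      intro t
      set u := x ^ 2 - 1 + 2 * x * t with hu
      rcases lt_or_ge 0 u with h | h
      · have hmem : t ∈ (fun s : ℝ => (s ^ 2 - (x ^ 2 - 1)) / (2 * x)) '' (Set.Ioi 0) := by
          refine ⟨Real.sqrt u, Real.sqrt_pos.2 h, ?_⟩
          simp only
          rw [Real.sq_sqrt h.le, hu]; field_simp; ring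
        rw [Set.indicator_of_mem hmem]
        refine le_trans (le_of_eq ?_) le_add_self
        have e2 : usqrt (u : ℂ) = (Real.sqrt u : ℝ) := by
          apply usqrt_unique
          · simp
          · exact_mod_cast Real.sq_sqrt h.le
          · simp
          · simp
        rw [e2]
        congr 2
        rw [← ofReal_norm, ← ofReal_norm, hnorm]
        simp [hu]
      · refine le_trans ?_ le_self_add
        gcongr
        have e2 : usqrt (u : ℂ) = (Real.sqrt (-u) : ℝ) * I := by
          apply usqrt_unique
          · simp
          · rw [mul_pow, I_sq]
            have : ((Real.sqrt (-u) : ℝ) : ℂ) ^ 2 = ((-u : ℝ) : ℂ) := by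
              exact_mod_cast Real.sq_sqrt (by linarith)
            rw [this]; push_cast; ring
          · simp
          · simp
        rw [e2, enorm_rpow_eq_ofReal hp.le]
        apply ENNReal.ofReal_le_ofReal
        apply Real.rpow_le_rpow (norm_nonneg _) _ hp.le
        rw [hnorm]
        have h3 := hb ((Real.sqrt (-u) : ℝ) * I)
        have h4 : ‖((Real.sqrt (-u) : ℝ) : ℂ) * I‖ = Real.sqrt (-u) := by
          simp [abs_of_nonneg]
        rw [h4] at h3
        have h5 : (((Real.sqrt (-u) : ℝ) : ℂ) * I).im = Real.sqrt (-u) := by simp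
        rw [h5]
        calc _ ≤ Real.exp (-((π + 1) * √(-u))) * (C * Real.exp ((π + 1) * √(-u))) := by gcongr
          _ = C * (Real.exp (-((π + 1) * √(-u))) * Real.exp ((π + 1) * √(-u))) := by ring
          _ = C := by rw [← Real.exp_add]; simp
          _ ≤ C := le_rfl
    refine (lintegral_mono hpt).trans ?_
    rw [lintegral_add_left (measurable_pker.mul_const _), lintegral_mul_const _ measurable_pker,
      lintegral_pker, one_mul]
    refine add_le_add le_rfl ?_
    have hmeas : MeasurableSet ((fun s : ℝ => (s ^ 2 - (x ^ 2 - 1)) / (2 * x)) '' (Set.Ioi 0)) := by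
      apply measurableSet_Ioi.image_of_continuousOn_injOn (by fun_prop)
      intro a ha b hb h
      simp only [Set.mem_Ioi] at ha hb
      have : a ^ 2 = b ^ 2 := by
        simp only at h
        field_simp at h
        linarith
      exact (pow_left_inj₀ ha.le hb.le two_ne_zero).1 this
    rw [lintegral_indicator hmeas, lintegral_image_eq_lintegral_abs_deriv_mul measurableSet_Ioi
      (f' := fun s => 2 * s / (2 * x))]
    · refine le_trans ?_ (setLIntegral_le_lintegral (Set.Ioi 0) _)
      apply setLIntegral_mono' measurableSet_Ioi
      intro s hs
      have hs' : 0 < s := hs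
      have e3 : x ^ 2 - 1 + 2 * x * ((s ^ 2 - (x ^ 2 - 1)) / (2 * x)) = s ^ 2 := by field_simp; ring
      rw [e3, Real.sqrt_sq hs'.le, ← mul_assoc]
      apply mul_le_of_le_one_left'
      rw [pker, ← ENNReal.ofReal_mul (by positivity), abs_of_pos (by positivity)]
      apply ENNReal.ofReal_le_one.2
      have e4 : 2 * s / (2 * x) * (π * (1 + ((s ^ 2 - (x ^ 2 - 1)) / (2 * x)) ^ 2))⁻¹ =
        4 * s * x / (π * (((s - x) ^ 2 + 1) * ((s + x) ^ 2 + 1))) := by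
        have : 4 * x ^ 2 + (s ^ 2 - (x ^ 2 - 1)) ^ 2 = ((s - x) ^ 2 + 1) * ((s + x) ^ 2 + 1) := by ring
        rw [← this]
        have h5 : 0 < 4 * x ^ 2 + (s ^ 2 - (x ^ 2 - 1)) ^ 2 := by positivity
        field_simp
        ring
      rw [e4, div_le_one (by positivity)]
      have h6 : 1 ≤ π := by linarith [Real.pi_gt_three]
      have h7 : 4 * s * x ≤ (s + x) ^ 2 + 1 := by nlinarith [sq_nonneg (s - x)]
      have h8 : (s + x) ^ 2 + 1 ≤ ((s - x) ^ 2 + 1) * ((s + x) ^ 2 + 1) := by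
        apply le_mul_of_one_le_left (by positivity); nlinarith [sq_nonneg (s - x)]
      calc 4 * s * x ≤ 1 * (((s - x) ^ 2 + 1) * ((s + x) ^ 2 + 1)) := by linarith
        _ ≤ _ := by gcongr
    · intro s _
      have h1 : HasDerivAt (fun s : ℝ => (s ^ 2 - (x ^ 2 - 1)) / (2 * x)) (2 * s / (2 * x)) s := by
        have := ((hasDerivAt_pow 2 s).sub_const (x ^ 2 - 1)).div_const (2 * x)
        simpa using this
      exact h1.hasDerivWithinAt
    · intro a ha b hb h
      simp only [Set.mem_Ioi] at ha hb
      have : a ^ 2 = b ^ 2 := by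
        simp only at h
        field_simp at h
        linarith
      exact (pow_left_inj₀ ha.le hb.le two_ne_zero).1 this
  · intro z hz
    exact ((hFd _).comp z (usqrt_diff hz)).differentiableWithinAt
  · intro z hz
    exact (ContinuousAt.comp (f := usqrt) hFd.continuous.continuousAt (usqrt_cont hz)).continuousWithinAt
  · intro z hz
    rw [hnorm, ← usqrt_norm]
    have h1 := hb (usqrt z)
    have h2 := (usqrt_quad hz).2
    have h3 : Real.exp (-((π + 1) * (usqrt z).im)) ≤ 1 := by
      apply Real.exp_le_one_iff.2
      have : 0 ≤ (π + 1) * (usqrt z).im := by positivity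
      linarith
    calc _ ≤ 1 * ‖f (usqrt z)‖ := by gcongr
      _ ≤ C * Real.exp ((π + 1) * ‖usqrt z‖) := by linarith
      _ ≤ _ := by
        gcongr
        · exact le_max_left _ _
        · exact le_max_right _ _


theorem exists_bound_right {f : ℂ → ℂ} (hf : ExpTypePi f) {p : ℝ} (hp : 0 < p)
    (hfin : ∫⁻ x : ℝ, ‖f x‖ₑ ^ p < ⊤) : ∃ M : ℝ, ∀ x : ℝ, 0 < x → ‖f (x + I)‖ ≤ M := by
  obtain ⟨C, hC, hb⟩ := hf.2 1 one_pos
  set K := ENNReal.ofReal (C ^ p) + ∫⁻ x : ℝ, ‖f x‖ₑ ^ p with hK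
  have hKt : K ≠ ⊤ := by
    rw [hK]; exact (ENNReal.add_lt_top.2 ⟨ENNReal.ofReal_lt_top, hfin⟩).ne
  refine ⟨Real.exp (π + 1) * K.toReal ^ p⁻¹, fun x hx => ?_⟩
  have h := quad_bound hf hp hC hb hx
  rw [← hK, enorm_rpow_eq_ofReal hp.le] at h
  have h2 := (ENNReal.ofReal_le_iff_le_toReal hKt).1 h
  have h3 : ‖Complex.exp (I * ((π + 1 : ℝ) : ℂ) * (x + I)) * f (x + I)‖ =
      Real.exp (-(π + 1)) * ‖f (x + I)‖ := by
    rw [norm_mul, Complex.norm_exp]; congr 2; simp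
  rw [h3] at h2
  have h4 : Real.exp (-(π + 1)) * ‖f (x + I)‖ ≤ K.toReal ^ p⁻¹ :=
    (Real.le_rpow_inv_iff_of_pos (by positivity) ENNReal.toReal_nonneg hp).2 h2
  calc ‖f (x + I)‖ = Real.exp (π + 1) * (Real.exp (-(π + 1)) * ‖f (x + I)‖) := by
        rw [← mul_assoc, ← Real.exp_add, add_neg_cancel, Real.exp_zero, one_mul]
    _ ≤ _ := by gcongr

theorem exists_bound {f : ℂ → ℂ} (hf : ExpTypePi f) {p : ℝ} (hp : 0 < p)
    (hfin : ∫⁻ x : ℝ, ‖f x‖ₑ ^ p < ⊤) :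
    ∃ M : ℝ, 0 ≤ M ∧ ∀ z : ℂ, ‖f z‖ ≤ M * Real.exp (π * |z.im|) := by
  obtain ⟨M1, h1⟩ := exists_bound_right hf hp hfin
  have hfin2 : ∫⁻ x : ℝ, ‖(starRingEnd ℂ) (f (-((starRingEnd ℂ) (x:ℂ))))‖ₑ ^ p < ⊤ := by
    have : ∀ x : ℝ, ‖(starRingEnd ℂ) (f (-((starRingEnd ℂ) (x:ℂ))))‖ₑ ^ p = ‖f ((-x : ℝ))‖ₑ ^ p := by
      intro x
      rw [← ofReal_norm, RCLike.norm_conj, ofReal_norm]; simp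
    simp_rw [this]
    rw [lintegral_neg_eq_self (μ := volume) (fun x : ℝ => ‖f x‖ₑ ^ p)]
    exact hfin
  obtain ⟨M2, h2⟩ := exists_bound_right hf.comp_neg.conj_conj hp hfin2
  have hI : ∀ x : ℝ, ‖(fun z => f (z + I)) x‖ ≤ max (max M1 M2) ‖f I‖ := by
    intro x
    rcases lt_trichotomy x 0 with h | h | h
    · have := h2 (-x) (by linarith)
      have e : -((starRingEnd ℂ) (((-x : ℝ):ℂ) + I)) = x + I := by simp [add_comm]
      rw [e, RCLike.norm_conj] at this
      exact this.trans ((le_max_right _ _).trans (le_max_left _ _))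
    · subst h; simp
    · exact (h1 x h).trans ((le_max_left _ _).trans (le_max_left _ _))
  set M3 := max (max M1 M2) ‖f I‖ with hM3
  have hR : ∀ x : ℝ, ‖f x‖ ≤ M3 * Real.exp π := by
    intro x
    have := pl_all (hf.comp_add I) hI (x - I)
    simpa using this
  refine ⟨M3 * Real.exp π, (norm_nonneg _).trans (hR 0), fun z => pl_all hf hR z⟩

end

section
open MeasureTheory Real Complex
open scoped ENNReal NNReal Topology
open Filter

theorem lintegral_affine {h : ℝ → ℝ≥0∞} (hh : Measurable h) (x : ℝ) {y : ℝ} (hy : 0 < y) :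
    ENNReal.ofReal y * ∫⁻ t : ℝ, h (x + y * t) = ∫⁻ t, h t := by
  have h1 := Real.smul_map_volume_mul_left hy.ne'
  rw [abs_of_pos hy] at h1
  have h2 : ∫⁻ t : ℝ, h (x + t) = ∫⁻ t, h t := lintegral_add_left_eq_self h x
  rw [← h2]
  conv_rhs => rw [← h1]
  rw [lintegral_smul_measure, lintegral_map (by fun_prop) (by fun_prop)]
  rfl

theorem pker_jensen {h : ℝ → ℝ≥0∞} (hh : Measurable h) {s : ℝ} (hs : 1 < s) :
    (∫⁻ t, pker t * h t) ^ s ≤ ∫⁻ t, pker t * h t ^ s := by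
  have e : ∀ k : ℝ → ℝ≥0∞, Measurable k → ∫⁻ t, k t ∂(volume.withDensity pker) = ∫⁻ t, pker t * k t := by
    intro k hk
    rw [lintegral_withDensity_eq_lintegral_mul _ measurable_pker hk]; rfl
  rw [← e h hh, ← e _ (hh.pow_const s)]
  have hq := Real.HolderConjugate.conjExponent hs
  have := ENNReal.lintegral_mul_le_Lp_mul_Lq (volume.withDensity pker) hq hh.aemeasurable
    (g := fun _ => 1) aemeasurable_const
  simp only [Pi.mul_apply, mul_one, ENNReal.one_rpow, lintegral_const] at this
  have h1 : (volume.withDensity pker) Set.univ = 1 := by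
    rw [withDensity_apply _ MeasurableSet.univ, Measure.restrict_univ, lintegral_pker]
  rw [h1, one_mul, ENNReal.one_rpow, mul_one, one_div] at this
  have h0 : 0 < s := by linarith
  calc _ ≤ ((∫⁻ t, h t ^ s ∂(volume.withDensity pker)) ^ s⁻¹) ^ s := by
        gcongr
    _ = _ := ENNReal.rpow_inv_rpow h0.ne' _

theorem lintegral_pker_conv {h : ℝ → ℝ≥0∞} (hh : Measurable h) (y : ℝ) :
    ∫⁻ x, ∫⁻ t, pker t * h (x + y * t) = ∫⁻ x, h x := by
  rw [lintegral_lintegral_swap]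
  · have : ∀ t : ℝ, ∫⁻ x, pker t * h (x + y * t) = pker t * ∫⁻ x, h x := by
      intro t
      rw [lintegral_const_mul _ (by fun_prop), lintegral_add_right_eq_self (fun x => h x)]
    simp_rw [this]
    rw [lintegral_mul_const _ measurable_pker, lintegral_pker, one_mul]
  · have := measurable_pker
    apply Measurable.aemeasurable
    simp only [Function.uncurry_def]
    fun_prop

/-- The normalized modulus `|f(z)| e^{-π|Im z|}`. -/
noncomputable def nf (f : ℂ → ℂ) (z : ℂ) : ℝ≥0∞ := ENNReal.ofReal (Real.exp (-(π * |z.im|))) * ‖f z‖ₑ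

theorem nf_poisson_pos {f : ℂ → ℂ} (hd : Differentiable ℂ f) {M : ℝ}
    (hb : ∀ z : ℂ, ‖f z‖ ≤ M * Real.exp (π * |z.im|)) {x y r : ℝ} (hy : 0 < y) (hr : 0 < r) :
    (nf f (x + y * I)) ^ r ≤ ∫⁻ t : ℝ, pker t * ‖f ((x + y * t : ℝ))‖ₑ ^ r := by
  set F : ℂ → ℂ := fun z => Complex.exp (I * π * z) * f z with hF
  have hnorm : ∀ z : ℂ, ‖F z‖ = Real.exp (-(π * z.im)) * ‖f z‖ := by
    intro z; simp only [hF]; rw [norm_mul, Complex.norm_exp]; congr 2; simp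
  have hFd : Differentiable ℂ F :=
    (by fun_prop : Differentiable ℂ fun z => Complex.exp (I * π * z)).mul hd
  have := poisson_bdd (H := F) (M := M) hFd.differentiableOn hFd.continuous.continuousOn ?_
    (x₀ := x) (y₀ := y) hy hr
  · have e1 : ‖F (x + y * I)‖ₑ = nf f (x + y * I) := by
      rw [nf, ← ofReal_norm, hnorm, ENNReal.ofReal_mul (by positivity), ofReal_norm]
      simp [abs_of_pos hy]
    rw [e1] at this
    refine this.trans (le_of_eq ?_)
    congr 1; ext t; congr 2
    rw [← ofReal_norm, hnorm, ofReal_im]; simp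
  · intro z hz
    rw [hnorm]
    have h := hb z
    rw [abs_of_nonneg hz] at h
    calc _ ≤ Real.exp (-(π * z.im)) * (M * Real.exp (π * z.im)) := by gcongr
      _ = M * (Real.exp (-(π * z.im)) * Real.exp (π * z.im)) := by ring
      _ = M := by rw [← Real.exp_add]; simp

theorem nf_neg (f : ℂ → ℂ) (z : ℂ) : nf (fun w => f (-w)) z = nf f (-z) := by
  simp [nf]

theorem pker_neg (t : ℝ) : pker (-t) = pker t := by simp [pker]

theorem nf_poisson {f : ℂ → ℂ} (hd : Differentiable ℂ f) {M : ℝ}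
    (hb : ∀ z : ℂ, ‖f z‖ ≤ M * Real.exp (π * |z.im|)) {x y r : ℝ} (hy : y ≠ 0) (hr : 0 < r) :
    (nf f (x + y * I)) ^ r ≤ ∫⁻ t : ℝ, pker t * ‖f ((x + |y| * t : ℝ))‖ₑ ^ r := by
  rcases lt_or_gt_of_ne hy with h | h
  · have h1 := nf_poisson_pos (f := fun w => f (-w)) (hd.comp (by fun_prop)) (M := M)
      (fun z => by simpa using hb (-z)) (x := -x) (y := -y) (by linarith) hr
    rw [nf_neg] at h1
    have e : -(((-x : ℝ) : ℂ) + ((-y : ℝ) : ℂ) * I) = x + y * I := by push_cast; ring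
    rw [e] at h1
    refine h1.trans (le_of_eq ?_)
    rw [← lintegral_neg_eq_self]
    congr 1; ext t
    rw [pker_neg, abs_of_neg h]
    congr 4
    push_cast; ring
  · rw [abs_of_pos h]; exact nf_poisson_pos hd hb h hr

theorem measurable_nf {f : ℂ → ℂ} (hd : Continuous f) : Measurable (nf f) := by
  unfold nf
  have := hd.measurable
  fun_prop

theorem plancherel_polya {f : ℂ → ℂ} (hd : Differentiable ℂ f) {M : ℝ}
    (hb : ∀ z : ℂ, ‖f z‖ ≤ M * Real.exp (π * |z.im|)) {y r : ℝ} (hy : y ≠ 0) (hr : 0 < r) :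
    ∫⁻ x : ℝ, (nf f (x + y * I)) ^ r ≤ ∫⁻ x : ℝ, ‖f x‖ₑ ^ r := by
  have := hd.continuous.measurable
  rw [← lintegral_pker_conv (h := fun x : ℝ => ‖f x‖ₑ ^ r) (by fun_prop) |y|]
  exact lintegral_mono fun x => nf_poisson hd hb hy hr

end

section
open MeasureTheory Real Complex
open scoped ENNReal NNReal Topology
open Filter

theorem carl_a {s c : ℝ} (hs : 2 < s) (hc : 0 ≤ c) :
    ∫⁻ y in Set.Ioi (0:ℝ), ENNReal.ofReal (y ^ (s / 2 - 2)) *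
      (if c ^ 2 * y ≤ 1 then ENNReal.ofReal c ^ s else 0) ≤
      ENNReal.ofReal (1 / (s / 2 - 1)) * ENNReal.ofReal c ^ 2 := by
  rcases hc.eq_or_lt with h | h
  · subst h
    have : (0:ℝ≥0∞) ^ s = 0 := ENNReal.zero_rpow_of_pos (by linarith)
    simp [this]
  have hc2 : 0 < (c ^ 2)⁻¹ := by positivity
  have h1 : ∀ y ∈ Set.Ioi (0:ℝ), ENNReal.ofReal (y ^ (s / 2 - 2)) *
      (if c ^ 2 * y ≤ 1 then ENNReal.ofReal c ^ s else 0) =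
      (Set.Iic (c ^ 2)⁻¹).indicator (fun y => ENNReal.ofReal (y ^ (s / 2 - 2)) * ENNReal.ofReal c ^ s) y := by
    intro y hy
    by_cases h2 : c ^ 2 * y ≤ 1
    · rw [if_pos h2, Set.indicator_of_mem]
      rw [Set.mem_Iic, ← one_div, le_div_iff₀ (by positivity)]; linarith
    · rw [if_neg h2, Set.indicator_of_notMem, mul_zero]
      rw [Set.mem_Iic, ← one_div, le_div_iff₀ (by positivity)]; linarith
  rw [setLIntegral_congr_fun measurableSet_Ioi h1, setLIntegral_indicator measurableSet_Iic,
    lintegral_mul_const _ (by fun_prop), Set.inter_comm, Set.Ioi_inter_Iic]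
  have hIntg : IntervalIntegrable (fun y : ℝ => y ^ (s / 2 - 2)) volume 0 (c ^ 2)⁻¹ :=
    intervalIntegral.intervalIntegrable_rpow' (by linarith)
  rw [← ofReal_integral_eq_lintegral_ofReal]
  · rw [← intervalIntegral.integral_of_le hc2.le, integral_rpow (by left; linarith),
      ENNReal.ofReal_rpow_of_pos h, ← ENNReal.ofReal_pow hc, ← ENNReal.ofReal_mul,
      ← ENNReal.ofReal_mul]
    · apply le_of_eq; congr 1
      have e1 : s / 2 - 2 + 1 = s / 2 - 1 := by ring
      rw [e1, Real.zero_rpow (by linarith), Real.inv_rpow (by positivity), sub_zero]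
      have e2 : (c ^ 2) ^ (s / 2 - 1) = c ^ (s - 2) := by
        rw [← Real.rpow_natCast, ← Real.rpow_mul hc]; congr 1; push_cast; ring
      rw [e2, Real.rpow_sub h, Real.rpow_two]
      have : 0 < c ^ s := by positivity
      field_simp
    · apply one_div_nonneg.2; linarith
    · have e1 : s / 2 - 2 + 1 = s / 2 - 1 := by ring
      rw [e1, Real.zero_rpow (by linarith), sub_zero]
      apply div_nonneg (by positivity); linarith
  · exact (intervalIntegrable_iff_integrableOn_Ioc_of_le hc2.le).1 hIntg
  · rw [EventuallyLE, ae_restrict_iff' measurableSet_Ioc]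
    exact Eventually.of_forall fun y hy => Real.rpow_nonneg hy.1.le _

theorem carl_b {c : ℝ} (hc : 0 ≤ c) :
    ∫⁻ y in Set.Ioi (0:ℝ), ENNReal.ofReal (y ^ (-(3/2) : ℝ)) *
      (if c ^ 2 * y ≤ 1 then 0 else ENNReal.ofReal c) ≤ 2 * ENNReal.ofReal c ^ 2 := by
  rcases hc.eq_or_lt with h | h
  · subst h; simp
  have hc2 : 0 < (c ^ 2)⁻¹ := by positivity
  have h1 : ∀ y ∈ Set.Ioi (0:ℝ), ENNReal.ofReal (y ^ (-(3/2) : ℝ)) *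
      (if c ^ 2 * y ≤ 1 then 0 else ENNReal.ofReal c) =
      (Set.Ioi (c ^ 2)⁻¹).indicator (fun y => ENNReal.ofReal (y ^ (-(3/2) : ℝ)) * ENNReal.ofReal c) y := by
    intro y hy
    by_cases h2 : c ^ 2 * y ≤ 1
    · rw [if_pos h2, Set.indicator_of_notMem, mul_zero]
      rw [Set.mem_Ioi, not_lt, ← one_div, le_div_iff₀ (by positivity)]; linarith
    · rw [if_neg h2, Set.indicator_of_mem]
      rw [Set.mem_Ioi, ← one_div, div_lt_iff₀ (by positivity)]; linarith
  rw [setLIntegral_congr_fun measurableSet_Ioi h1, setLIntegral_indicator measurableSet_Ioi,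
    lintegral_mul_const _ (by fun_prop), Set.Ioi_inter_Ioi, sup_of_le_left hc2.le]
  rw [← ofReal_integral_eq_lintegral_ofReal]
  · rw [integral_Ioi_rpow_of_lt (by norm_num) hc2]
    have e : -((c ^ 2)⁻¹ ^ ((-(3/2) : ℝ) + 1)) / ((-(3/2) : ℝ) + 1) = 2 * c := by
      have : ((-(3/2) : ℝ) + 1) = -(1/2) := by norm_num
      rw [this, Real.inv_rpow (by positivity), Real.rpow_neg (by positivity), ← Real.sqrt_eq_rpow,
        Real.sqrt_sq hc]
      field_simp
    rw [e, ENNReal.ofReal_mul (by norm_num)]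
    apply le_of_eq
    simp; ring
  · exact integrableOn_Ioi_rpow_of_lt (by norm_num) hc2
  · rw [EventuallyLE, ae_restrict_iff' measurableSet_Ioi]
    exact Eventually.of_forall fun y hy => Real.rpow_nonneg (hc2.le.trans (le_of_lt hy)) _

theorem carl_y {G : ℝ → ℝ} (hG : Measurable G) (hG0 : ∀ x, 0 ≤ G x) {s : ℝ} (hs : 2 < s)
    (hG1 : ∫⁻ x, ENNReal.ofReal (G x) ^ 2 ≤ 1) {y : ℝ} (hy : 0 < y) :
    ∫⁻ x, (∫⁻ t, pker t * ENNReal.ofReal (G (x + y * t))) ^ s ≤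
      2 ^ (s - 1) * ((∫⁻ x, if G x ^ 2 * y ≤ 1 then ENNReal.ofReal (G x) ^ s else 0) +
        ENNReal.ofReal (y ^ (-(s - 1) / 2)) * ∫⁻ x, if G x ^ 2 * y ≤ 1 then 0 else ENNReal.ofReal (G x)) := by
  set g1 : ℝ → ℝ≥0∞ := fun x => if G x ^ 2 * y ≤ 1 then ENNReal.ofReal (G x) else 0 with hg1
  set g2 : ℝ → ℝ≥0∞ := fun x => if G x ^ 2 * y ≤ 1 then 0 else ENNReal.ofReal (G x) with hg2
  have hms : MeasurableSet {x | G x ^ 2 * y ≤ 1} := measurableSet_le (by fun_prop) (by fun_prop)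
  have m1 : Measurable g1 := Measurable.ite hms (by fun_prop) (by fun_prop)
  have m2 : Measurable g2 := Measurable.ite hms (by fun_prop) (by fun_prop)
  have mp := measurable_pker
  have hsum : ∀ x, (∫⁻ t, pker t * ENNReal.ofReal (G (x + y * t))) =
      (∫⁻ t, pker t * g1 (x + y * t)) + ∫⁻ t, pker t * g2 (x + y * t) := by
    intro x
    rw [← lintegral_add_left (by fun_prop)]
    congr 1; ext t
    simp only [hg1, hg2]
    split_ifs <;> simp
  have hg1s : (∫⁻ x, if G x ^ 2 * y ≤ 1 then ENNReal.ofReal (G x) ^ s else 0) = ∫⁻ x, g1 x ^ s := by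
    congr 1; ext x
    simp only [hg1]
    split_ifs
    · rfl
    · rw [ENNReal.zero_rpow_of_pos (by linarith)]
  have hA : ∫⁻ x, (∫⁻ t, pker t * g1 (x + y * t)) ^ s ≤ ∫⁻ x, g1 x ^ s := by
    rw [← lintegral_pker_conv (h := fun x => g1 x ^ s) (by fun_prop) y]
    exact lintegral_mono fun x => pker_jensen (h := fun t => g1 (x + y * t)) (by fun_prop) (by linarith)
  have hL1 : ∫⁻ x, g2 x ≤ ENNReal.ofReal (Real.sqrt y) := by
    calc ∫⁻ x, g2 x ≤ ∫⁻ x, ENNReal.ofReal (Real.sqrt y) * ENNReal.ofReal (G x) ^ 2 := by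
          apply lintegral_mono; intro x
          simp only [hg2]
          split_ifs with h
          · simp
          · rw [← ENNReal.ofReal_pow (hG0 x), ← ENNReal.ofReal_mul (by positivity)]
            apply ENNReal.ofReal_le_ofReal
            have h1 : 1 ≤ G x * Real.sqrt y := by
              by_contra h2
              push Not at h2 h
              have h3 : 0 ≤ G x * Real.sqrt y := mul_nonneg (hG0 x) (by positivity)
              have h4 : (G x * Real.sqrt y) ^ 2 < 1 := by nlinarith
              rw [mul_pow, Real.sq_sqrt hy.le] at h4
              linarith
            have := mul_le_mul_of_nonneg_left h1 (hG0 x)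
            nlinarith
      _ = ENNReal.ofReal (Real.sqrt y) * ∫⁻ x, ENNReal.ofReal (G x) ^ 2 := lintegral_const_mul _ (by fun_prop)
      _ ≤ _ := mul_le_of_le_one_right' hG1
  have hsup : ∀ x, ∫⁻ t, pker t * g2 (x + y * t) ≤ ENNReal.ofReal (y ^ (-(1/2) : ℝ)) := by
    intro x
    calc _ ≤ ∫⁻ t, g2 (x + y * t) := by
          apply lintegral_mono; intro t
          apply mul_le_of_le_one_left'
          rw [pker]
          apply ENNReal.ofReal_le_one.2
          apply inv_le_one_of_one_le₀
          have := Real.pi_gt_three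
          nlinarith [sq_nonneg t]
      _ = ENNReal.ofReal y⁻¹ * (ENNReal.ofReal y * ∫⁻ t, g2 (x + y * t)) := by
          rw [← mul_assoc, ← ENNReal.ofReal_mul (by positivity), inv_mul_cancel₀ hy.ne']; simp
      _ = ENNReal.ofReal y⁻¹ * ∫⁻ t, g2 t := by rw [lintegral_affine m2 x hy]
      _ ≤ ENNReal.ofReal y⁻¹ * ENNReal.ofReal (Real.sqrt y) := by gcongr
      _ = _ := by
          rw [← ENNReal.ofReal_mul (by positivity)]
          congr 1
          rw [Real.sqrt_eq_rpow, ← Real.rpow_neg_one, ← Real.rpow_add hy]; norm_num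
  have hB : ∫⁻ x, (∫⁻ t, pker t * g2 (x + y * t)) ^ s ≤ ENNReal.ofReal (y ^ (-(s - 1) / 2)) * ∫⁻ x, g2 x := by
    calc _ ≤ ∫⁻ x, ENNReal.ofReal (y ^ (-(s - 1) / 2)) * ∫⁻ t, pker t * g2 (x + y * t) := by
          apply lintegral_mono; intro x
          simp only
          set v := ∫⁻ t, pker t * g2 (x + y * t) with hv
          have hvt : v ≠ ⊤ := ((hsup x).trans_lt ENNReal.ofReal_lt_top).ne
          have e : v ^ s = v ^ (s - 1) * v := by
            rcases eq_or_ne v 0 with h0 | h0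
            · rw [h0, ENNReal.zero_rpow_of_pos (by linarith)]; simp
            · conv_rhs => rw [← ENNReal.rpow_one v, ← ENNReal.rpow_mul, one_mul, ← ENNReal.rpow_add _ _ h0 hvt]
              congr 1; ring
          rw [e]
          gcongr
          calc v ^ (s - 1) ≤ ENNReal.ofReal (y ^ (-(1/2) : ℝ)) ^ (s - 1) := by
                gcongr
                · linarith
                · exact hsup x
            _ = _ := by
                rw [ENNReal.ofReal_rpow_of_pos (by positivity), ← Real.rpow_mul hy.le]
                congr 2; ring
      _ = _ := by
          rw [lintegral_const_mul _ (Measurable.lintegral_prod_right (by fun_prop)), lintegral_pker_conv m2]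
  rw [hg1s]
  calc _ ≤ ∫⁻ x, 2 ^ (s - 1) * ((∫⁻ t, pker t * g1 (x + y * t)) ^ s + (∫⁻ t, pker t * g2 (x + y * t)) ^ s) := by
        apply lintegral_mono; intro x
        simp only
        rw [hsum]
        exact ENNReal.rpow_add_le_mul_rpow_add_rpow _ _ (by linarith)
    _ = 2 ^ (s - 1) * ((∫⁻ x, (∫⁻ t, pker t * g1 (x + y * t)) ^ s) + ∫⁻ x, (∫⁻ t, pker t * g2 (x + y * t)) ^ s) := by
        have k1 : Measurable fun x => (∫⁻ t, pker t * g1 (x + y * t)) ^ s :=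
          (Measurable.lintegral_prod_right (by fun_prop)).pow_const s
        have k2 : Measurable fun x => (∫⁻ t, pker t * g2 (x + y * t)) ^ s :=
          (Measurable.lintegral_prod_right (by fun_prop)).pow_const s
        exact (lintegral_const_mul _ (k1.add k2)).trans (congrArg _ (lintegral_add_left k1 _))
    _ ≤ _ := by gcongr

theorem carleson {G : ℝ → ℝ} (hG : Measurable G) (hG0 : ∀ x, 0 ≤ G x) {s : ℝ} (hs : 2 < s)
    (hG1 : ∫⁻ x, ENNReal.ofReal (G x) ^ 2 ≤ 1) :
    ∫⁻ y in Set.Ioi (0:ℝ), ENNReal.ofReal (y ^ (s / 2 - 2)) *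
      ∫⁻ x, (∫⁻ t, pker t * ENNReal.ofReal (G (x + y * t))) ^ s ≤
      2 ^ (s - 1) * (ENNReal.ofReal (1 / (s / 2 - 1)) + 2) := by
  set A : ℝ → ℝ → ℝ≥0∞ := fun y x => ENNReal.ofReal (y ^ (s / 2 - 2)) *
      (if G x ^ 2 * y ≤ 1 then ENNReal.ofReal (G x) ^ s else 0) with hA
  set B : ℝ → ℝ → ℝ≥0∞ := fun y x => ENNReal.ofReal (y ^ (-(3/2) : ℝ)) *
      (if G x ^ 2 * y ≤ 1 then 0 else ENNReal.ofReal (G x)) with hB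
  have hms : MeasurableSet {w : ℝ × ℝ | G w.2 ^ 2 * w.1 ≤ 1} := measurableSet_le (by fun_prop) (by fun_prop)
  have mA : Measurable (Function.uncurry A) := by
    simp only [hA, Function.uncurry_def]
    exact Measurable.mul (by fun_prop) (Measurable.ite hms (by fun_prop) (by fun_prop))
  have mB : Measurable (Function.uncurry B) := by
    simp only [hB, Function.uncurry_def]
    exact Measurable.mul (by fun_prop) (Measurable.ite hms (by fun_prop) (by fun_prop))
  have step : ∀ y ∈ Set.Ioi (0:ℝ), ENNReal.ofReal (y ^ (s / 2 - 2)) *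
      ∫⁻ x, (∫⁻ t, pker t * ENNReal.ofReal (G (x + y * t))) ^ s ≤
      2 ^ (s - 1) * ((∫⁻ x, A y x) + ∫⁻ x, B y x) := by
    intro y hy
    have hy' : 0 < y := hy
    have hms' : MeasurableSet {x | G x ^ 2 * y ≤ 1} := measurableSet_le (by fun_prop) (by fun_prop)
    have eA : ∫⁻ x, A y x = ENNReal.ofReal (y ^ (s / 2 - 2)) *
        ∫⁻ x, if G x ^ 2 * y ≤ 1 then ENNReal.ofReal (G x) ^ s else 0 :=
      lintegral_const_mul _ (Measurable.ite hms' (by fun_prop) (by fun_prop))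
    have eB : ∫⁻ x, B y x = ENNReal.ofReal (y ^ (-(3/2) : ℝ)) *
        ∫⁻ x, if G x ^ 2 * y ≤ 1 then 0 else ENNReal.ofReal (G x) :=
      lintegral_const_mul _ (Measurable.ite hms' (by fun_prop) (by fun_prop))
    have e3 : ENNReal.ofReal (y ^ (-(3/2) : ℝ)) =
        ENNReal.ofReal (y ^ (s / 2 - 2)) * ENNReal.ofReal (y ^ (-(s - 1) / 2)) := by
      rw [← ENNReal.ofReal_mul (by positivity), ← Real.rpow_add hy']; congr 2; ring
    calc _ ≤ ENNReal.ofReal (y ^ (s / 2 - 2)) * _ := mul_le_mul_right (carl_y hG hG0 hs hG1 hy') _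
      _ = _ := by rw [eA, eB, e3]; ring
  calc _ ≤ ∫⁻ y in Set.Ioi (0:ℝ), 2 ^ (s - 1) * ((∫⁻ x, A y x) + ∫⁻ x, B y x) :=
        setLIntegral_mono' measurableSet_Ioi step
    _ = 2 ^ (s - 1) * ((∫⁻ y in Set.Ioi (0:ℝ), ∫⁻ x, A y x) + ∫⁻ y in Set.Ioi (0:ℝ), ∫⁻ x, B y x) := by
        exact (lintegral_const_mul _ (mA.lintegral_prod_right.add mB.lintegral_prod_right)).trans
          (congrArg _ (lintegral_add_left mA.lintegral_prod_right _))
    _ = 2 ^ (s - 1) * ((∫⁻ x, ∫⁻ y in Set.Ioi (0:ℝ), A y x) + ∫⁻ x, ∫⁻ y in Set.Ioi (0:ℝ), B y x) := by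
        rw [lintegral_lintegral_swap mA.aemeasurable, lintegral_lintegral_swap mB.aemeasurable]
    _ ≤ 2 ^ (s - 1) * ((∫⁻ x, ENNReal.ofReal (1 / (s / 2 - 1)) * ENNReal.ofReal (G x) ^ 2) +
          ∫⁻ x, 2 * ENNReal.ofReal (G x) ^ 2) := by
        gcongr with x x
        · exact carl_a hs (hG0 x)
        · exact carl_b (hG0 x)
    _ ≤ _ := by
        rw [lintegral_const_mul _ (by fun_prop), lintegral_const_mul _ (by fun_prop)]
        gcongr
        · exact mul_le_of_le_one_right' hG1
        · exact mul_le_of_le_one_right' hG1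

/-- The `q`-th power of the weighted area quasi-norm. -/
noncomputable def Aq (p q : ℝ) (f : ℂ → ℂ) : ℝ≥0∞ :=
  ∫⁻ z : ℂ, ENNReal.ofReal (Real.exp (-q * Real.pi * |z.im|) * |z.im| ^ (q / p - 2)) * ‖f z‖ₑ ^ q

theorem Aq_integrand {q : ℝ} (hq : 0 < q) (a : ℝ) (f : ℂ → ℂ) (z : ℂ) :
    ENNReal.ofReal (Real.exp (-q * Real.pi * |z.im|) * |z.im| ^ a) * ‖f z‖ₑ ^ q =
      ENNReal.ofReal (|z.im| ^ a) * nf f z ^ q := by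
  rw [nf, ENNReal.mul_rpow_of_nonneg _ _ hq.le, ENNReal.ofReal_rpow_of_pos (by positivity),
    ← Real.exp_mul, ENNReal.ofReal_mul (by positivity)]
  have : -q * π * |z.im| = -(π * |z.im|) * q := by ring
  rw [this]; ring

theorem lintegral_complex {h : ℂ → ℝ≥0∞} (hh : Measurable h) :
    ∫⁻ z, h z = ∫⁻ y : ℝ, ∫⁻ x : ℝ, h (x + y * I) := by
  rw [← (Complex.volume_preserving_equiv_real_prod.symm).lintegral_comp_emb
    (MeasurableEquiv.measurableEmbedding _), Measure.volume_eq_prod, lintegral_prod_symm]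
  · congr 1; ext y; congr 1; ext x; congr 1
    exact Complex.mk_eq_add_mul_I x y
  · exact (hh.comp (MeasurableEquiv.measurable _)).aemeasurable

theorem Aq_eq {p q : ℝ} (hq : 0 < q) {f : ℂ → ℂ} (hf : Continuous f) :
    Aq p q f = ∫⁻ y : ℝ, ENNReal.ofReal (|y| ^ (q / p - 2)) * ∫⁻ x : ℝ, nf f (x + y * I) ^ q := by
  have m := measurable_nf hf
  unfold Aq
  simp_rw [Aq_integrand hq]
  rw [lintegral_complex (by fun_prop)]
  congr 1; ext y
  rw [← lintegral_const_mul _ (by fun_prop)]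
  simp

theorem lintegral_abs_le {h k : ℝ → ℝ≥0∞} (hh : Measurable h) (hle : ∀ y, y ≠ 0 → h y ≤ k |y|) :
    ∫⁻ y, h y ≤ 2 * ∫⁻ y in Set.Ioi 0, k y := by
  rw [← lintegral_add_compl _ (measurableSet_Ioi (a := (0:ℝ))), two_mul, Set.compl_Ioi]
  refine add_le_add ?_ ?_
  · apply setLIntegral_mono' measurableSet_Ioi
    intro y hy
    have := hle y (ne_of_gt hy)
    rwa [abs_of_pos hy] at this
  · rw [setLIntegral_congr Iio_ae_eq_Iic.symm, ← lintegral_indicator measurableSet_Iio,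
      ← lintegral_indicator measurableSet_Ioi, ← lintegral_neg_eq_self]
    apply lintegral_mono
    intro y
    show (Set.Iio 0).indicator h (-y) ≤ (Set.Ioi 0).indicator k y
    by_cases hy : 0 < y
    · rw [Set.indicator_of_mem (by simpa using hy), Set.indicator_of_mem (Set.mem_Ioi.2 hy)]
      have := hle (-y) (by simpa using hy.ne')
      rwa [abs_neg, abs_of_pos hy] at this
    · rw [Set.indicator_of_notMem (by simpa using hy)]; exact zero_le

theorem Aq_ball {p q : ℝ} (hp : 0 < p) (hpq : p < q) {f : ℂ → ℂ} (hf : ExpTypePi f)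
    (h1 : ∫⁻ x : ℝ, ‖f x‖ₑ ^ p ≤ 1) :
    Aq p q f ≤ 2 * (2 ^ (2 * q / p - 1) * (ENNReal.ofReal (1 / (q / p - 1)) + 2)) := by
  have hq : 0 < q := hp.trans hpq
  obtain ⟨M, -, hb⟩ := exists_bound hf hp (h1.trans_lt ENNReal.one_lt_top)
  have hm := hf.1.continuous.measurable
  have hmn := measurable_nf hf.1.continuous
  rw [Aq_eq hq hf.1.continuous]
  set G : ℝ → ℝ := fun x => ‖f x‖ ^ (p / 2) with hG
  have hGe : ∀ x : ℝ, ENNReal.ofReal (G x) = ‖f x‖ₑ ^ (p / 2) := by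
    intro x; rw [enorm_rpow_eq_ofReal (by positivity)]
  have hs : 2 < 2 * q / p := by rw [lt_div_iff₀ hp]; linarith
  have hc := carleson (G := G) (by fun_prop) (fun x => by positivity) hs ?_
  · have e1 : 2 * q / p / 2 = q / p := by ring
    rw [e1] at hc
    refine le_trans (lintegral_abs_le (k := fun y => ENNReal.ofReal (y ^ (q / p - 2)) *
      ∫⁻ x, (∫⁻ t, pker t * ENNReal.ofReal (G (x + y * t))) ^ (2 * q / p)) ?_ ?_) ?_
    · apply Measurable.mul (by fun_prop)
      exact Measurable.lintegral_prod_right (by fun_prop)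
    · intro y hy
      gcongr with x
      have := nf_poisson hf.1 hb hy (x := x) (r := p / 2) (by positivity)
      simp_rw [← hGe] at this
      calc nf f (x + y * I) ^ q = (nf f (x + y * I) ^ (p / 2)) ^ (2 * q / p) := by
            rw [← ENNReal.rpow_mul]; congr 1; field_simp
        _ ≤ _ := by gcongr
    · gcongr
  · refine le_trans (le_of_eq ?_) h1
    congr 1; ext x
    rw [hGe, ← ENNReal.rpow_natCast, ← ENNReal.rpow_mul]; congr 1; push_cast; ring

end

section
open MeasureTheory Real Complex
open scoped ENNReal NNReal Topology Pointwise
open Filter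

/-- The unit ball of `E^p`. -/
def Bp (p : ℝ) : Set (ℂ → ℂ) := {f : ℂ → ℂ | ExpTypePi f ∧ (∫⁻ x : ℝ, ‖f x‖ₑ ^ p) ≤ 1}

theorem ExpTypePi.smul {f : ℂ → ℂ} (hf : ExpTypePi f) (c : ℂ) : ExpTypePi (c • f) := by
  refine ⟨hf.1.const_smul c, fun ε hε => ?_⟩
  obtain ⟨C, hC, h⟩ := hf.2 ε hε
  refine ⟨(‖c‖ + 1) * C, by positivity, fun z => ?_⟩
  rw [Pi.smul_apply, norm_smul, mul_assoc]
  have := h z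
  gcongr
  linarith

theorem ExpTypePi.add {f g : ℂ → ℂ} (hf : ExpTypePi f) (hg : ExpTypePi g) : ExpTypePi (f + g) := by
  refine ⟨hf.1.add hg.1, fun ε hε => ?_⟩
  obtain ⟨C, hC, h⟩ := hf.2 ε hε
  obtain ⟨C', hC', h'⟩ := hg.2 ε hε
  refine ⟨C + C', by positivity, fun z => ?_⟩
  rw [Pi.add_apply, add_mul]
  exact (norm_add_le _ _).trans (add_le_add (h z) (h' z))

theorem expTypePi_zero : ExpTypePi (0 : ℂ → ℂ) :=
  ⟨differentiable_const 0, fun ε _ => ⟨1, one_pos, fun z => by simp; positivity⟩⟩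

theorem ExpTypePi.sum {ι : Type*} (s : Finset ι) {f : ι → ℂ → ℂ} (hf : ∀ i ∈ s, ExpTypePi (f i)) :
    ExpTypePi (∑ i ∈ s, f i) := by
  classical
  induction s using Finset.induction_on with
  | empty => simpa using expTypePi_zero
  | insert a s ha ih =>
    rw [Finset.sum_insert ha]
    exact (hf a (by simp)).add (ih fun i hi => hf i (by simp [hi]))

theorem ExpTypePi.sub {f g : ℂ → ℂ} (hf : ExpTypePi f) (hg : ExpTypePi g) : ExpTypePi (f - g) := by
  have := hf.add (hg.smul (-1))
  have e : f - g = f + (-1 : ℂ) • g := by ext z; simp [sub_eq_add_neg]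
  rwa [e]

theorem enorm_sum_rpow_le {ι : Type*} (s : Finset ι) (f : ι → ℂ) {q : ℝ} (hq : 0 < q) (hq1 : q ≤ 1) :
    ‖∑ i ∈ s, f i‖ₑ ^ q ≤ ∑ i ∈ s, ‖f i‖ₑ ^ q := by
  classical
  induction s using Finset.induction_on with
  | empty => simp [hq]
  | insert a s ha ih =>
    rw [Finset.sum_insert ha, Finset.sum_insert ha]
    calc _ ≤ (‖f a‖ₑ + ‖∑ i ∈ s, f i‖ₑ) ^ q := by gcongr; exact enorm_add_le _ _
      _ ≤ ‖f a‖ₑ ^ q + ‖∑ i ∈ s, f i‖ₑ ^ q := ENNReal.rpow_add_le_add_rpow _ _ hq.le hq1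
      _ ≤ _ := by gcongr

theorem Aq_smul {p q : ℝ} (hq : 0 < q) (c : ℂ) {f : ℂ → ℂ} (hf : Continuous f) :
    Aq p q (c • f) = ‖c‖ₑ ^ q * Aq p q f := by
  unfold Aq
  have := hf.measurable
  rw [← lintegral_const_mul _ (by fun_prop)]
  congr 1; ext z
  rw [Pi.smul_apply, enorm_smul, ENNReal.mul_rpow_of_nonneg _ _ hq.le]; ring

theorem Aq_sum {p q : ℝ} (hq : 0 < q) (hq1 : q ≤ 1) {ι : Type*} (s : Finset ι) {f : ι → ℂ → ℂ}
    (hf : ∀ i ∈ s, Continuous (f i)) : Aq p q (∑ i ∈ s, f i) ≤ ∑ i ∈ s, Aq p q (f i) := by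
  unfold Aq
  rw [← lintegral_finsetSum']
  · apply lintegral_mono; intro z
    simp only
    rw [← Finset.mul_sum, Finset.sum_apply]
    gcongr
    exact enorm_sum_rpow_le _ _ hq hq1
  · intro i hi
    have := (hf i hi).measurable
    exact (by fun_prop : Measurable _).aemeasurable

theorem Aq_hull {p q : ℝ} (hp : 0 < p) (hpq : p < q) (hq1 : q < 1) {h : ℂ → ℂ}
    (hh : h ∈ qConvexHull q (Bp p)) :
    Aq p q h ≤ 2 * (2 ^ (2 * q / p - 1) * (ENNReal.ofReal (1 / (q / p - 1)) + 2)) := by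
  have hq : 0 < q := hp.trans hpq
  obtain ⟨n, f, a, hf, ha, rfl⟩ := hh
  set K : ℝ≥0∞ := 2 * (2 ^ (2 * q / p - 1) * (ENNReal.ofReal (1 / (q / p - 1)) + 2)) with hK
  have hc : ∀ i, Continuous (f i) := fun i => (hf i).1.1.continuous
  calc _ ≤ ∑ i, Aq p q (a i • f i) := Aq_sum hq hq1.le _ fun i _ => (hc i).const_smul _
    _ = ∑ i, ‖a i‖ₑ ^ q * Aq p q (f i) := by simp_rw [Aq_smul hq _ (hc _)]
    _ ≤ ∑ i, ‖a i‖ₑ ^ q * K := by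
        gcongr with i
        exact Aq_ball hp hpq (hf i).1 (hf i).2
    _ = (∑ i, ‖a i‖ₑ ^ q) * K := by rw [Finset.sum_mul]
    _ ≤ K := by
        apply mul_le_of_le_one_left'
        simp_rw [enorm_rpow_eq_ofReal hq.le]
        rw [← ENNReal.ofReal_sum_of_nonneg fun i _ => by positivity]
        exact ENNReal.ofReal_le_one.2 ha

theorem lint_smul_rpow (c : ℂ) {f : ℂ → ℂ} (hf : Continuous f) {p : ℝ} (hp : 0 < p) :
    ∫⁻ x : ℝ, ‖(c • f) x‖ₑ ^ p = ‖c‖ₑ ^ p * ∫⁻ x : ℝ, ‖f x‖ₑ ^ p := by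
  have := hf.measurable
  rw [← lintegral_const_mul _ (by fun_prop)]
  congr 1; ext z
  rw [Pi.smul_apply, enorm_smul, ENNReal.mul_rpow_of_nonneg _ _ hp.le]

theorem mem_smul_hull {p q R : ℝ} (hp : 0 < p) (hR : 0 < R) {ι : Type*} [Fintype ι]
    {g : ι → ℂ → ℂ} {b : ι → ℝ} (hb : ∀ i, 0 < b i) (hg : ∀ i, ExpTypePi (g i))
    (hn : ∀ i, ∫⁻ x : ℝ, ‖g i x‖ₑ ^ p ≤ ENNReal.ofReal (b i ^ p)) (hs : ∑ i, b i ^ q ≤ R ^ q) :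
    (∑ i, g i) ∈ R • qConvexHull q (Bp p) := by
  set e := Fintype.equivFin ι
  rw [Set.mem_smul_set]
  refine ⟨R⁻¹ • ∑ i, g i, ⟨Fintype.card ι, fun k => ((b (e.symm k))⁻¹ : ℂ) • g (e.symm k),
    fun k => ((R⁻¹ * b (e.symm k) : ℝ) : ℂ), ?_, ?_, ?_⟩, ?_⟩
  · intro k
    have hbk := hb (e.symm k)
    refine ⟨(hg _).smul _, ?_⟩
    rw [lint_smul_rpow _ (hg _).1.continuous hp]
    calc _ ≤ _ * ENNReal.ofReal (b (e.symm k) ^ p) := mul_le_mul_right (hn _) _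
      _ = 1 := by
        rw [enorm_rpow_eq_ofReal hp.le, ← ENNReal.ofReal_mul (by positivity),
          ← Real.mul_rpow (by positivity) hbk.le]
        have : ‖((b (e.symm k) : ℂ))⁻¹‖ * b (e.symm k) = 1 := by
          rw [norm_inv, Complex.norm_real, Real.norm_of_nonneg hbk.le]; field_simp
        rw [this]; simp
      _ ≤ 1 := le_rfl
  · rw [e.symm.sum_comp (fun i => ‖((R⁻¹ * b i : ℝ) : ℂ)‖ ^ q)]
    have : ∀ i, ‖((R⁻¹ * b i : ℝ) : ℂ)‖ ^ q = (R ^ q)⁻¹ * b i ^ q := by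
      intro i
      have := hb i
      rw [Complex.norm_real, Real.norm_of_nonneg (by positivity), Real.mul_rpow (by positivity) (hb i).le,
        Real.inv_rpow hR.le]
    simp_rw [this]
    rw [← Finset.mul_sum, ← div_eq_inv_mul, div_le_one (by positivity)]
    exact hs
  · rw [e.symm.sum_comp (fun i => ((R⁻¹ * b i : ℝ) : ℂ) • ((b i)⁻¹ : ℂ) • g i), Finset.smul_sum]
    congr 1; ext i z
    have := (hb i).ne'
    have : (b i : ℂ) ≠ 0 := by exact_mod_cast this
    simp only [Pi.smul_apply, smul_eq_mul, Complex.real_smul]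
    push_cast
    field_simp
  · rw [smul_smul, mul_inv_cancel₀ hR.ne', one_smul]

theorem gauge_upper {p q : ℝ} (hp : 0 < p) (hpq : p < q) (hq1 : q < 1) :
    ∃ C : ℝ, 0 < C ∧ ∀ f : ℂ → ℂ, ExpTypePi f → (∫⁻ x : ℝ, ‖f x‖ₑ ^ p) < ⊤ →
      Aq p q f ^ (1 / q) ≤ ENNReal.ofReal (C * gauge (qConvexHull q (Bp p)) f) := by
  have hq : 0 < q := hp.trans hpq
  set K : ℝ≥0∞ := 2 * (2 ^ (2 * q / p - 1) * (ENNReal.ofReal (1 / (q / p - 1)) + 2)) with hK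
  have hKt : K ≠ ⊤ := by
    have : (2:ℝ≥0∞) ^ (2 * q / p - 1) ≠ ⊤ := by
      apply ENNReal.rpow_ne_top_of_ne_zero <;> simp
    rw [hK]
    exact ENNReal.mul_ne_top (by simp) (ENNReal.mul_ne_top this (by simp))
  have hK0 : K ≠ 0 := by
    have : (2:ℝ≥0∞) ^ (2 * q / p - 1) ≠ 0 := by
      have := ENNReal.rpow_pos (p := 2 * q / p - 1) (x := 2) (by simp) (by simp)
      exact this.ne'
    simp [hK, this]
  have hKp : 0 < K.toReal := ENNReal.toReal_pos hK0 hKt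
  set C := K.toReal ^ (1 / q) with hC
  have hC0 : 0 < C := by positivity
  refine ⟨C, hC0, fun f hf hfin => ?_⟩
  have hr : ∀ r : ℝ, 0 < r → f ∈ r • qConvexHull q (Bp p) → Aq p q f ^ (1 / q) ≤ ENNReal.ofReal (C * r) := by
    intro r hr hfr
    obtain ⟨h, hh, rfl⟩ := Set.mem_smul_set.1 hfr
    have e : r • h = ((r : ℂ)) • h := by ext z; simp
    have hcont : Continuous h := by
      have : Continuous (((r:ℂ)⁻¹) • (r • h)) := hf.1.continuous.const_smul ((r:ℂ)⁻¹)
      have e2 : ((r:ℂ)⁻¹) • (r • h) = h := by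
        rw [e, smul_smul, inv_mul_cancel₀ (by exact_mod_cast hr.ne'), one_smul]
      rwa [e2] at this
    rw [e, Aq_smul hq _ hcont]
    calc (‖(r:ℂ)‖ₑ ^ q * Aq p q h) ^ (1 / q) ≤ (‖(r:ℂ)‖ₑ ^ q * K) ^ (1 / q) := by
          gcongr
          exact Aq_hull hp hpq hq1 hh
      _ = _ := by
          rw [ENNReal.mul_rpow_of_nonneg _ _ (by positivity), ← ENNReal.rpow_mul, mul_one_div_cancel hq.ne',
            ENNReal.rpow_one, mul_comm C, ENNReal.ofReal_mul hr.le, ← ofReal_norm, Complex.norm_real,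
            Real.norm_of_nonneg hr.le, hC, ← ENNReal.ofReal_rpow_of_pos hKp, ENNReal.ofReal_toReal hKt]
  have hne : {r : ℝ | r ∈ Set.Ioi (0:ℝ) ∧ f ∈ r • qConvexHull q (Bp p)}.Nonempty := by
    set N := (∫⁻ x : ℝ, ‖f x‖ₑ ^ p).toReal with hN
    have hN0 : 0 ≤ N := ENNReal.toReal_nonneg
    have hR : 0 < (N + 1) ^ p⁻¹ := by positivity
    refine ⟨(N + 1) ^ p⁻¹, hR, ?_⟩
    have := mem_smul_hull (q := q) hp hR (ι := Unit) (g := fun _ => f) (b := fun _ => (N + 1) ^ p⁻¹)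
      (fun _ => hR) (fun _ => hf) ?_ ?_
    · simpa using this
    · intro _
      rw [← Real.rpow_mul (by positivity), inv_mul_cancel₀ hp.ne', Real.rpow_one,
        ← ENNReal.ofReal_toReal hfin.ne]
      apply ENNReal.ofReal_le_ofReal
      linarith
    · simp
  obtain ⟨r0, hr0, hr0'⟩ := hne
  have hXt : Aq p q f ^ (1 / q) ≠ ⊤ := ((hr r0 hr0 hr0').trans_lt ENNReal.ofReal_lt_top).ne
  have h5 : (Aq p q f ^ (1 / q)).toReal / C ≤ gauge (qConvexHull q (Bp p)) f := by
    rw [gauge]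
    refine le_csInf ⟨r0, hr0, hr0'⟩ ?_
    rintro r ⟨h1, h2⟩
    rw [div_le_iff₀ hC0, mul_comm]
    have h1' : 0 < r := h1
    exact ENNReal.toReal_le_of_le_ofReal (by positivity) (hr r h1 h2)
  rw [← ENNReal.ofReal_toReal hXt]
  apply ENNReal.ofReal_le_ofReal
  rw [div_le_iff₀ hC0] at h5
  linarith

theorem gauge_le_of_sum {p q R : ℝ} (hp : 0 < p) (hR : 0 < R) {ι : Type*} [Fintype ι]
    {g : ι → ℂ → ℂ} {b : ι → ℝ} (hb : ∀ i, 0 < b i) (hg : ∀ i, ExpTypePi (g i))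
    (hn : ∀ i, ∫⁻ x : ℝ, ‖g i x‖ₑ ^ p ≤ ENNReal.ofReal (b i ^ p)) (hs : ∑ i, b i ^ q ≤ R ^ q) :
    gauge (qConvexHull q (Bp p)) (∑ i, g i) ≤ R :=
  gauge_le_of_mem hR.le (mem_smul_hull hp hR hb hg hn hs)

end

section
open MeasureTheory Real Complex
open scoped ENNReal NNReal Topology
open Filter

/-- The entire function `(e^w - 1)/w`. -/
noncomputable def e1 : ℂ → ℂ := dslope Complex.exp 0

theorem dslope_entire {g : ℂ → ℂ} (hg : Differentiable ℂ g) (c : ℂ) : Differentiable ℂ (dslope g c) := by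
  have := (differentiableOn_dslope (s := Set.univ) (f := g) (c := c) univ_mem).2 hg.differentiableOn
  exact differentiableOn_univ.1 this

theorem e1_diff : Differentiable ℂ e1 := dslope_entire Complex.differentiable_exp 0

theorem e1_zero : e1 0 = 1 := by simp [e1, dslope_same]

theorem e1_of_ne {w : ℂ} (hw : w ≠ 0) : e1 w = (Complex.exp w - 1) / w := by
  rw [e1, dslope_of_ne _ hw, slope_def_field]; simp

theorem exp_max_one (x : ℝ) : 1 ≤ Real.exp (max 0 x) := Real.one_le_exp (le_max_left _ _)

theorem e1_bound1 (w : ℂ) : ‖e1 w‖ ≤ Real.exp (max 0 w.re) := by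
  rcases eq_or_ne w 0 with rfl | hw
  · rw [e1_zero]; simp
  rw [e1_of_ne hw, norm_div, div_le_iff₀ (norm_pos_iff.2 hw)]
  have hconv : Convex ℝ {z : ℂ | z.re ≤ max 0 w.re} := convex_halfSpace_re_le _
  have := hconv.norm_image_sub_le_of_norm_deriv_le (f := Complex.exp) (C := Real.exp (max 0 w.re))
    (x := 0) (y := w) (fun z _ => Complex.differentiable_exp z) ?_ (by simp) (by simp)
  · simpa using this
  · intro z hz
    rw [Complex.deriv_exp, Complex.norm_exp]
    exact Real.exp_le_exp.2 hz

theorem e1_bound2 {w : ℂ} (hw : w ≠ 0) : ‖e1 w‖ ≤ Real.exp (max 0 w.re) * (2 / ‖w‖) := by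
  rw [e1_of_ne hw, norm_div, ← mul_div_assoc]
  gcongr
  calc _ ≤ ‖Complex.exp w‖ + ‖(1:ℂ)‖ := norm_sub_le _ _
    _ ≤ Real.exp (max 0 w.re) + Real.exp (max 0 w.re) := by
        gcongr
        · rw [Complex.norm_exp]; exact Real.exp_le_exp.2 (le_max_right _ _)
        · rw [norm_one]; exact exp_max_one _
    _ = _ := by ring

/-- The smooth cutoff multiplier. -/
noncomputable def An (N : ℕ) (v : ℂ) : ℂ := e1 (-I * ((2 / N : ℝ) : ℂ) * v) ^ N

theorem An_diff (N : ℕ) : Differentiable ℂ (An N) :=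
  (e1_diff.comp (by fun_prop : Differentiable ℂ fun v : ℂ => -I * ((2 / N : ℝ) : ℂ) * v)).pow N

theorem An_zero (N : ℕ) : An N 0 = 1 := by simp [An, e1_zero]

theorem An_exp {N : ℕ} (hN : 1 ≤ N) (v : ℂ) :
    Real.exp (max 0 (-I * ((2 / N : ℝ) : ℂ) * v).re) ^ N = Real.exp (2 * max 0 v.im) := by
  have hN' : (0:ℝ) < N := by exact_mod_cast hN
  have h1 : (-I * ((2 / N : ℝ) : ℂ) * v).re = 2 / N * v.im := by
    have : -I * ((2 / N : ℝ) : ℂ) * v = ((2 / N : ℝ) : ℂ) * (-I * v) := by ring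
    rw [this, re_ofReal_mul]; simp
  rw [← Real.exp_nat_mul, h1]
  congr 1
  have : max 0 (2 / N * v.im) = 2 / N * max 0 v.im := by
    rw [mul_max_of_nonneg _ _ (by positivity), mul_zero]
  rw [this]
  field_simp

theorem An_bound1 {N : ℕ} (hN : 1 ≤ N) (v : ℂ) : ‖An N v‖ ≤ Real.exp (2 * max 0 v.im) := by
  rw [An, norm_pow, ← An_exp hN v]
  gcongr
  exact e1_bound1 _

theorem An_bound2 {N : ℕ} (hN : 1 ≤ N) {v : ℂ} (hv : v ≠ 0) :
    ‖An N v‖ ≤ Real.exp (2 * max 0 v.im) * (N / ‖v‖) ^ N := by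
  have hN' : (0:ℝ) < N := by exact_mod_cast hN
  rw [An, norm_pow, ← An_exp hN v, ← mul_pow]
  have hw : -I * ((2 / N : ℝ) : ℂ) * v ≠ 0 := by
    refine mul_ne_zero (mul_ne_zero (by simp) ?_) hv
    exact_mod_cast (by positivity : (2 / N : ℝ) ≠ 0)
  have h := e1_bound2 hw
  have e : 2 / ‖-I * ((2 / N : ℝ) : ℂ) * v‖ = N / ‖v‖ := by
    rw [norm_mul, norm_mul, Complex.norm_real, Real.norm_of_nonneg (by positivity)]
    simp only [norm_neg, norm_I, one_mul]
    have := norm_pos_iff.2 hv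
    field_simp
  rw [e] at h
  gcongr

/-- Numerators of the Cauchy kernels. -/
noncomputable def num (N : ℕ) (θ : ℝ) (u : ℂ) : ℂ := Complex.exp (I * π * u) * An N (θ * u)

theorem num_diff (N : ℕ) (θ : ℝ) : Differentiable ℂ (num N θ) :=
  (by fun_prop : Differentiable ℂ fun u : ℂ => Complex.exp (I * π * u)).mul
    ((An_diff N).comp (by fun_prop))

theorem num_zero (N : ℕ) (θ : ℝ) : num N θ 0 = 1 := by simp [num, An_zero]

theorem num_norm (N : ℕ) (θ : ℝ) (u : ℂ) :
    ‖num N θ u‖ = Real.exp (-(π * u.im)) * ‖An N (θ * u)‖ := by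
  rw [num, norm_mul, Complex.norm_exp]; congr 2; simp

theorem num_bound1 {N : ℕ} (hN : 1 ≤ N) {θ : ℝ} (h0 : 0 ≤ θ) (h1 : θ ≤ 1) (u : ℂ) :
    ‖num N θ u‖ ≤ Real.exp (π * |u.im|) := by
  rw [num_norm]
  calc _ ≤ Real.exp (-(π * u.im)) * Real.exp (2 * max 0 ((θ:ℂ) * u).im) := by
        gcongr; exact An_bound1 hN _
    _ ≤ _ := by
        rw [← Real.exp_add]
        apply Real.exp_le_exp.2
        rw [im_ofReal_mul]
        have := Real.pi_gt_three
        rcases le_total 0 u.im with h | h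
        · rw [max_eq_right (by positivity), abs_of_nonneg h]
          nlinarith [mul_le_mul_of_nonneg_right h1 h]
        · rw [max_eq_left (mul_nonpos_of_nonneg_of_nonpos h0 h), abs_of_nonpos h]; linarith

theorem num_bound2 {N : ℕ} (hN : 1 ≤ N) {θ : ℝ} (h0 : 0 < θ) {u : ℂ} (hu : u ≠ 0) :
    ‖num N θ u‖ ≤ Real.exp (-(π * u.im) + 2 * θ * max 0 u.im) * (N / (θ * ‖u‖)) ^ N := by
  rw [num_norm, Real.exp_add, mul_assoc]
  have := An_bound2 hN (v := (θ:ℂ) * u) (mul_ne_zero (by exact_mod_cast h0.ne') hu)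
  rw [norm_mul, Complex.norm_real, Real.norm_of_nonneg h0.le, im_ofReal_mul] at this
  have e : max 0 (θ * u.im) = θ * max 0 u.im := by
    rw [mul_max_of_nonneg _ _ h0.le, mul_zero]
  rw [e, ← mul_assoc] at this
  gcongr

theorem ExpTypePi.dslope_of_bound {g : ℂ → ℂ} (hg : Differentiable ℂ g) {D : ℝ}
    (hb : ∀ u, ‖g u‖ ≤ D * Real.exp (π * |u.im|)) : ExpTypePi (dslope g 0) := by
  have hd := dslope_entire hg 0
  obtain ⟨C0, hC0⟩ := (isCompact_closedBall (0:ℂ) 1).exists_bound_of_continuousOn hd.continuous.continuousOn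
  have hD : 0 ≤ D := by simpa using (norm_nonneg _).trans (hb 0)
  refine ⟨hd, fun ε hε => ⟨2 * D + |C0| + 1, by positivity, fun z => ?_⟩⟩
  have hpi := Real.pi_pos
  have h1 : 1 ≤ Real.exp ((π + ε) * ‖z‖) := Real.one_le_exp (by positivity)
  rcases le_or_gt ‖z‖ 1 with h | h
  · have := hC0 z (by simpa using h)
    have h2 := le_abs_self C0
    nlinarith [abs_nonneg C0]
  · have hz : z ≠ 0 := by rintro rfl; simp at h; linarith
    rw [dslope_of_ne _ hz, slope_def_field, norm_div, sub_zero]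
    calc _ ≤ ‖g z - g 0‖ / 1 := by gcongr
      _ ≤ ‖g z‖ + ‖g 0‖ := by rw [div_one]; exact norm_sub_le _ _
      _ ≤ D * Real.exp ((π + ε) * ‖z‖) + D * Real.exp ((π + ε) * ‖z‖) := by
          gcongr
          · refine (hb z).trans ?_
            have := Complex.abs_im_le_norm z
            gcongr
            linarith
          · have := hb 0
            simp at this
            nlinarith
      _ ≤ _ := by nlinarith [abs_nonneg C0]

/-- The dyadic kernels. -/
noncomputable def Kj (N : ℕ) (θ : ℝ) : ℂ → ℂ :=
  fun u => (2 * π * I)⁻¹ * dslope (fun u => num N θ u - num N (2 * θ) u) 0 u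

/-- The low-frequency kernel. -/
noncomputable def K0 (N : ℕ) : ℂ → ℂ :=
  fun u => (2 * π * I)⁻¹ * dslope (fun u => num N 1 u - num N 1 (-u)) 0 u

theorem Kj_type {N : ℕ} (hN : 1 ≤ N) {θ : ℝ} (h0 : 0 ≤ θ) (h1 : 2 * θ ≤ 1) : ExpTypePi (Kj N θ) := by
  have : ExpTypePi (dslope (fun u => num N θ u - num N (2 * θ) u) 0) := by
    apply ExpTypePi.dslope_of_bound (D := 2) ((num_diff N θ).sub (num_diff N _))
    intro u
    show ‖num N θ u - num N (2 * θ) u‖ ≤ _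
    have a := num_bound1 hN h0 (by linarith) u
    have b := num_bound1 hN (by linarith : 0 ≤ 2 * θ) h1 u
    have := norm_sub_le (num N θ u) (num N (2 * θ) u)
    linarith
  exact this.smul _

theorem K0_type {N : ℕ} (hN : 1 ≤ N) : ExpTypePi (K0 N) := by
  have : ExpTypePi (dslope (fun u => num N 1 u - num N 1 (-u)) 0) := by
    apply ExpTypePi.dslope_of_bound (D := 2) ((num_diff N 1).sub ((num_diff N 1).comp (by fun_prop)))
    intro u
    show ‖num N 1 u - num N 1 (-u)‖ ≤ _
    have a := num_bound1 hN zero_le_one le_rfl u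
    have b := num_bound1 hN zero_le_one le_rfl (-u)
    simp only [neg_im, abs_neg] at b
    have := norm_sub_le (num N 1 u) (num N 1 (-u))
    linarith
  exact this.smul _

theorem Kj_eq (N : ℕ) (θ : ℝ) {u : ℂ} (hu : u ≠ 0) :
    Kj N θ u = num N θ u / (2 * π * I * u) - num N (2 * θ) u / (2 * π * I * u) := by
  have hpi : (π : ℂ) ≠ 0 := by exact_mod_cast Real.pi_ne_zero
  have hI := I_ne_zero
  rw [Kj, dslope_of_ne _ hu, slope_def_field]
  simp only [num_zero]
  field_simp
  ring

theorem K0_eq (N : ℕ) {u : ℂ} (hu : u ≠ 0) :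
    K0 N u = num N 1 u / (2 * π * I * u) - num N 1 (-u) / (2 * π * I * u) := by
  have hpi : (π : ℂ) ≠ 0 := by exact_mod_cast Real.pi_ne_zero
  have hI := I_ne_zero
  rw [K0, dslope_of_ne _ hu, slope_def_field]
  simp only [num_zero, neg_zero]
  field_simp
  ring

theorem Kj_bound {N : ℕ} (hN : 1 ≤ N) {l : ℝ} (hl : 0 < l) (s : ℝ) :
    ‖Kj N l⁻¹ (s + l * I)‖ ≤
      (Real.exp 4 * N ^ N) * l⁻¹ * Real.exp (-(π * l)) * (Real.sqrt (1 + (s / l) ^ 2))⁻¹ ^ (N + 1) := by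
  set u : ℂ := s + l * I with hu
  have him : u.im = l := by simp [hu]
  have hu0 : u ≠ 0 := by intro h; rw [h] at him; simp at him; linarith
  have hnu : ‖u‖ = l * Real.sqrt (1 + (s / l) ^ 2) := by
    rw [hu, Complex.norm_add_mul_I]
    rw [show s ^ 2 + l ^ 2 = l ^ 2 * (1 + (s / l) ^ 2) by field_simp; ring, Real.sqrt_mul (by positivity),
      Real.sqrt_sq hl.le]
  set w := Real.sqrt (1 + (s / l) ^ 2) with hw
  have hw0 : 0 < w := by rw [hw]; positivity
  have hb1 := num_bound2 hN (inv_pos.2 hl) hu0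
  have hb2 := num_bound2 hN (by positivity : 0 < 2 * l⁻¹) hu0
  rw [him, max_eq_right hl.le, hnu] at hb1 hb2
  have hN' : (0:ℝ) < N := by exact_mod_cast hN
  have a1 : ‖num N l⁻¹ u‖ ≤ Real.exp 4 * Real.exp (-(π * l)) * (N / w) ^ N := by
    refine hb1.trans ?_
    rw [← Real.exp_add]
    have : (l⁻¹ * (l * w)) = w := by field_simp
    rw [this]
    refine mul_le_mul_of_nonneg_right (Real.exp_le_exp.2 ?_) (by positivity)
    have : 2 * l⁻¹ * l = 2 := by field_simp
    rw [this]; linarith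
  have a2 : ‖num N (2 * l⁻¹) u‖ ≤ Real.exp 4 * Real.exp (-(π * l)) * (N / w) ^ N := by
    refine hb2.trans ?_
    rw [← Real.exp_add]
    have : (2 * l⁻¹ * (l * w)) = 2 * w := by field_simp
    rw [this]
    refine mul_le_mul (Real.exp_le_exp.2 ?_) ?_ (by positivity) (by positivity)
    · have : 2 * (2 * l⁻¹) * l = 4 := by field_simp; norm_num
      rw [this]; linarith
    · gcongr
      linarith
  have hden : ‖2 * π * I * u‖ = 2 * π * (l * w) := by
    rw [norm_mul, hnu]; simp [abs_of_pos Real.pi_pos]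
  rw [Kj_eq _ _ hu0, ← sub_div, norm_div, hden]
  have hpi := Real.pi_gt_three
  calc _ ≤ (2 * (Real.exp 4 * Real.exp (-(π * l)) * (N / w) ^ N)) / (2 * 1 * (l * w)) := by
        gcongr
        · exact (norm_sub_le _ _).trans (by linarith)
        · linarith
    _ = _ := by
        rw [div_pow, inv_pow, pow_succ]; field_simp

theorem K0_bound {N : ℕ} (hN : 1 ≤ N) (s : ℝ) :
    ‖K0 N (s + (1:ℝ) * I)‖ ≤ (Real.exp (4 + 2 * π) * N ^ N) * (1:ℝ)⁻¹ * Real.exp (-(π * 1)) *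
        (Real.sqrt (1 + (s / 1) ^ 2))⁻¹ ^ (N + 1) := by
  set u : ℂ := s + (1:ℝ) * I with hu
  have him : u.im = 1 := by simp [hu]
  have hu0 : u ≠ 0 := by intro h; rw [h] at him; simp at him
  set w := Real.sqrt (1 + (s / 1) ^ 2) with hw
  have hnu : ‖u‖ = w := by
    rw [hu, Complex.norm_add_mul_I, hw]; congr 1; ring
  have hw0 : 0 < w := by rw [hw]; positivity
  have hb1 := num_bound2 hN one_pos hu0
  have hb2 := num_bound2 hN one_pos (neg_ne_zero.2 hu0)
  rw [him, hnu] at hb1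
  rw [neg_im, norm_neg, him, hnu] at hb2
  have hN' : (0:ℝ) < N := by exact_mod_cast hN
  have hpi := Real.pi_gt_three
  have a1 : ‖num N 1 u‖ ≤ Real.exp (4 + 2 * π) * Real.exp (-(π * 1)) * (N / w) ^ N := by
    refine hb1.trans ?_
    rw [← Real.exp_add, one_mul]
    refine mul_le_mul_of_nonneg_right (Real.exp_le_exp.2 ?_) (by positivity)
    norm_num; linarith
  have a2 : ‖num N 1 (-u)‖ ≤ Real.exp (4 + 2 * π) * Real.exp (-(π * 1)) * (N / w) ^ N := by
    refine hb2.trans ?_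
    rw [← Real.exp_add, one_mul]
    refine mul_le_mul_of_nonneg_right (Real.exp_le_exp.2 ?_) (by positivity)
    norm_num; linarith
  have hden : ‖2 * π * I * u‖ = 2 * π * w := by
    rw [norm_mul, hnu]; simp [abs_of_pos Real.pi_pos]
  rw [K0_eq _ hu0, ← sub_div, norm_div, hden]
  calc _ ≤ (2 * (Real.exp (4 + 2 * π) * Real.exp (-(π * 1)) * (N / w) ^ N)) / (2 * 1 * w) := by
        gcongr
        · exact (norm_sub_le _ _).trans (by linarith)
        · linarith
    _ = _ := by
        rw [div_pow, inv_pow, pow_succ]; field_simp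

end

section
open MeasureTheory Real Complex
open scoped ENNReal NNReal Topology
open Filter

theorem strip_lemma {Φ : ℂ → ℂ} {a b D : ℝ} (hab : a ≤ b)
    (hd : DifferentiableOn ℂ Φ {z | a ≤ z.im ∧ z.im ≤ b})
    (hdec : ∀ z : ℂ, a ≤ z.im → z.im ≤ b → 1 ≤ |z.re| → ‖Φ z‖ ≤ D / |z.re|)
    (hIntg : Integrable (fun s : ℝ => Φ (s + a * I) - Φ (s + b * I))) :
    ∫ s : ℝ, (Φ (s + a * I) - Φ (s + b * I)) = 0 := by
  have hcont : ∀ c : ℝ, a ≤ c → c ≤ b → Continuous fun s : ℝ => Φ (s + c * I) := by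
    intro c h1 h2
    refine hd.continuousOn.comp_continuous (by fun_prop) fun s => ?_
    simp [h1, h2]
  have hlim := intervalIntegral_tendsto_integral hIntg
    (tendsto_neg_atTop_atBot.comp tendsto_natCast_atTop_atTop)
    (tendsto_natCast_atTop_atTop (R := ℝ))
  refine tendsto_nhds_unique hlim ?_
  rw [tendsto_zero_iff_norm_tendsto_zero]
  have hb0 : Tendsto (fun n : ℕ => (2 * |b - a| * D) / (n : ℝ)) atTop (𝓝 0) :=
    tendsto_const_div_atTop_nhds_zero_nat _
  refine tendsto_of_tendsto_of_tendsto_of_le_of_le' tendsto_const_nhds hb0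
    (Eventually.of_forall fun _ => norm_nonneg _) ?_
  filter_upwards [eventually_ge_atTop 1] with n hn
  have hn' : (1:ℝ) ≤ n := by exact_mod_cast hn
  have key := integral_boundary_rect_eq_zero_of_differentiableOn Φ
    (((-(n:ℝ) : ℝ) : ℂ) + a * I) (((n:ℝ) : ℂ) + b * I) (hd.mono ?_)
  · have e1 : (((-(n:ℝ) : ℝ) : ℂ) + a * I).re = -n := by simp
    have e2 : (((-(n:ℝ) : ℝ) : ℂ) + a * I).im = a := by simp
    have e3 : (((n:ℝ) : ℂ) + b * I).re = n := by simp
    have e4 : (((n:ℝ) : ℂ) + b * I).im = b := by simp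
    rw [e1, e2, e3, e4] at key
    simp only [Function.comp]
    rw [intervalIntegral.integral_sub ((hcont a le_rfl hab).intervalIntegrable _ _)
      ((hcont b hab le_rfl).intervalIntegrable _ _)]
    have v : ∀ c : ℝ, |c| = n → ‖∫ y in a..b, Φ (c + y * I)‖ ≤ D / n * |b - a| := by
      intro c hc
      refine intervalIntegral.norm_integral_le_of_norm_le_const fun y hy => ?_
      rw [Set.uIoc_of_le hab] at hy
      have := hdec (c + y * I) (by simpa using hy.1.le) (by simpa using hy.2) (by simp [hc, hn'])
      simpa [hc] using this
    have v1 := v n (by simp)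
    have v2 := v (-n) (by simp)
    have : (∫ x in (-(n:ℝ))..n, Φ (x + a * I)) - ∫ x in (-(n:ℝ))..n, Φ (x + b * I)
        = I • (∫ y in a..b, Φ (((-(n:ℝ) : ℝ) : ℂ) + y * I)) - I • ∫ y in a..b, Φ (((n:ℝ):ℂ) + y * I) := by
      linear_combination key
    rw [this]
    refine (norm_sub_le _ _).trans ?_
    rw [norm_smul, norm_smul, norm_I, one_mul, one_mul]
    refine (add_le_add v2 v1).trans (le_of_eq ?_)
    ring
  · intro z hz
    rw [mem_reProdIm] at hz
    have := hz.2
    simp only [add_im, ofReal_im, mul_im, ofReal_re, I_im, I_re, mul_one, mul_zero, add_zero, zero_add] at this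
    rw [Set.uIcc_of_le hab] at this
    exact this

/-- Cauchy-type integrand. -/
noncomputable def Ci (N : ℕ) (θ : ℝ) (f : ℂ → ℂ) (x : ℝ) (u : ℂ) : ℂ :=
  f (x - u) * (num N θ u / (2 * π * I * u))

theorem Ci_bound {N : ℕ} (hN : 1 ≤ N) {θ M τ : ℝ} (hθ : 0 < θ) {f : ℂ → ℂ}
    (hb : ∀ z, ‖f z‖ ≤ M * Real.exp (τ * |z.im|)) (x : ℝ) {u : ℂ} (hu : 1 ≤ u.im) :
    ‖Ci N θ f x u‖ ≤ (M * (N / θ) ^ N) * Real.exp (-((π - 2 * θ - τ) * u.im)) * (u.re ^ 2 + u.im ^ 2)⁻¹ := by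
  have hu0 : u ≠ 0 := by rintro rfl; simp at hu; linarith
  have hM : 0 ≤ M := by simpa using (norm_nonneg _).trans (hb 0)
  have hnu : 1 ≤ ‖u‖ := hu.trans ((le_abs_self _).trans (abs_im_le_norm u))
  have h1 := hb (x - u)
  have e1 : ((x:ℂ) - u).im = - u.im := by simp
  rw [e1, abs_neg, abs_of_pos (by linarith)] at h1
  have h2 := num_bound2 hN hθ hu0
  rw [max_eq_right (by linarith)] at h2
  have e3 : u.re ^ 2 + u.im ^ 2 = ‖u‖ ^ 2 := by rw [Complex.sq_norm, normSq_apply]; ring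
  have hpi := Real.pi_gt_three
  rw [Ci, norm_mul, norm_div, norm_mul, e3]
  have e4 : ‖2 * π * I‖ = 2 * π := by simp [abs_of_pos Real.pi_pos]
  rw [e4]
  calc _ ≤ (M * Real.exp (τ * u.im)) * ((Real.exp (-(π * u.im) + 2 * θ * u.im) * (N / (θ * ‖u‖)) ^ N) / (1 * ‖u‖)) := by
        gcongr; linarith
    _ = (M * (N / θ) ^ N) * Real.exp (-((π - 2 * θ - τ) * u.im)) * (‖u‖ ^ (N + 1))⁻¹ := by
        rw [show -((π - 2 * θ - τ) * u.im) = τ * u.im + (-(π * u.im) + 2 * θ * u.im) by ring, Real.exp_add (τ * u.im)]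
        generalize Real.exp (τ * u.im) = A
        generalize Real.exp (-(π * u.im) + 2 * θ * u.im) = A'
        rw [div_pow, div_pow, mul_pow, pow_succ]; field_simp
    _ ≤ _ := by
        have : ‖u‖ ^ 2 ≤ ‖u‖ ^ (N + 1) := pow_le_pow_right₀ hnu (by omega)
        gcongr

theorem Ci_diffOn {N : ℕ} {θ : ℝ} {f : ℂ → ℂ} (hf : Differentiable ℂ f) (x : ℝ) :
    DifferentiableOn ℂ (Ci N θ f x) {u | u ≠ 0} := by
  unfold Ci
  refine DifferentiableOn.mul (hf.comp (by fun_prop : Differentiable ℂ fun u : ℂ => (x:ℂ) - u)).differentiableOn ?_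
  refine DifferentiableOn.div (num_diff N θ).differentiableOn (by fun_prop) ?_
  intro u hu
  have hpi : (π : ℂ) ≠ 0 := by exact_mod_cast Real.pi_ne_zero
  exact mul_ne_zero (by simp [hpi]) hu

theorem line_integrable {Φ : ℂ → ℂ} {h D : ℝ} (hc : Continuous fun s : ℝ => Φ (s + h * I))
    (hb : ∀ s : ℝ, ‖Φ (s + h * I)‖ ≤ D * (1 + s ^ 2)⁻¹) : Integrable (fun s : ℝ => Φ (s + h * I)) :=
  Integrable.mono' (integrable_inv_one_add_sq.const_mul D) hc.aestronglyMeasurable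
    (Eventually.of_forall hb)

theorem inv_mono_aux {s h : ℝ} (hh : 1 ≤ h) : (s ^ 2 + h ^ 2)⁻¹ ≤ (1 + s ^ 2)⁻¹ := by
  apply inv_anti₀ (by positivity)
  nlinarith

theorem Ci_line_cont {N : ℕ} {θ : ℝ} {f : ℂ → ℂ} (hf : Differentiable ℂ f) (x : ℝ) {h : ℝ} (hh : 1 ≤ h) :
    Continuous fun s : ℝ => Ci N θ f x (s + h * I) := by
  refine (Ci_diffOn hf x).continuousOn.comp_continuous (by fun_prop) fun s => ?_
  intro h0
  have := congrArg Complex.im h0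
  simp at this; linarith

theorem Ci_line_bound {N : ℕ} (hN : 1 ≤ N) {θ M τ : ℝ} (hθ : 0 < θ) {f : ℂ → ℂ}
    (hb : ∀ z, ‖f z‖ ≤ M * Real.exp (τ * |z.im|)) (x : ℝ) {h : ℝ} (hh : 1 ≤ h) (s : ℝ) :
    ‖Ci N θ f x (s + h * I)‖ ≤
      ((M * (N / θ) ^ N) * Real.exp (-((π - 2 * θ - τ) * h))) * (1 + s ^ 2)⁻¹ := by
  have hM : 0 ≤ M := by simpa using (norm_nonneg _).trans (hb 0)
  have := Ci_bound hN hθ hb x (u := s + h * I) (by simpa using hh)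
  simp only [add_im, ofReal_im, mul_im, ofReal_re, I_im, I_re, mul_one, mul_zero, add_zero, zero_add,
    add_re, mul_re, sub_zero] at this
  refine this.trans ?_
  have := inv_mono_aux (s := s) hh
  gcongr

theorem Ci_int {N : ℕ} (hN : 1 ≤ N) {θ M τ : ℝ} (hθ : 0 < θ) {f : ℂ → ℂ} (hf : Differentiable ℂ f)
    (hb : ∀ z, ‖f z‖ ≤ M * Real.exp (τ * |z.im|)) (x : ℝ) {h : ℝ} (hh : 1 ≤ h) :
    Integrable fun s : ℝ => Ci N θ f x (s + h * I) :=
  line_integrable (Ci_line_cont hf x hh) (Ci_line_bound hN hθ hb x hh)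

theorem Ci_shift {N : ℕ} (hN : 1 ≤ N) {θ M τ : ℝ} (hθ : 0 < θ) {f : ℂ → ℂ} (hf : Differentiable ℂ f)
    (hb : ∀ z, ‖f z‖ ≤ M * Real.exp (τ * |z.im|)) (x : ℝ) {a b : ℝ} (ha : 1 ≤ a) (hab : a ≤ b) :
    ∫ s : ℝ, Ci N θ f x (s + a * I) = ∫ s : ℝ, Ci N θ f x (s + b * I) := by
  have hM : 0 ≤ M := by simpa using (norm_nonneg _).trans (hb 0)
  have ia := Ci_int hN hθ hf hb x ha
  have ib := Ci_int hN hθ hf hb x (ha.trans hab)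
  have := strip_lemma (Φ := Ci N θ f x) (D := (M * (N / θ) ^ N) * Real.exp (|π - 2 * θ - τ| * b)) hab
    ((Ci_diffOn hf x).mono ?_) ?_ (ia.sub ib)
  · rw [integral_sub ia ib] at this
    exact sub_eq_zero.1 this
  · rintro z ⟨h1, h2⟩ rfl
    simp at h1; linarith
  · intro z h1 h2 h3
    refine (Ci_bound hN hθ hb x (ha.trans h1)).trans ?_
    rw [div_eq_mul_inv]
    have e : -((π - 2 * θ - τ) * z.im) ≤ |π - 2 * θ - τ| * b := by
      have := neg_abs_le (π - 2 * θ - τ)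
      have h5 : 0 ≤ |π - 2 * θ - τ| := abs_nonneg _
      nlinarith
    have e2 : |z.re| ≤ z.re ^ 2 + z.im ^ 2 := by
      nlinarith [sq_abs z.re, sq_nonneg z.im]
    refine mul_le_mul ?_ (inv_anti₀ (by linarith) e2) (by positivity) (by positivity)
    exact mul_le_mul_of_nonneg_left (Real.exp_le_exp.2 e) (by positivity)

theorem Ci_zero {N : ℕ} (hN : 1 ≤ N) {θ M τ : ℝ} (hθ : 0 < θ) {f : ℂ → ℂ} (hf : Differentiable ℂ f)
    (hb : ∀ z, ‖f z‖ ≤ M * Real.exp (τ * |z.im|)) (hτ : τ < π - 2 * θ) (x : ℝ) {a : ℝ} (ha : 1 ≤ a) :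
    ∫ s : ℝ, Ci N θ f x (s + a * I) = 0 := by
  have h1 : ∀ᶠ b : ℝ in atTop, ‖∫ s : ℝ, Ci N θ f x (s + a * I)‖ ≤
      ((M * (N / θ) ^ N) * Real.exp (-((π - 2 * θ - τ) * b))) * π := by
    filter_upwards [eventually_ge_atTop a] with b hab
    rw [Ci_shift hN hθ hf hb x ha hab]
    have := norm_integral_le_of_norm_le (integrable_inv_one_add_sq.const_mul
      ((M * (N / θ) ^ N) * Real.exp (-((π - 2 * θ - τ) * b))))
      (Eventually.of_forall (Ci_line_bound hN hθ hb x (ha.trans hab)))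
    rwa [integral_const_mul, integral_univ_inv_one_add_sq] at this
  have h2 : Tendsto (fun b : ℝ => ((M * (N / θ) ^ N) * Real.exp (-((π - 2 * θ - τ) * b))) * π) atTop (𝓝 0) := by
    have : Tendsto (fun b : ℝ => Real.exp (-((π - 2 * θ - τ) * b))) atTop (𝓝 0) :=
      Real.tendsto_exp_neg_atTop_nhds_zero.comp (tendsto_id.const_mul_atTop (by linarith))
    simpa using (this.const_mul (M * (N / θ) ^ N)).mul_const π
  have := ge_of_tendsto h2 h1
  exact norm_le_zero_iff.1 this

end

section
open MeasureTheory Real Complex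
open scoped ENNReal NNReal Topology
open Filter

/-- Convolution along a horizontal line. -/
noncomputable def Tk (K : ℂ → ℂ) (l : ℝ) (f : ℂ → ℂ) (x : ℝ) : ℂ :=
  ∫ s : ℝ, f (x - (s + l * I)) * K (s + l * I)

theorem line_ne {l : ℝ} (hl : 0 < l) (s : ℝ) : (s : ℂ) + l * I ≠ 0 := by
  intro h0
  have := congrArg Complex.im h0
  simp at this; linarith

theorem Tk_Kj {N : ℕ} (hN : 1 ≤ N) {M τ : ℝ} {f : ℂ → ℂ} (hf : Differentiable ℂ f)
    (hb : ∀ z, ‖f z‖ ≤ M * Real.exp (τ * |z.im|)) (x : ℝ) {l : ℝ} (hl : 1 ≤ l) :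
    Tk (Kj N l⁻¹) l f x = (∫ s : ℝ, Ci N l⁻¹ f x (s + (1:ℝ) * I))
      - ∫ s : ℝ, Ci N (2 * l⁻¹) f x (s + (1:ℝ) * I) := by
  have hl0 : 0 < l := by linarith
  have h1 : 0 < l⁻¹ := by positivity
  have h2 : 0 < 2 * l⁻¹ := by positivity
  rw [Ci_shift hN h1 hf hb x le_rfl hl, Ci_shift hN h2 hf hb x le_rfl hl,
    ← integral_sub (Ci_int hN h1 hf hb x hl) (Ci_int hN h2 hf hb x hl), Tk]
  congr 1; ext s
  rw [Kj_eq _ _ (line_ne hl0 s), Ci, Ci]; ring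

theorem sum_Tk {N : ℕ} (hN : 1 ≤ N) {M τ : ℝ} {f : ℂ → ℂ} (hf : Differentiable ℂ f)
    (hb : ∀ z, ‖f z‖ ≤ M * Real.exp (τ * |z.im|)) (x : ℝ) (J : ℕ) (hJ : τ < π - 2 * (2 ^ J)⁻¹) :
    ∑ j ∈ Finset.range J, Tk (Kj N (2 ^ (j + 1))⁻¹) (2 ^ (j + 1)) f x =
      - ∫ s : ℝ, Ci N 1 f x (s + (1:ℝ) * I) := by
  have h : ∀ j ∈ Finset.range J, Tk (Kj N (2 ^ (j + 1))⁻¹) (2 ^ (j + 1)) f x =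
      (∫ s : ℝ, Ci N (2 ^ (j + 1))⁻¹ f x (s + (1:ℝ) * I)) -
        ∫ s : ℝ, Ci N (2 ^ j)⁻¹ f x (s + (1:ℝ) * I) := by
    intro j _
    rw [Tk_Kj hN hf hb x (one_le_pow₀ one_le_two)]
    have : (2:ℝ) * (2 ^ (j + 1))⁻¹ = (2 ^ j)⁻¹ := by rw [pow_succ]; field_simp
    rw [this]
  rw [Finset.sum_congr rfl h,
    Finset.sum_range_sub (fun j => ∫ s : ℝ, Ci N (2 ^ j)⁻¹ f x (s + (1:ℝ) * I)),
    Ci_zero hN (by positivity) hf hb hJ x le_rfl]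
  simp

theorem Ci_residue {N : ℕ} (hN : 1 ≤ N) {M τ : ℝ} {f : ℂ → ℂ} (hf : Differentiable ℂ f)
    (hb : ∀ z, ‖f z‖ ≤ M * Real.exp (τ * |z.im|)) (x : ℝ) :
    Tk (K0 N) 1 f x = (∫ s : ℝ, Ci N 1 f x (s + (1:ℝ) * I)) + f x +
      ∫ s : ℝ, Ci N 1 (fun z => f (-z)) (-x) (s + (1:ℝ) * I) := by
  have hM : 0 ≤ M := by simpa using (norm_nonneg _).trans (hb 0)
  have hN' : (0:ℝ) < N := by exact_mod_cast hN
  have hpi : (π : ℂ) ≠ 0 := by exact_mod_cast Real.pi_ne_zero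
  set Ψ : ℂ → ℂ := fun u => f (x - u) * num N 1 (-u) with hΨ
  have hΨd : Differentiable ℂ Ψ :=
    (hf.comp (by fun_prop : Differentiable ℂ fun u : ℂ => (x:ℂ) - u)).mul ((num_diff N 1).comp (by fun_prop))
  have hΨ0 : Ψ 0 = f x := by simp [hΨ, num_zero]
  set D : ℝ := M * Real.exp |τ| * (Real.exp (π + 2) * N ^ N) with hD
  have hD0 : 0 ≤ D := by positivity
  have hΨb : ∀ u : ℂ, |u.im| ≤ 1 → 1 ≤ ‖u‖ → ‖Ψ u‖ ≤ D * ‖u‖⁻¹ := by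
    intro u h1 h2
    have hu0 : u ≠ 0 := by rintro rfl; simp at h2; linarith
    have b1 : ‖f (x - u)‖ ≤ M * Real.exp |τ| := by
      refine (hb _).trans ?_
      gcongr
      have e : |((x:ℂ) - u).im| = |u.im| := by simp
      rw [e]
      calc τ * |u.im| ≤ |τ| * |u.im| := by gcongr; exact le_abs_self _
        _ ≤ |τ| * 1 := by gcongr
        _ = _ := mul_one _
    have b2 : ‖num N 1 (-u)‖ ≤ Real.exp (π + 2) * N ^ N * ‖u‖⁻¹ := by
      have := num_bound2 hN one_pos (neg_ne_zero.2 hu0)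
      refine this.trans ?_
      rw [mul_assoc (Real.exp (π + 2))]
      have hp := Real.pi_gt_three
      refine mul_le_mul (Real.exp_le_exp.2 ?_) ?_ (by positivity) (by positivity)
      · have := abs_le.1 h1
        have m1 : max 0 (-u).im ≤ 1 := by simp only [neg_im]; exact max_le zero_le_one (by linarith)
        simp only [neg_im] at m1 ⊢
        nlinarith
      · rw [one_mul, norm_neg, div_pow, div_eq_mul_inv]
        have : ‖u‖ ≤ ‖u‖ ^ N := le_self_pow₀ h2 (by omega)
        gcongr
    rw [hΨ]; simp only [norm_mul]
    calc _ ≤ (M * Real.exp |τ|) * (Real.exp (π + 2) * N ^ N * ‖u‖⁻¹) := by gcongr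
      _ = _ := by rw [hD]; ring
  have hline : ∀ h : ℝ, |h| = 1 → ∀ s : ℝ, ‖Ψ (s + h * I) / (s + h * I)‖ ≤ D * (1 + s ^ 2)⁻¹ := by
    intro h hh s
    have hn : ‖(s:ℂ) + h * I‖ ^ 2 = 1 + s ^ 2 := by
      rw [Complex.norm_add_mul_I, Real.sq_sqrt (by positivity), ← sq_abs h, hh]; ring
    have hn1 : 1 ≤ ‖(s:ℂ) + h * I‖ := by
      nlinarith [norm_nonneg ((s:ℂ) + h * I), sq_nonneg s]
    have := hΨb (s + h * I) (by simp [hh]) hn1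
    rw [norm_div, ← hn, div_eq_mul_inv]
    calc _ ≤ D * ‖(s:ℂ) + h * I‖⁻¹ * ‖(s:ℂ) + h * I‖⁻¹ := by gcongr
      _ = _ := by rw [sq, mul_inv]; ring
  have hne : ∀ h : ℝ, |h| = 1 → ∀ s : ℝ, (s:ℂ) + h * I ≠ 0 := by
    intro h hh s h0
    have := congrArg Complex.im h0
    simp at this; rw [this] at hh; simp at hh
  have hcont : ∀ h : ℝ, |h| = 1 → Continuous fun s : ℝ => Ψ (s + h * I) / (s + h * I) := by
    intro h hh
    exact Continuous.div (hΨd.continuous.comp (by fun_prop)) (by fun_prop) (hne h hh)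
  have i1 := line_integrable (Φ := fun u => Ψ u / u) (hcont 1 (by simp)) (hline 1 (by simp))
  have i2 := line_integrable (Φ := fun u => Ψ u / u) (hcont (-1) (by simp)) (hline (-1) (by simp))
  have hds : ∀ u : ℂ, u ≠ 0 → dslope Ψ 0 u = Ψ u / u - f x * u⁻¹ := by
    intro u hu
    rw [dslope_of_ne _ hu, slope_def_field, hΨ0]; field_simp; ring
  have hdiff : ∀ s : ℝ, dslope Ψ 0 (s + (-1:ℝ) * I) - dslope Ψ 0 (s + (1:ℝ) * I) =
      (Ψ (s + (-1:ℝ) * I) / (s + (-1:ℝ) * I) - Ψ (s + (1:ℝ) * I) / (s + (1:ℝ) * I))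
        - (2 * I * f x) * (((1 + s ^ 2)⁻¹ : ℝ) : ℂ) := by
    intro s
    have n1 := hne 1 (by simp) s
    have n2 := hne (-1) (by simp) s
    rw [hds _ n1, hds _ n2]
    have : ((s:ℂ) + (-1:ℝ) * I)⁻¹ - (s + (1:ℝ) * I)⁻¹ = 2 * I * (((1 + s ^ 2)⁻¹ : ℝ) : ℂ) := by
      have e : (((1 + s ^ 2)⁻¹ : ℝ) : ℂ) = ((s + (-1:ℝ) * I) * (s + (1:ℝ) * I))⁻¹ := by
        push_cast
        congr 1
        linear_combination I_sq
      rw [e, mul_inv]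
      have c1 := mul_inv_cancel₀ n1
      have c2 := mul_inv_cancel₀ n2
      push_cast at c1 c2 ⊢
      linear_combination (-((s:ℂ) + -1 * I)⁻¹) * c1 + ((s:ℂ) + 1 * I)⁻¹ * c2
    linear_combination - f x * this
  have iK : Integrable fun s : ℝ => (2 * I * f x) * (((1 + s ^ 2)⁻¹ : ℝ) : ℂ) :=
    (integrable_inv_one_add_sq.ofReal).const_mul _
  have hstrip := strip_lemma (Φ := dslope Ψ 0) (a := -1) (b := 1) (D := D + ‖f x‖) (by norm_num)
    (dslope_entire hΨd 0).differentiableOn ?_ ?_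
  · simp_rw [hdiff] at hstrip
    have i21 : Integrable fun s : ℝ => Ψ (s + (-1:ℝ) * I) / (s + (-1:ℝ) * I) - Ψ (s + (1:ℝ) * I) / (s + (1:ℝ) * I) :=
      i2.sub i1
    rw [integral_sub i21 iK, integral_sub i2 i1, integral_const_mul, integral_complex_ofReal,
      integral_univ_inv_one_add_sq] at hstrip
    have hm : ∫ s : ℝ, Ψ (s + (-1:ℝ) * I) / (s + (-1:ℝ) * I) =
        - (2 * π * I * ∫ s : ℝ, Ci N 1 (fun z => f (-z)) (-x) (s + (1:ℝ) * I)) := by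
      rw [← integral_neg_eq_self, ← integral_const_mul, ← integral_neg]
      congr 1; ext s
      have n1 := hne 1 (by simp) s
      have e : (((-s : ℝ) : ℂ) + (-1:ℝ) * I) = -(s + (1:ℝ) * I) := by push_cast; ring
      rw [e, hΨ, Ci]
      simp only [neg_neg]
      rw [show -((((-x : ℝ)) : ℂ) - (s + (1:ℝ) * I)) = x - -(s + (1:ℝ) * I) by push_cast; ring]
      have := I_ne_zero
      field_simp
    have hT : Tk (K0 N) 1 f x = (∫ s : ℝ, Ci N 1 f x (s + (1:ℝ) * I)) -
        (2 * π * I)⁻¹ * ∫ s : ℝ, Ψ (s + (1:ℝ) * I) / (s + (1:ℝ) * I) := by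
      rw [← integral_const_mul, ← integral_sub (Ci_int hN one_pos hf hb x le_rfl) (i1.const_mul _), Tk]
      congr 1; ext s
      have n1 := hne 1 (by simp) s
      rw [K0_eq _ n1, Ci, hΨ]
      have := I_ne_zero
      field_simp
    rw [hT]
    rw [hm] at hstrip
    have hI := I_ne_zero
    have e : ∫ s : ℝ, Ψ (s + (1:ℝ) * I) / (s + (1:ℝ) * I) = -(2 * π * I) * f x
        - (2 * π * I * ∫ s : ℝ, Ci N 1 (fun z => f (-z)) (-x) (s + (1:ℝ) * I)) := by
      linear_combination -hstrip
    rw [e]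
    field_simp
    ring
  · intro z h1 h2 h3
    have hz1 : |z.re| ≤ ‖z‖ := abs_re_le_norm z
    have hz0 : z ≠ 0 := by rintro rfl; simp at h3; linarith
    rw [hds z hz0]
    have hbz := hΨb z (abs_le.2 ⟨h1, h2⟩) (h3.trans hz1)
    calc _ ≤ ‖Ψ z / z‖ + ‖f x * z⁻¹‖ := norm_sub_le _ _
      _ ≤ D / |z.re| + ‖f x‖ / |z.re| := by
          rw [norm_div, norm_mul (f x), norm_inv, div_eq_mul_inv (‖f x‖)]
          have : ‖Ψ z‖ ≤ D := by
            refine hbz.trans ?_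
            have : ‖z‖⁻¹ ≤ 1 := inv_le_one_of_one_le₀ (h3.trans hz1)
            nlinarith
          gcongr
      _ = _ := by ring
  · simp_rw [hdiff]
    exact (i2.sub i1).sub iK

theorem representation {N : ℕ} (hN : 1 ≤ N) {M τ : ℝ} {f : ℂ → ℂ} (hf : Differentiable ℂ f)
    (hb : ∀ z, ‖f z‖ ≤ M * Real.exp (τ * |z.im|)) (x : ℝ) (J : ℕ) (hJ : τ < π - 2 * (2 ^ J)⁻¹) :
    f x = Tk (K0 N) 1 f x + (∑ j ∈ Finset.range J, Tk (Kj N (2 ^ (j + 1))⁻¹) (2 ^ (j + 1)) f x) +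
      ∑ j ∈ Finset.range J, Tk (Kj N (2 ^ (j + 1))⁻¹) (2 ^ (j + 1)) (fun z => f (-z)) (-x) := by
  have hf' : Differentiable ℂ fun z => f (-z) := hf.comp (by fun_prop)
  have hb' : ∀ z, ‖f (-z)‖ ≤ M * Real.exp (τ * |z.im|) := fun z => by simpa using hb (-z)
  rw [Ci_residue hN hf hb x, sum_Tk hN hf hb x J hJ, sum_Tk hN hf' hb' (-x) J hJ]
  ring

end

section
open MeasureTheory Real Complex
open scoped ENNReal NNReal Topology
open Filter

/-- Atoms. -/
noncomputable def blk (K : ℂ → ℂ) (l : ℝ) (f : ℂ → ℂ) (a : ℝ) (z : ℂ) : ℂ :=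
  ∫ t in a..(a + l), f (t - l * I) * K (z - t + l * I)

theorem blk_type {K : ℂ → ℂ} (hK : ExpTypePi K) {l : ℝ} (hl : 0 < l) {f : ℂ → ℂ} (hf : Continuous f) (a : ℝ) :
    ExpTypePi (blk K l f a) := by
  have hKc := hK.1.continuous
  have hK' : Continuous (deriv K) := (hK.1.contDiff (n := 1)).continuous_deriv le_rfl
  obtain ⟨F0, hF0⟩ := (isCompact_uIcc (a := a) (b := a + l)).exists_bound_of_continuousOn
    (f := fun t : ℝ => f (t - l * I)) (by fun_prop)
  refine ⟨fun z₀ => ?_, fun ε hε => ?_⟩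
  · obtain ⟨Bd, hBd⟩ := ((isCompact_closedBall z₀ 1).prod (isCompact_uIcc (a := a) (b := a + l))).exists_bound_of_continuousOn
      (f := fun w : ℂ × ℝ => f (w.2 - l * I) * deriv K (w.1 - w.2 + l * I)) (by fun_prop)
    have := intervalIntegral.hasDerivAt_integral_of_dominated_loc_of_deriv_le (μ := volume) (a := a) (b := a + l)
      (F := fun (z : ℂ) (t : ℝ) => f (t - l * I) * K (z - t + l * I))
      (F' := fun (z : ℂ) (t : ℝ) => f (t - l * I) * deriv K (z - t + l * I)) (x₀ := z₀)
      (s := Metric.closedBall z₀ 1) (bound := fun _ => Bd)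
      (Metric.closedBall_mem_nhds _ one_pos)
      (Eventually.of_forall fun z => (by fun_prop : Continuous _).aestronglyMeasurable)
      ((by fun_prop : Continuous _).intervalIntegrable _ _)
      ((by fun_prop : Continuous _).aestronglyMeasurable)
      (Eventually.of_forall fun t ht z hz => hBd (z, t) ⟨hz, Set.uIoc_subset_uIcc ht⟩)
      intervalIntegrable_const
      (Eventually.of_forall fun t ht z hz => by
        refine HasDerivAt.const_mul _ ?_
        have h1 : HasDerivAt (fun z : ℂ => z - t + l * I) 1 z := ((hasDerivAt_id z).sub_const _).add_const _
        have := (hK.1 (z - t + l * I)).hasDerivAt.comp z h1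
        rw [mul_one] at this
        exact this)
    exact this.2.differentiableAt
  · obtain ⟨C, hC, hb⟩ := hK.2 ε hε
    have hF0' : 0 ≤ F0 := (norm_nonneg _).trans (hF0 a Set.left_mem_uIcc)
    refine ⟨(F0 * C * Real.exp ((π + ε) * (|a| + 2 * l)) + 1) * l, by positivity, fun z => ?_⟩
    have hpi := Real.pi_pos
    have := intervalIntegral.norm_integral_le_of_norm_le_const (a := a) (b := a + l)
      (f := fun t : ℝ => f (t - l * I) * K (z - t + l * I))
      (C := (F0 * C * Real.exp ((π + ε) * (|a| + 2 * l)) + 1) * Real.exp ((π + ε) * ‖z‖)) ?_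
    · refine this.trans (le_of_eq ?_)
      rw [show a + l - a = l by ring, abs_of_pos hl]; ring
    · intro t ht
      have h1 := hF0 t (Set.uIoc_subset_uIcc ht)
      have h2 := hb (z - t + l * I)
      rw [Set.uIoc_of_le (by linarith)] at ht
      have h3 : ‖z - t + l * I‖ ≤ ‖z‖ + (|a| + 2 * l) := by
        calc _ ≤ ‖z - t‖ + ‖(l:ℂ) * I‖ := norm_add_le _ _
          _ ≤ ‖z‖ + ‖(t:ℂ)‖ + l := by
              gcongr
              · exact norm_sub_le _ _
              · simp [abs_of_pos hl]
          _ ≤ _ := by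
              have : |t| ≤ |a| + l := by
                rw [abs_le]
                have := neg_abs_le a
                have := le_abs_self a
                exact ⟨by linarith [ht.1], by linarith [ht.2]⟩
              rw [Complex.norm_real, Real.norm_eq_abs]; linarith
      rw [norm_mul]
      calc _ ≤ F0 * (C * Real.exp ((π + ε) * (‖z‖ + (|a| + 2 * l)))) := by
            gcongr
            exact h2.trans (by gcongr)
        _ = (F0 * C * Real.exp ((π + ε) * (|a| + 2 * l))) * Real.exp ((π + ε) * ‖z‖) := by
            rw [mul_add, Real.exp_add]; ring
        _ ≤ _ := by gcongr; linarith

theorem aux_three {a b : ℝ} (h : |a - b| ≤ 1) : 1 + b ^ 2 ≤ 3 * (1 + a ^ 2) := by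
  have := abs_le.1 h
  nlinarith [sq_nonneg (2 * a - b), sq_nonneg (a - b), sq_nonneg (a + b)]

theorem blk_bound {p : ℝ} (hp : 0 < p) {K : ℂ → ℂ} {l : ℝ} (hl : 0 < l) {D A : ℝ} (hD : 0 ≤ D) (hA : 0 ≤ A)
    (hK : ∀ s : ℝ, ‖K (s + l * I)‖ ≤ D * l⁻¹ * Real.exp (-(π * l)) * ((1 + (s / l) ^ 2)⁻¹) ^ (1 / p))
    {f : ℂ → ℂ} (a : ℝ)
    (hf : ∀ t : ℝ, a ≤ t → t ≤ a + l → Real.exp (-(π * l)) * ‖f (t - l * I)‖ ≤ A) (x : ℝ) :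
    ‖blk K l f a x‖ ≤ A * D * (3 * (1 + ((x - a) / l) ^ 2)⁻¹) ^ (1 / p) := by
  have := intervalIntegral.norm_integral_le_of_norm_le_const (a := a) (b := a + l)
      (f := fun t : ℝ => f (t - l * I) * K (x - t + l * I))
      (C := A * D * l⁻¹ * (3 * (1 + ((x - a) / l) ^ 2)⁻¹) ^ (1 / p)) ?_
  · refine this.trans (le_of_eq ?_)
    rw [show a + l - a = l by ring, abs_of_pos hl]; field_simp
  · intro t ht
    rw [Set.uIoc_of_le (by linarith)] at ht
    have h1 := hf t ht.1.le ht.2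
    have h2 := hK (x - t)
    push_cast at h2
    have h3 : ((1 + ((x - t) / l) ^ 2)⁻¹) ≤ 3 * (1 + ((x - a) / l) ^ 2)⁻¹ := by
      have : 1 + ((x - a) / l) ^ 2 ≤ 3 * (1 + ((x - t) / l) ^ 2) := by
        apply aux_three
        rw [← sub_div, abs_div, abs_of_pos hl, div_le_one hl, abs_le]
        constructor <;> linarith [ht.1, ht.2]
      rw [← div_eq_mul_inv, le_div_iff₀ (by positivity), inv_mul_le_iff₀ (by positivity)]
      linarith
    rw [norm_mul]
    have h4 : ‖f (t - l * I)‖ ≤ A * Real.exp (π * l) := by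
      rw [Real.exp_neg] at h1
      rw [inv_mul_le_iff₀ (by positivity)] at h1
      linarith
    calc _ ≤ (A * Real.exp (π * l)) * (D * l⁻¹ * Real.exp (-(π * l)) * (3 * (1 + ((x - a) / l) ^ 2)⁻¹) ^ (1 / p)) := by
          gcongr
          exact h2.trans (by gcongr)
      _ = _ := by rw [Real.exp_neg]; field_simp

theorem blk_lint {p : ℝ} (hp : 0 < p) {K : ℂ → ℂ} {l : ℝ} (hl : 0 < l) {D A : ℝ} (hD : 0 ≤ D) (hA : 0 ≤ A)
    (hK : ∀ s : ℝ, ‖K (s + l * I)‖ ≤ D * l⁻¹ * Real.exp (-(π * l)) * ((1 + (s / l) ^ 2)⁻¹) ^ (1 / p))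
    {f : ℂ → ℂ} (a : ℝ)
    (hf : ∀ t : ℝ, a ≤ t → t ≤ a + l → Real.exp (-(π * l)) * ‖f (t - l * I)‖ ≤ A) :
    ∫⁻ x : ℝ, ‖blk K l f a x‖ₑ ^ p ≤ ENNReal.ofReal (((3 * π * l) ^ (1 / p) * (D * A)) ^ p) := by
  have hpt : ∀ x : ℝ, ‖blk K l f a x‖ₑ ^ p ≤
      ENNReal.ofReal (3 * (D * A) ^ p * (1 + ((x - a) / l) ^ 2)⁻¹) := by
    intro x
    rw [enorm_rpow_eq_ofReal hp.le]
    apply ENNReal.ofReal_le_ofReal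
    calc _ ≤ (A * D * (3 * (1 + ((x - a) / l) ^ 2)⁻¹) ^ (1 / p)) ^ p := by
          gcongr; exact blk_bound hp hl hD hA hK a hf x
      _ = _ := by
          rw [Real.mul_rpow (by positivity) (by positivity), ← Real.rpow_mul (by positivity),
            one_div_mul_cancel hp.ne', Real.rpow_one, mul_comm A D]; ring
  refine (lintegral_mono hpt).trans (le_of_eq ?_)
  rw [← lintegral_affine (by fun_prop) a hl]
  have e : ∀ t : ℝ, ENNReal.ofReal (3 * (D * A) ^ p * (1 + ((a + l * t - a) / l) ^ 2)⁻¹) =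
      ENNReal.ofReal (3 * (D * A) ^ p * (1 + t ^ 2)⁻¹) := by
    intro t; congr 4; field_simp; ring
  simp_rw [e]
  rw [← ofReal_integral_eq_lintegral_ofReal (integrable_inv_one_add_sq.const_mul _)
    (Eventually.of_forall fun x => by positivity), integral_const_mul, integral_univ_inv_one_add_sq,
    ← ENNReal.ofReal_mul hl.le]
  congr 1
  have hpi := Real.pi_pos
  rw [Real.mul_rpow (x := (3 * π * l) ^ (1 / p)) (by positivity) (by positivity),
    ← Real.rpow_mul (by positivity), one_div_mul_cancel hp.ne', Real.rpow_one]
  ring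

theorem Tk_hasSum {p : ℝ} (hp : 0 < p) (hp1 : p < 1) {K : ℂ → ℂ} (hKc : Continuous K) {l : ℝ} (hl : 0 < l) {D : ℝ}
    (hK : ∀ s : ℝ, ‖K (s + l * I)‖ ≤ D * l⁻¹ * Real.exp (-(π * l)) * ((1 + (s / l) ^ 2)⁻¹) ^ (1 / p))
    {f : ℂ → ℂ} (hf : Continuous f) {M : ℝ} (hb : ∀ z, ‖f z‖ ≤ M * Real.exp (π * |z.im|)) (x : ℝ) :
    HasSum (fun k : ℤ => blk K l f (k * l) x) (Tk K l f x) := by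
  have e : Tk K l f x = ∫ t : ℝ, f (t - l * I) * K (x - t + l * I) := by
    rw [Tk, ← integral_sub_left_eq_self _ volume x]
    congr 1; ext t
    push_cast
    congr 2
    ring
  have hM : 0 ≤ M := by simpa using (norm_nonneg _).trans (hb 0)
  have hD : 0 ≤ D := by
    have := (norm_nonneg _).trans (hK 0)
    simp at this
    by_contra h
    push Not at h
    have : D * l⁻¹ * Real.exp (-(π * l)) < 0 := mul_neg_of_neg_of_pos (mul_neg_of_neg_of_pos h (by positivity)) (by positivity)
    linarith
  have hIntg : Integrable fun t : ℝ => f (t - l * I) * K (x - t + l * I) := by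
    have i0 : Integrable fun t : ℝ => (1 + ((x - t) / l) ^ 2)⁻¹ :=
      ((integrable_inv_one_add_sq.comp_div hl.ne').comp_sub_left x)
    refine Integrable.mono' (i0.const_mul (M * Real.exp (π * l) * (D * l⁻¹ * Real.exp (-(π * l)))))
      (by fun_prop : Continuous _).aestronglyMeasurable (Eventually.of_forall fun t => ?_)
    rw [norm_mul, mul_assoc]
    have h1 := hb (t - l * I)
    have h2 := hK (x - t)
    push_cast at h2
    simp [abs_of_pos hl] at h1
    have h3 : ((1 + ((x - t) / l) ^ 2)⁻¹) ^ (1 / p) ≤ (1 + ((x - t) / l) ^ 2)⁻¹ := by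
      refine Real.rpow_le_self_of_le_one (by positivity) (inv_le_one_of_one_le₀ (by nlinarith [sq_nonneg ((x - t) / l)])) ?_
      rw [le_div_iff₀ hp]; linarith
    gcongr
    exact h2.trans (by gcongr)
  rw [e, ← setIntegral_univ, ← iUnion_Ico_zsmul hl]
  have := hasSum_integral_iUnion (μ := volume) (f := fun t : ℝ => f (t - l * I) * K (x - t + l * I))
    (s := fun n : ℤ => Set.Ico (n • l) ((n + 1) • l)) (fun _ => measurableSet_Ico)
    (Set.pairwise_disjoint_Ico_zsmul l) hIntg.integrableOn
  have e2 : (fun k : ℤ => blk K l f (k * l) x) = fun n : ℤ =>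
      ∫ t in Set.Ico (n • l) ((n + 1) • l), f ((t:ℝ) - l * I) * K (x - (t:ℝ) + l * I) := by
    funext k
    rw [blk, intervalIntegral.integral_of_le (by linarith), integral_Ico_eq_integral_Ioc]
    have h1 : k • l = k * l := by simp
    have h2 : (k + 1) • l = k * l + l := by simp; ring
    rw [h1, h2]
  rw [e2]
  exact this

end

section
open MeasureTheory Real Complex
open scoped ENNReal NNReal Topology
open Filter

/-- Horizontal strips. -/
def Sl (l : ℝ) : Set ℂ := {z : ℂ | -(5 / 4 * l) ≤ z.im ∧ z.im ≤ -(3 / 4 * l)}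

theorem measurableSet_Sl (l : ℝ) : MeasurableSet (Sl l) :=
  (measurableSet_le measurable_const Complex.measurable_im).inter
    (measurableSet_le Complex.measurable_im measurable_const)

theorem nf_lower {f : ℂ → ℂ} {z : ℂ} (hz : z.im ≤ 0) :
    nf f z = ‖Complex.exp (-(I * π * z)) * f z‖ₑ := by
  rw [nf, enorm_mul, ← ofReal_norm (Complex.exp _), Complex.norm_exp, abs_of_nonpos hz]
  congr 4
  simp

theorem exists_A {f : ℂ → ℂ} (hf : Differentiable ℂ f) {l : ℝ} (hl : 0 < l) :
    ∃ A : ℤ → ℝ, (∀ k, 0 ≤ A k) ∧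
      (∀ (k : ℤ) (t : ℝ), k * l ≤ t → t ≤ k * l + l → Real.exp (-(π * l)) * ‖f (t - l * I)‖ ≤ A k) ∧
      ∀ r : ℝ, 0 < r → ∀ s : Finset ℤ, ENNReal.ofReal (π * (l / 4) ^ 2) * ∑ k ∈ s, ENNReal.ofReal (A k ^ r) ≤
        3 * ∫⁻ z in Sl l, nf f z ^ r := by
  have hfc := hf.continuous
  have hmax : ∀ k : ℤ, ∃ t ∈ Set.Icc ((k:ℝ) * l) (k * l + l),
      IsMaxOn (fun t : ℝ => Real.exp (-(π * l)) * ‖f (t - l * I)‖) (Set.Icc ((k:ℝ) * l) (k * l + l)) t := fun k =>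
    isCompact_Icc.exists_isMaxOn ⟨k * l, by simp [hl.le]⟩ (by fun_prop)
  choose T hT hTm using hmax
  refine ⟨fun k => Real.exp (-(π * l)) * ‖f (T k - l * I)‖, fun k => by positivity,
    fun k t h1 h2 => hTm k ⟨h1, h2⟩, fun r hr s => ?_⟩
  have hball : ∀ k, ∀ z ∈ Metric.ball ((T k : ℂ) - l * I) (l / 4), |z.re - T k| < l / 4 ∧ |z.im + l| < l / 4 := by
    intro k z hz
    rw [mem_ball_iff_norm] at hz
    have h1 := (abs_re_le_norm (z - (T k - l * I))).trans_lt hz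
    have h2 := (abs_im_le_norm (z - (T k - l * I))).trans_lt hz
    simp at h1 h2
    exact ⟨h1, h2⟩
  have hone : ∀ k, ENNReal.ofReal (π * (l / 4) ^ 2) *
      ENNReal.ofReal ((Real.exp (-(π * l)) * ‖f (T k - l * I)‖) ^ r) ≤
      ∫⁻ z in Metric.ball ((T k : ℂ) - l * I) (l / 4), nf f z ^ r := by
    intro k
    have hg : Differentiable ℂ fun z => Complex.exp (-(I * π * z)) * f z := by fun_prop
    have := area_submean (c := T k - l * I) (by positivity : 0 < l / 4) hr hg
    rw [enorm_rpow_eq_ofReal hr.le] at this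
    have e : ‖Complex.exp (-(I * π * (T k - l * I))) * f (T k - l * I)‖ =
        Real.exp (-(π * l)) * ‖f (T k - l * I)‖ := by
      rw [norm_mul, Complex.norm_exp]; congr 2; simp
    rw [e] at this
    refine this.trans (le_of_eq ?_)
    refine setLIntegral_congr_fun measurableSet_ball fun z hz => ?_
    rw [nf_lower]
    have := (abs_lt.1 (hball k z hz).2).2
    linarith
  rw [Finset.mul_sum]
  refine (Finset.sum_le_sum fun k _ => hone k).trans ?_
  have hm : Measurable fun z => nf f z ^ r := (measurable_nf hfc).pow_const r
  simp_rw [← lintegral_indicator (measurableSet_ball)]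
  rw [← lintegral_indicator (measurableSet_Sl l), ← lintegral_finsetSum _ fun k _ => hm.indicator measurableSet_ball,
    ← lintegral_const_mul _ (hm.indicator (measurableSet_Sl l))]
  apply lintegral_mono
  intro z
  classical
  simp only
  have hsub : ∀ k, z ∈ Metric.ball ((T k : ℂ) - l * I) (l / 4) →
      z ∈ Sl l ∧ k ∈ ({⌊z.re / l⌋ - 1, ⌊z.re / l⌋, ⌊z.re / l⌋ + 1} : Finset ℤ) := by
    intro k hz
    obtain ⟨h1, h2⟩ := hball k z hz
    rw [abs_lt] at h1 h2
    obtain ⟨h3, h4⟩ := hT k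
    refine ⟨⟨by linarith, by linarith⟩, ?_⟩
    have f1 := Int.floor_le (z.re / l)
    have f2 := Int.lt_floor_add_one (z.re / l)
    set n := ⌊z.re / l⌋
    rw [le_div_iff₀ hl] at f1
    rw [div_lt_iff₀ hl] at f2
    have g1 : (k:ℝ) < n + 2 := by
      by_contra h; push Not at h
      nlinarith
    have g2 : (n:ℝ) - 2 < k := by
      by_contra h; push Not at h
      nlinarith
    have g1' : k < n + 2 := by exact_mod_cast g1
    have g2' : n - 2 < k := by exact_mod_cast g2
    simp only [Finset.mem_insert, Finset.mem_singleton]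
    omega
  by_cases hz : z ∈ Sl l
  · rw [Set.indicator_of_mem hz]
    calc _ ≤ ∑ k ∈ s, if k ∈ ({⌊z.re / l⌋ - 1, ⌊z.re / l⌋, ⌊z.re / l⌋ + 1} : Finset ℤ) then nf f z ^ r else 0 := by
          apply Finset.sum_le_sum
          intro k _
          by_cases hk : z ∈ Metric.ball ((T k : ℂ) - l * I) (l / 4)
          · rw [Set.indicator_of_mem hk, if_pos (hsub k hk).2]
          · rw [Set.indicator_of_notMem hk]; exact zero_le
      _ = ∑ k ∈ s with k ∈ ({⌊z.re / l⌋ - 1, ⌊z.re / l⌋, ⌊z.re / l⌋ + 1} : Finset ℤ), nf f z ^ r := by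
          rw [Finset.sum_filter]
      _ ≤ ∑ k ∈ ({⌊z.re / l⌋ - 1, ⌊z.re / l⌋, ⌊z.re / l⌋ + 1} : Finset ℤ), nf f z ^ r := by
          apply Finset.sum_le_sum_of_subset
          intro k hk
          exact (Finset.mem_filter.1 hk).2
      _ ≤ _ := by
          rw [Finset.sum_const, nsmul_eq_mul]
          gcongr
          exact_mod_cast Finset.card_le_three
  · rw [Set.indicator_of_notMem hz, mul_zero]
    apply le_of_eq
    apply Finset.sum_eq_zero
    intro k _
    exact Set.indicator_of_notMem (fun hk => hz (hsub k hk).1) _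

theorem Sl_finite {p : ℝ} (hp : 0 < p) {f : ℂ → ℂ} (hf : Differentiable ℂ f) {M : ℝ}
    (hb : ∀ z, ‖f z‖ ≤ M * Real.exp (π * |z.im|)) (hfin : ∫⁻ x : ℝ, ‖f x‖ₑ ^ p < ⊤) {l : ℝ} (hl : 0 < l) :
    ∫⁻ z in Sl l, nf f z ^ p < ⊤ := by
  have hm : Measurable fun z => nf f z ^ p := (measurable_nf hf.continuous).pow_const p
  rw [← lintegral_indicator (measurableSet_Sl l), lintegral_complex (hm.indicator (measurableSet_Sl l))]
  calc _ ≤ ∫⁻ y : ℝ, (Set.Icc (-(5 / 4 * l)) (-(3 / 4 * l))).indicator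
          (fun _ => ∫⁻ x : ℝ, ‖f x‖ₑ ^ p) y := by
        apply lintegral_mono
        intro y
        simp only
        by_cases hy : y ∈ Set.Icc (-(5 / 4 * l)) (-(3 / 4 * l))
        · rw [Set.indicator_of_mem hy]
          refine le_trans (lintegral_mono fun x => Set.indicator_le_self _ _ _) ?_
          have : y ≠ 0 := by rintro rfl; have := hy.2; linarith
          exact plancherel_polya hf hb this hp
        · rw [Set.indicator_of_notMem hy]
          apply le_of_eq
          have h0 : ∀ x : ℝ, (Sl l).indicator (fun z => nf f z ^ p) (x + y * I) = 0 := ?_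
          · simp_rw [h0]; simp
          intro x
          apply Set.indicator_of_notMem
          intro h
          apply hy
          simpa [Sl] using h
    _ < ⊤ := by
        rw [lintegral_indicator measurableSet_Icc, setLIntegral_const]
        exact ENNReal.mul_lt_top hfin (by simp)

theorem kernel_conv {N : ℕ} {p : ℝ} (hp : 0 < p) (hN : 2 ≤ (N + 1) * p) (a : ℝ) :
    (Real.sqrt (1 + a ^ 2))⁻¹ ^ (N + 1) ≤ ((1 + a ^ 2)⁻¹) ^ (1 / p) := by
  have h1 : 1 ≤ 1 + a ^ 2 := by nlinarith [sq_nonneg a]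
  have h0 : 0 < (1 + a ^ 2)⁻¹ := by positivity
  rw [← Real.sqrt_inv, Real.sqrt_eq_rpow, ← Real.rpow_natCast, ← Real.rpow_mul h0.le]
  apply Real.rpow_le_rpow_of_exponent_ge h0 (inv_le_one_of_one_le₀ h1)
  push_cast
  rw [div_le_iff₀ hp]
  linarith

end

section
open MeasureTheory Real Complex
open scoped ENNReal NNReal Topology
open Filter

/-- Atomic decomposability up to small `L^p` errors, with cost `X`. -/
def Dec (p q : ℝ) (X : ℝ≥0∞) (T : ℝ → ℂ) : Prop :=
  Measurable T ∧ ∀ η : ℝ, 0 < η → ∃ (ι : Type) (_ : Fintype ι) (g : ι → ℂ → ℂ) (b : ι → ℝ),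
    (∀ i, 0 ≤ b i) ∧ (∀ i, ExpTypePi (g i)) ∧
    (∀ i, ∫⁻ x : ℝ, ‖g i x‖ₑ ^ p ≤ ENNReal.ofReal (b i ^ p)) ∧
    ∑ i, ENNReal.ofReal (b i ^ q) ≤ X ∧
    ∫⁻ x : ℝ, ‖T x - ∑ i, g i x‖ₑ ^ p ≤ ENNReal.ofReal η

theorem Dec.mono {p q : ℝ} {X Y : ℝ≥0∞} {T : ℝ → ℂ} (h : Dec p q X T) (hXY : X ≤ Y) : Dec p q Y T := by
  refine ⟨h.1, fun η hη => ?_⟩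
  obtain ⟨ι, hι, g, b, h1, h2, h3, h4, h5⟩ := h.2 η hη
  exact ⟨ι, hι, g, b, h1, h2, h3, h4.trans hXY, h5⟩

theorem Dec.zero {p q : ℝ} (hp : 0 < p) : Dec p q 0 (fun _ => 0) := by
  refine ⟨measurable_const, fun η hη => ⟨Empty, inferInstance, fun i => i.elim, fun i => i.elim, ?_, ?_, ?_, ?_, ?_⟩⟩
  · intro i; exact i.elim
  · intro i; exact i.elim
  · intro i; exact i.elim
  · simp
  · simp [hp]

theorem enorm_add_rpow_le' (a b : ℂ) {p : ℝ} (hp : 0 < p) (hp1 : p ≤ 1) :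
    ‖a + b‖ₑ ^ p ≤ ‖a‖ₑ ^ p + ‖b‖ₑ ^ p := by
  calc _ ≤ (‖a‖ₑ + ‖b‖ₑ) ^ p := by gcongr; exact enorm_add_le _ _
    _ ≤ _ := ENNReal.rpow_add_le_add_rpow _ _ hp.le hp1

theorem Dec.add {p q : ℝ} (hp : 0 < p) (hp1 : p ≤ 1) {X Y : ℝ≥0∞} {S T : ℝ → ℂ}
    (hS : Dec p q X S) (hT : Dec p q Y T) : Dec p q (X + Y) (fun x => S x + T x) := by
  refine ⟨hS.1.add hT.1, fun η hη => ?_⟩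
  obtain ⟨ι, hι, g, b, h1, h2, h3, h4, h5⟩ := hS.2 (η / 2) (by positivity)
  obtain ⟨κ, hκ, g', b', k1, k2, k3, k4, k5⟩ := hT.2 (η / 2) (by positivity)
  refine ⟨ι ⊕ κ, inferInstance, Sum.elim g g', Sum.elim b b', ?_, ?_, ?_, ?_, ?_⟩
  · rintro (i | i); exacts [h1 i, k1 i]
  · rintro (i | i); exacts [h2 i, k2 i]
  · rintro (i | i); exacts [h3 i, k3 i]
  · simpa using add_le_add h4 k4
  · simp only [Fintype.sum_sum_type, Sum.elim_inl, Sum.elim_inr]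
    have hgm : ∀ i, Measurable fun x : ℝ => g i x := fun i =>
      ((h2 i).1.continuous.comp continuous_ofReal).measurable
    have hm : Measurable fun x : ℝ => ‖S x - ∑ i, g i x‖ₑ ^ p := by
      have := hS.1
      exact ((this.sub (Finset.measurable_fun_sum _ fun i _ => hgm i)).enorm).pow_const p
    calc _ ≤ ∫⁻ x : ℝ, (‖S x - ∑ i, g i x‖ₑ ^ p + ‖T x - ∑ i, g' i x‖ₑ ^ p) := by
          apply lintegral_mono; intro x
          have := enorm_add_rpow_le' (S x - ∑ i, g i x) (T x - ∑ i, g' i x) hp hp1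
          refine le_trans (le_of_eq ?_) this
          have e : S x + T x - (∑ i, g i x + ∑ i, g' i x) = (S x - ∑ i, g i x) + (T x - ∑ i, g' i x) := by ring
          show ‖S x + T x - (∑ i, g i x + ∑ i, g' i x)‖ₑ ^ p = _
          rw [e]
      _ = _ := lintegral_add_left hm _
      _ ≤ ENNReal.ofReal (η / 2) + ENNReal.ofReal (η / 2) := add_le_add h5 k5
      _ = _ := by rw [← ENNReal.ofReal_add (by positivity) (by positivity)]; congr 1; ring

theorem Dec.sum {p q : ℝ} (hp : 0 < p) (hp1 : p ≤ 1) {κ : Type*} (s : Finset κ) {X : κ → ℝ≥0∞} {T : κ → ℝ → ℂ}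
    (h : ∀ j ∈ s, Dec p q (X j) (T j)) : Dec p q (∑ j ∈ s, X j) (fun x => ∑ j ∈ s, T j x) := by
  classical
  induction s using Finset.induction_on with
  | empty => simpa using Dec.zero hp
  | insert a s ha ih =>
    simp only [Finset.sum_insert ha]
    exact (h a (by simp)).add hp hp1 (ih fun j hj => h j (by simp [hj]))

theorem lintegral_neg_real {h : ℝ → ℝ≥0∞} : ∫⁻ x : ℝ, h (-x) = ∫⁻ x, h x :=
  (Measure.measurePreserving_neg (volume : Measure ℝ)).lintegral_comp_emb
    (MeasurableEquiv.neg ℝ).measurableEmbedding h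

theorem Dec.neg {p q : ℝ} {X : ℝ≥0∞} {T : ℝ → ℂ} (h : Dec p q X T) : Dec p q X (fun x => T (-x)) := by
  refine ⟨h.1.comp measurable_neg, fun η hη => ?_⟩
  obtain ⟨ι, hι, g, b, h1, h2, h3, h4, h5⟩ := h.2 η hη
  refine ⟨ι, hι, fun i z => g i (-z), b, h1, fun i => (h2 i).comp_neg, fun i => ?_, h4, ?_⟩
  · refine le_trans (le_of_eq ?_) (h3 i)
    rw [← lintegral_neg_real]
    simp
  · refine le_trans (le_of_eq ?_) h5
    rw [← lintegral_neg_real]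
    simp

theorem Tk_measurable {K f : ℂ → ℂ} (hK : Continuous K) (hf : Continuous f) (l : ℝ) : Measurable (Tk K l f) := by
  have : StronglyMeasurable (Function.uncurry fun (x s : ℝ) => f (x - (s + l * I)) * K (s + l * I)) := by
    apply Continuous.stronglyMeasurable
    simp only [Function.uncurry_def]
    fun_prop
  exact this.integral_prod_right.measurable

theorem pow_strip {l y a : ℝ} (hl : 0 < l) (h1 : l / 2 ≤ y) (h2 : y ≤ 2 * l) : l ^ a ≤ 2 ^ |a| * y ^ a := by
  have hy : 0 < y := by linarith
  rcases le_total 0 a with ha | ha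
  · rw [abs_of_nonneg ha, ← Real.mul_rpow (by norm_num) hy.le]
    gcongr; linarith
  · rw [abs_of_nonpos ha]
    obtain ⟨c, rfl⟩ : ∃ c, a = -c := ⟨-a, by ring⟩
    have hc : 0 ≤ c := by linarith
    rw [neg_neg, Real.rpow_neg hl.le, Real.rpow_neg hy.le, ← div_eq_mul_inv, le_div_iff₀ (by positivity),
      inv_mul_le_iff₀ (by positivity), ← Real.mul_rpow hl.le (by norm_num)]
    gcongr; linarith

/-- The constant of the block lemma. -/
noncomputable def C1 (p q D : ℝ) : ℝ := ((3 * π) ^ (1 / p) * D) ^ q * (48 / π) * 2 ^ |q / p - 2|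

theorem const_eq {p q D l : ℝ} (hp : 0 < p) (hD : 0 ≤ D) (hl : 0 < l) :
    ((3 * π * l) ^ (1 / p) * D) ^ q * ((π * (l / 4) ^ 2)⁻¹ * 3) =
      ((3 * π) ^ (1 / p) * D) ^ q * (48 / π) * l ^ (q / p - 2) := by
  have hpi := Real.pi_pos
  rw [Real.mul_rpow (x := 3 * π) (by positivity) hl.le, mul_right_comm ((3 * π) ^ (1 / p)),
    Real.mul_rpow (x := (3 * π) ^ (1 / p) * D) (by positivity) (by positivity), ← Real.rpow_mul hl.le,
    one_div_mul_eq_div, Real.rpow_sub hl]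
  norm_num
  field_simp
  ring

theorem Dec.block {p q : ℝ} (hp : 0 < p) (hpq : p < q) (hq1 : q < 1) {K : ℂ → ℂ} (hKt : ExpTypePi K)
    {l : ℝ} (hl : 0 < l) {D : ℝ} (hD : 0 ≤ D)
    (hK : ∀ s : ℝ, ‖K (s + l * I)‖ ≤ D * l⁻¹ * Real.exp (-(π * l)) * ((1 + (s / l) ^ 2)⁻¹) ^ (1 / p))
    {f : ℂ → ℂ} (hf : Differentiable ℂ f) {M : ℝ} (hb : ∀ z, ‖f z‖ ≤ M * Real.exp (π * |z.im|))
    (hfin : ∫⁻ x : ℝ, ‖f x‖ₑ ^ p < ⊤) :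
    Dec p q (ENNReal.ofReal (C1 p q D) * ∫⁻ z in Sl l, ENNReal.ofReal (|z.im| ^ (q / p - 2)) * nf f z ^ q)
      (Tk K l f) := by
  refine ⟨Tk_measurable hKt.1.continuous hf.continuous l, fun η hη => ?_⟩
  have hq : 0 < q := hp.trans hpq
  have hpi := Real.pi_pos
  obtain ⟨A, hA0, hA1, hA2⟩ := exists_A hf hl
  have hgt : ∀ k : ℤ, ExpTypePi (blk K l f (k * l)) := fun k => blk_type hKt hl hf.continuous _
  set b : ℤ → ℝ := fun k => (3 * π * l) ^ (1 / p) * (D * A k) with hbdef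
  have hb0 : ∀ k, 0 ≤ b k := fun k => by have := hA0 k; positivity
  have hgb : ∀ k : ℤ, ∫⁻ x : ℝ, ‖blk K l f (k * l) x‖ₑ ^ p ≤ ENNReal.ofReal (b k ^ p) := fun k =>
    blk_lint hp hl hD (hA0 k) hK _ (hA1 k)
  have hsum : ∀ r : ℝ, 0 < r → ∀ s : Finset ℤ, ∑ k ∈ s, ENNReal.ofReal (b k ^ r) ≤
      ENNReal.ofReal (((3 * π * l) ^ (1 / p) * D) ^ r * ((π * (l / 4) ^ 2)⁻¹ * 3)) * ∫⁻ z in Sl l, nf f z ^ r := by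
    intro r hr s
    have e : ∀ k ∈ s, ENNReal.ofReal (b k ^ r) =
        ENNReal.ofReal (((3 * π * l) ^ (1 / p) * D) ^ r) * ENNReal.ofReal (A k ^ r) := by
      intro k _
      have := hA0 k
      rw [← ENNReal.ofReal_mul (by positivity), ← Real.mul_rpow (by positivity) (by positivity), hbdef]
      congr 2; ring
    have hc : 0 < π * (l / 4) ^ 2 := by positivity
    have h3 := hA2 r hr s
    rw [Finset.sum_congr rfl e, ← Finset.mul_sum, ENNReal.ofReal_mul (by positivity),
      mul_assoc (ENNReal.ofReal _)]
    gcongr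
    have h0 : ENNReal.ofReal (π * (l / 4) ^ 2) ≠ 0 := (ENNReal.ofReal_pos.2 hc).ne'
    rw [ENNReal.ofReal_mul (by positivity), ENNReal.ofReal_inv_of_pos hc, mul_assoc (ENNReal.ofReal _)⁻¹]
    have h4 : ∑ k ∈ s, ENNReal.ofReal (A k ^ r) = (ENNReal.ofReal (π * (l / 4) ^ 2))⁻¹ *
        (ENNReal.ofReal (π * (l / 4) ^ 2) * ∑ k ∈ s, ENNReal.ofReal (A k ^ r)) := by
      rw [← mul_assoc, ENNReal.inv_mul_cancel h0 ENNReal.ofReal_ne_top, one_mul]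
    rw [h4]
    refine mul_le_mul' le_rfl ?_
    simpa using h3
  have htop : ∑' k : ℤ, ENNReal.ofReal (b k ^ p) ≠ ⊤ := by
    refine ne_top_of_le_ne_top
      (ENNReal.mul_lt_top (ENNReal.ofReal_lt_top (r := ((3 * π * l) ^ (1 / p) * D) ^ p *
        ((π * (l / 4) ^ 2)⁻¹ * 3))) (Sl_finite hp hf hb hfin hl)).ne ?_
    · rw [ENNReal.tsum_eq_iSup_sum]
      exact iSup_le fun s => hsum p hp s
  have htail := ENNReal.tendsto_tsum_compl_atTop_zero htop
  obtain ⟨s, hs⟩ := (htail.eventually_le_const (ENNReal.ofReal_pos.2 hη)).exists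
  refine ⟨s, inferInstance, fun k => blk K l f (k * l), fun k => b k, fun k => hb0 k, fun k => hgt k,
    fun k => hgb k, ?_, ?_⟩
  · rw [Finset.sum_coe_sort s (fun k => ENNReal.ofReal (b k ^ q))]
    refine (hsum q hq s).trans ?_
    have hm : Measurable fun z => nf f z ^ q := (measurable_nf hf.continuous).pow_const q
    rw [← lintegral_const_mul _ hm, ← lintegral_const_mul _ (by fun_prop)]
    apply setLIntegral_mono' (measurableSet_Sl l)
    intro z hz
    have hC : 0 ≤ C1 p q D := by unfold C1; positivity
    rw [← mul_assoc (ENNReal.ofReal (C1 p q D)), ← ENNReal.ofReal_mul hC, const_eq hp hD hl, C1]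
    gcongr ENNReal.ofReal ?_ * _
    rw [mul_assoc _ ((2:ℝ) ^ _)]
    gcongr
    have hz1 := hz.1
    have hz2 := hz.2
    have : |z.im| = -z.im := abs_of_nonpos (by linarith)
    rw [this]
    exact pow_strip hl (by linarith) (by linarith)
  · refine le_trans ?_ hs
    have hpt : ∀ x : ℝ, ‖Tk K l f x - ∑ k : s, blk K l f ((k:ℤ) * l) x‖ₑ ^ p ≤
        ∑' k : {k // k ∉ s}, ‖blk K l f ((k:ℤ) * l) x‖ₑ ^ p := by
      intro x
      have hS := Tk_hasSum hp (hpq.trans hq1) hKt.1.continuous hl hK hf.continuous hb x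
      rw [Finset.sum_coe_sort s (fun k : ℤ => blk K l f (k * l) x)]
      have h2 := (Finset.hasSum_compl_iff (f := fun k : ℤ => blk K l f (k * l) x)
        (a := Tk K l f x - ∑ k ∈ s, blk K l f ((k:ℤ) * l) x) s).2 (by simpa using hS)
      have h3 := ((continuous_enorm.tendsto _).comp h2).ennrpow_const p
      refine le_of_tendsto h3 (Eventually.of_forall fun s' => ?_)
      simp only [Function.comp]
      refine (enorm_sum_rpow_le s' _ hp (hpq.trans hq1).le).trans ?_
      exact ENNReal.sum_le_tsum (f := fun k : {k // k ∉ s} => ‖blk K l f ((k:ℤ) * l) x‖ₑ ^ p) s'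
    refine (lintegral_mono hpt).trans ?_
    rw [lintegral_tsum]
    · exact ENNReal.tsum_le_tsum fun k => hgb k
    · intro k
      have := (hgt k).1.continuous
      exact ((this.comp continuous_ofReal).measurable.enorm.pow_const p).aemeasurable

end

section
open MeasureTheory Real Complex
open scoped ENNReal NNReal Topology
open Filter

theorem Aq_eq' {p q : ℝ} (hq : 0 < q) (f : ℂ → ℂ) :
    Aq p q f = ∫⁻ z : ℂ, ENNReal.ofReal (|z.im| ^ (q / p - 2)) * nf f z ^ q := by
  unfold Aq
  exact lintegral_congr fun z => Aq_integrand hq _ f z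

theorem lintegral_neg_complex {h : ℂ → ℝ≥0∞} : ∫⁻ x : ℂ, h (-x) = ∫⁻ x, h x :=
  (Measure.measurePreserving_neg (volume : Measure ℂ)).lintegral_comp_emb
    (MeasurableEquiv.neg ℂ).measurableEmbedding h

theorem Aq_neg {p q : ℝ} (hq : 0 < q) (f : ℂ → ℂ) : Aq p q (fun z => f (-z)) = Aq p q f := by
  rw [Aq_eq' hq, Aq_eq' hq, ← lintegral_neg_complex]
  refine lintegral_congr fun z => ?_
  rw [nf_neg]; simp

theorem sum_strips (F : ℂ → ℝ≥0∞) (J : ℕ) :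
    ∑ j ∈ Finset.range J, ∫⁻ z in Sl (2 ^ (j + 1)), F z ≤ ∫⁻ z, F z := by
  have hd : (↑(Finset.range J) : Set ℕ).Pairwise (fun i j => Disjoint (Sl (2 ^ (i + 1))) (Sl (2 ^ (j + 1)))) := by
    have key : ∀ i j : ℕ, i < j → Disjoint (Sl (2 ^ (i + 1))) (Sl (2 ^ (j + 1))) := by
      intro i j hij
      rw [Set.disjoint_left]
      intro z hz hz'
      have h1 := hz.1
      have h2 := hz'.2
      have h3 : (2:ℝ) * 2 ^ (i + 1) ≤ 2 ^ (j + 1) := by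
        rw [← pow_succ']; exact pow_le_pow_right₀ (by norm_num) (by omega)
      have h4 : (0:ℝ) < 2 ^ (i + 1) := by positivity
      linarith
    intro i _ j _ hij
    rcases lt_or_gt_of_ne hij with h | h
    · exact key i j h
    · exact (key j i h).symm
  rw [← lintegral_biUnion_finset hd (fun j _ => measurableSet_Sl _)]
  exact setLIntegral_le_lintegral _ _

theorem dec_main {p q : ℝ} (hp : 0 < p) (hpq : p < q) (hq1 : q < 1) {N : ℕ} (hN : 1 ≤ N)
    (hNp : 2 ≤ (N + 1) * p) {f : ℂ → ℂ} (hf : Differentiable ℂ f) {M τ : ℝ} (hM : 0 ≤ M) (hτ : τ < π)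
    (hb : ∀ z, ‖f z‖ ≤ M * Real.exp (τ * |z.im|)) (hfin : ∫⁻ x : ℝ, ‖f x‖ₑ ^ p < ⊤) :
    Dec p q (3 * (ENNReal.ofReal (C1 p q (Real.exp (4 + 2 * π) * N ^ N)) * Aq p q f)) (fun x => f x) := by
  have hq : 0 < q := hp.trans hpq
  have hpi := Real.pi_pos
  have hp1 : p ≤ 1 := (hpq.trans hq1).le
  set D := Real.exp (4 + 2 * π) * (N:ℝ) ^ N with hD
  have hD0 : 0 ≤ D := by positivity
  have hb1 : ∀ z, ‖f z‖ ≤ M * Real.exp (π * |z.im|) := fun z => (hb z).trans (by gcongr)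
  have hf' : Differentiable ℂ fun z => f (-z) := hf.comp (by fun_prop)
  have hb1' : ∀ z, ‖f (-z)‖ ≤ M * Real.exp (π * |z.im|) := fun z => by simpa using hb1 (-z)
  have hfin' : ∫⁻ x : ℝ, ‖(fun z : ℂ => f (-z)) x‖ₑ ^ p < ⊤ := by
    have := lintegral_neg_real (h := fun x : ℝ => ‖f x‖ₑ ^ p)
    simp only [ofReal_neg] at this
    rw [this]; exact hfin
  obtain ⟨J, hJ⟩ : ∃ J : ℕ, τ < π - 2 * ((2:ℝ) ^ J)⁻¹ := by
    obtain ⟨J, hJ⟩ := exists_pow_lt_of_lt_one (show 0 < (π - τ) / 2 by linarith) (show (1/2:ℝ) < 1 by norm_num)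
    refine ⟨J, ?_⟩
    rw [one_div, inv_pow] at hJ
    linarith
  have hrep := fun x => representation hN hf hb x J hJ
  have h0 : Dec p q (ENNReal.ofReal (C1 p q D) * Aq p q f) (Tk (K0 N) 1 f) := by
    refine (Dec.block hp hpq hq1 (K0_type hN) one_pos hD0 (fun s => ?_) hf hb1 hfin).mono ?_
    · refine (K0_bound hN s).trans ?_
      gcongr
      exact kernel_conv hp hNp _
    · gcongr
      rw [Aq_eq' hq]
      exact setLIntegral_le_lintegral _ _
  have hsum : ∀ g : ℂ → ℂ, Differentiable ℂ g → (∀ z, ‖g z‖ ≤ M * Real.exp (π * |z.im|)) →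
      ∫⁻ x : ℝ, ‖g x‖ₑ ^ p < ⊤ → Dec p q (ENNReal.ofReal (C1 p q D) * Aq p q g)
        (fun x => ∑ j ∈ Finset.range J, Tk (Kj N (2 ^ (j + 1))⁻¹) (2 ^ (j + 1)) g x) := by
    intro g hg hgb hgfin
    refine (Dec.sum hp hp1 (Finset.range J) (fun j _ => Dec.block hp hpq hq1 (Kj_type hN (by positivity) ?_)
      (l := 2 ^ (j + 1)) (by positivity) hD0 (fun s => ?_) hg hgb hgfin)).mono ?_
    · have : (2:ℝ) ≤ 2 ^ (j + 1) := by
        have : (1:ℝ) ≤ 2 ^ j := one_le_pow₀ (by norm_num)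
        rw [pow_succ]; linarith
      rw [← div_eq_mul_inv, div_le_one (by positivity)]; exact this
    · refine (Kj_bound hN (l := 2 ^ (j + 1)) (by positivity) s).trans ?_
      have h1 := kernel_conv hp hNp (s / 2 ^ (j + 1))
      have h2 : Real.exp 4 * (N:ℝ) ^ N ≤ D := by
        rw [hD]; gcongr; linarith
      gcongr
    · rw [← Finset.mul_sum]
      gcongr
      rw [Aq_eq' hq]
      exact sum_strips _ J
  have h1 := hsum f hf hb1 hfin
  have h2 := (hsum _ hf' hb1' hfin').neg
  rw [Aq_neg hq] at h2
  have h3 := (h0.add hp hp1 h1).add hp hp1 h2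
  have e : (fun x : ℝ => f x) = fun x : ℝ => Tk (K0 N) 1 f x +
      (∑ j ∈ Finset.range J, Tk (Kj N (2 ^ (j + 1))⁻¹) (2 ^ (j + 1)) f x) +
      ∑ j ∈ Finset.range J, Tk (Kj N (2 ^ (j + 1))⁻¹) (2 ^ (j + 1)) (fun z => f (-z)) (-x) := funext hrep
  rw [e]
  refine h3.mono (le_of_eq ?_)
  ring

end

section
open MeasureTheory Real Complex
open scoped ENNReal NNReal Topology
open Filter

theorem lint_dil {h : ℝ → ℝ≥0∞} (hh : Measurable h) {ρ : ℝ} (hρ : 0 < ρ) :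
    ∫⁻ t : ℝ, h (ρ * t) = (ENNReal.ofReal ρ)⁻¹ * ∫⁻ t, h t := by
  have := lintegral_affine hh 0 hρ
  simp only [zero_add] at this
  rw [← this, ← mul_assoc, ENNReal.inv_mul_cancel (ENNReal.ofReal_pos.2 hρ).ne' ENNReal.ofReal_ne_top, one_mul]

theorem dil_approx {p : ℝ} (hp : 0 < p) (hp1 : p ≤ 1) {f : ℂ → ℂ} (hf : Continuous f)
    (hfin : ∫⁻ x : ℝ, ‖f x‖ₑ ^ p < ⊤) {η : ℝ} (hη : 0 < η) :
    ∃ ρ : ℝ, 1 / 2 ≤ ρ ∧ ρ < 1 ∧ ∫⁻ x : ℝ, ‖f x - f (ρ * x)‖ₑ ^ p ≤ ENNReal.ofReal η := by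
  by_contra! hcon
  set ρ : ℕ → ℝ := fun n => 1 - 1 / 2 / ((n:ℝ) + 1) with hρ
  have hρ1 : ∀ n, 1 / 2 ≤ ρ n := fun n => by
    have : (1 / 2 : ℝ) / ((n:ℝ) + 1) ≤ 1 / 2 := div_le_self (by norm_num) (by linarith [(Nat.cast_nonneg n : (0:ℝ) ≤ n)])
    simp only [hρ]; linarith
  have hρ2 : ∀ n, ρ n < 1 := fun n => by
    have : 0 < (1 / 2 : ℝ) / ((n:ℝ) + 1) := by positivity
    simp only [hρ]; linarith
  have hρ0 : ∀ n, 0 < ρ n := fun n => by linarith [hρ1 n]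
  have hlim : Tendsto ρ atTop (𝓝 1) := by
    have h1 := (tendsto_one_div_add_atTop_nhds_zero_nat (𝕜 := ℝ)).const_mul (1 / 2)
    have h2 := h1.const_sub 1
    simp only [mul_zero, sub_zero] at h2
    refine h2.congr fun n => ?_
    simp only [hρ]; ring
  set N := ∫⁻ x : ℝ, ‖f x‖ₑ ^ p with hN
  have hm : Measurable fun x : ℝ => ‖f x‖ₑ ^ p :=
    ((hf.comp continuous_ofReal).measurable.enorm).pow_const p
  have hmρ : ∀ n, Measurable fun x : ℝ => ‖f (ρ n * x)‖ₑ ^ p := fun n =>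
    ((show Continuous fun x : ℝ => f (ρ n * x) by fun_prop).measurable.enorm).pow_const p
  have hmd : ∀ n, Measurable fun x : ℝ => ‖f x - f (ρ n * x)‖ₑ ^ p := fun n =>
    ((show Continuous fun x : ℝ => f x - f (ρ n * x) by fun_prop).measurable.enorm).pow_const p
  have hNρ : ∀ n, ∫⁻ x : ℝ, ‖f (ρ n * x)‖ₑ ^ p = (ENNReal.ofReal (ρ n))⁻¹ * N := fun n => by
    rw [hN, ← lint_dil hm (hρ0 n)]; simp
  have hle : ∀ n (x : ℝ), ‖f x - f (ρ n * x)‖ₑ ^ p ≤ ‖f x‖ₑ ^ p + ‖f (ρ n * x)‖ₑ ^ p := fun n x => by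
    have := enorm_add_rpow_le' (f x) (-f (ρ n * x)) hp hp1
    rwa [enorm_neg, ← sub_eq_add_neg] at this
  set h : ℕ → ℝ → ℝ≥0∞ := fun n x => (‖f x‖ₑ ^ p + ‖f (ρ n * x)‖ₑ ^ p) - ‖f x - f (ρ n * x)‖ₑ ^ p with hh
  have hhm : ∀ n, Measurable (h n) := fun n => (hm.add (hmρ n)).sub (hmd n)
  have hfat := lintegral_liminf_le (μ := volume) (u := atTop) hhm
  have hpt : ∀ x : ℝ, liminf (fun n => h n x) atTop = ‖f x‖ₑ ^ p + ‖f x‖ₑ ^ p := by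
    intro x
    apply Tendsto.liminf_eq
    have c1 : Tendsto (fun n => f (ρ n * x)) atTop (𝓝 (f x)) := by
      have : Tendsto (fun n => (ρ n : ℂ) * x) atTop (𝓝 ((1:ℝ) * x)) :=
        ((continuous_ofReal.tendsto _).comp hlim).mul_const _
      simp only [ofReal_one, one_mul] at this
      exact (hf.tendsto _).comp this
    have c2 : Tendsto (fun n => ‖f (ρ n * x)‖ₑ ^ p) atTop (𝓝 (‖f x‖ₑ ^ p)) :=
      ((continuous_enorm.tendsto _).comp c1).ennrpow_const p
    have c3 : Tendsto (fun n => ‖f x - f (ρ n * x)‖ₑ ^ p) atTop (𝓝 0) := by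
      have := ((continuous_enorm.tendsto _).comp (c1.const_sub (f x))).ennrpow_const p
      simpa [hp] using this
    have c4 := ENNReal.Tendsto.sub (c2.const_add (‖f x‖ₑ ^ p)) c3 (Or.inr ENNReal.zero_ne_top)
    simpa using c4
  simp only [hpt] at hfat
  rw [lintegral_add_left hm, ← hN] at hfat
  set v : ℕ → ℝ≥0∞ := fun n => N + (ENNReal.ofReal (ρ n))⁻¹ * N with hv
  have hvl : Tendsto v atTop (𝓝 (N + N)) := by
    have c1 : Tendsto (fun n => (ENNReal.ofReal (ρ n))⁻¹) atTop (𝓝 1) := by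
      have := (ENNReal.tendsto_ofReal hlim).inv
      simpa using this
    have c2 := (ENNReal.Tendsto.mul_const c1 (Or.inr hfin.ne)).const_add N
    simpa using c2
  have hIntg : ∀ n, (∫⁻ x, h n x) + ENNReal.ofReal η ≤ v n := by
    intro n
    have e : (∫⁻ x, h n x) + ∫⁻ x : ℝ, ‖f x - f (ρ n * x)‖ₑ ^ p = v n := by
      rw [← lintegral_add_left (hhm n), hv]
      simp only
      rw [← hNρ n, hN, ← lintegral_add_left hm]
      exact lintegral_congr fun x => tsub_add_cancel_of_le (hle n x)
    rw [← e]
    gcongr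
    exact (hcon (ρ n) (hρ1 n) (hρ2 n)).le
  have hη' : ENNReal.ofReal η ≤ N + N := ge_of_tendsto' hvl fun n => le_add_self.trans (hIntg n)
  have hub : liminf (fun n => ∫⁻ x, h n x) atTop ≤ N + N - ENNReal.ofReal η := by
    have c : Tendsto (fun n => v n - ENNReal.ofReal η) atTop (𝓝 (N + N - ENNReal.ofReal η)) :=
      ENNReal.Tendsto.sub hvl tendsto_const_nhds (Or.inr ENNReal.ofReal_ne_top)
    rw [← c.liminf_eq]
    exact liminf_le_liminf (Eventually.of_forall fun n =>
      ENNReal.le_sub_of_add_le_right ENNReal.ofReal_ne_top (hIntg n))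
  have hηp := ENNReal.ofReal_pos.2 hη
  have := ENNReal.sub_lt_self (a := N + N) (ENNReal.add_lt_top.2 ⟨hfin, hfin⟩).ne
    (hηp.trans_le hη').ne' hηp.ne'
  exact absurd (hfat.trans hub) (not_le.2 this)

theorem lint_dil_complex {h : ℂ → ℝ≥0∞} (hh : Measurable h) {ρ : ℝ} (hρ : 0 < ρ) :
    ∫⁻ z : ℂ, h (ρ * z) = (ENNReal.ofReal ρ)⁻¹ * ((ENNReal.ofReal ρ)⁻¹ * ∫⁻ z, h z) := by
  have h1 : Measurable fun z : ℂ => h (ρ * z) := hh.comp (by fun_prop)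
  have hin : Measurable fun y : ℝ => ∫⁻ x : ℝ, h (x + y * I) := by
    have : Measurable (Function.uncurry fun (y x : ℝ) => h (x + y * I)) :=
      hh.comp (by fun_prop)
    exact this.lintegral_prod_right'
  rw [lintegral_complex h1, lintegral_complex hh, ← lint_dil hin hρ, ← lintegral_const_mul _ (by fun_prop)]
  refine lintegral_congr fun y => ?_
  rw [← lint_dil (h := fun x : ℝ => h (x + ((ρ * y : ℝ) : ℂ) * I)) (hh.comp (by fun_prop)) hρ]
  refine lintegral_congr fun x => ?_
  congr 1
  push_cast; ring

theorem Aq_dil {p q : ℝ} (hq : 0 < q) {f : ℂ → ℂ} (hf : Continuous f) {ρ : ℝ}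
    (hρ : 0 < ρ) (hρ1 : ρ ≤ 1) :
    Aq p q (fun z => f (ρ * z)) ≤ ENNReal.ofReal (ρ ^ (-(q / p))) * Aq p q f := by
  rw [Aq_eq' hq, Aq_eq' hq]
  set G : ℂ → ℝ≥0∞ := fun z => ENNReal.ofReal (|z.im| ^ (q / p - 2)) * nf f z ^ q with hG
  have hGm : Measurable G := by
    have := measurable_nf hf
    rw [hG]; fun_prop
  have hpi := Real.pi_pos
  calc _ ≤ ∫⁻ z : ℂ, ENNReal.ofReal (ρ ^ (-(q / p - 2))) * G (ρ * z) := by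
        apply lintegral_mono
        intro z
        have him : ((ρ:ℂ) * z).im = ρ * z.im := by simp
        have e : ENNReal.ofReal (ρ ^ (-(q / p - 2))) * G (ρ * z) =
            ENNReal.ofReal (|z.im| ^ (q / p - 2)) * nf f (ρ * z) ^ q := by
          rw [hG]
          simp only
          rw [← mul_assoc, ← ENNReal.ofReal_mul (by positivity), him, abs_mul, abs_of_pos hρ,
            Real.mul_rpow hρ.le (abs_nonneg _), ← mul_assoc, ← Real.rpow_add hρ]
          simp
        simp only [e]
        gcongr
        unfold nf
        have : Real.exp (-(π * |z.im|)) ≤ Real.exp (-(π * |((ρ:ℂ) * z).im|)) := by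
          apply Real.exp_le_exp.2
          rw [him, abs_mul, abs_of_pos hρ]
          have h1 : ρ * |z.im| ≤ |z.im| := mul_le_of_le_one_left (abs_nonneg _) hρ1
          nlinarith
        exact mul_le_mul' (ENNReal.ofReal_le_ofReal this) le_rfl
    _ = ENNReal.ofReal (ρ ^ (-(q / p - 2))) * ((ENNReal.ofReal ρ)⁻¹ * ((ENNReal.ofReal ρ)⁻¹ * ∫⁻ z, G z)) := by
        rw [lintegral_const_mul _ (show Measurable fun z : ℂ => G (ρ * z) from hGm.comp (by fun_prop)), lint_dil_complex hGm hρ]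
    _ = _ := by
        rw [← mul_assoc, ← mul_assoc, ← ENNReal.ofReal_inv_of_pos hρ, ← ENNReal.ofReal_mul (by positivity),
          ← ENNReal.ofReal_mul (by positivity)]
        congr 2
        have : ρ ^ (-(q / p)) = ρ ^ (-(q / p - 2)) * ρ ^ (-2 : ℝ) := by
          rw [← Real.rpow_add hρ]; congr 1; ring
        rw [this, Real.rpow_neg hρ.le 2, mul_assoc]
        congr 1
        rw [Real.rpow_two]; field_simp

end

section
open MeasureTheory Real Complex
open scoped ENNReal NNReal Topology
open Filter

theorem gauge_of_approx {p q : ℝ} (hp : 0 < p) (hpq : p < q) (hq1 : q < 1) {f : ℂ → ℂ} (hf : ExpTypePi f)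
    {X : ℝ} (hX : 0 ≤ X)
    (h : ∀ η : ℝ, 0 < η → ∃ T : ℝ → ℂ, Dec p q (ENNReal.ofReal X) T ∧
      ∫⁻ x : ℝ, ‖f x - T x‖ₑ ^ p ≤ ENNReal.ofReal η) :
    gauge (qConvexHull q (Bp p)) f ^ q ≤ X := by
  have hq : 0 < q := hp.trans hpq
  have hp1 : p ≤ 1 := (hpq.trans hq1).le
  refine le_of_forall_pos_le_add fun δ hδ => ?_
  set β : ℝ := (δ / 2) ^ (1 / q) with hβ
  have hβ0 : 0 < β := by positivity
  have hβq : β ^ q = δ / 2 := by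
    rw [hβ, ← Real.rpow_mul (by positivity), one_div_mul_cancel hq.ne', Real.rpow_one]
  obtain ⟨T, hT, hTf⟩ := h (β ^ p / 2) (by positivity)
  obtain ⟨ι, hι, g, b, h1, h2, h3, h4, h5⟩ := hT.2 (β ^ p / 2) (by positivity)
  set κ : ℝ := δ / 2 / (Fintype.card ι + 1) with hκ
  have hκ0 : 0 < κ := by positivity
  set b' : ι → ℝ := fun i => (b i ^ q + κ) ^ (1 / q) with hb'
  have hbp : ∀ i, 0 < b' i := fun i => by
    have := Real.rpow_nonneg (h1 i) q
    positivity
  have hbq : ∀ i, b' i ^ q = b i ^ q + κ := fun i => by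
    have := Real.rpow_nonneg (h1 i) q
    rw [hb', ← Real.rpow_mul (by positivity), one_div_mul_cancel hq.ne', Real.rpow_one]
  have hbb : ∀ i, b i ≤ b' i := fun i => by
    rw [← Real.rpow_le_rpow_iff (h1 i) (hbp i).le hq, hbq]; linarith
  set r : ℂ → ℂ := f - ∑ i, g i with hr
  have hrt : ExpTypePi r := hf.sub (ExpTypePi.sum _ fun i _ => h2 i)
  have hrn : ∫⁻ x : ℝ, ‖r x‖ₑ ^ p ≤ ENNReal.ofReal (β ^ p) := by
    have hm : Measurable fun x : ℝ => ‖f x - T x‖ₑ ^ p :=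
      (((hf.1.continuous.comp continuous_ofReal).measurable.sub hT.1).enorm).pow_const p
    calc _ ≤ ∫⁻ x : ℝ, (‖f x - T x‖ₑ ^ p + ‖T x - ∑ i, g i x‖ₑ ^ p) := by
          apply lintegral_mono; intro x
          have := enorm_add_rpow_le' (f x - T x) (T x - ∑ i, g i x) hp hp1
          have e : r x = (f x - T x) + (T x - ∑ i, g i x) := by
            rw [hr]; simp
          simp only [e]
          exact this
      _ = _ := lintegral_add_left hm _
      _ ≤ ENNReal.ofReal (β ^ p / 2) + ENNReal.ofReal (β ^ p / 2) := add_le_add hTf h5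
      _ = _ := by rw [← ENNReal.ofReal_add (by positivity) (by positivity)]; congr 1; ring
  have hsX : ∑ i, b i ^ q ≤ X := by
    rw [← ENNReal.ofReal_sum_of_nonneg (fun i _ => Real.rpow_nonneg (h1 i) q)] at h4
    exact (ENNReal.ofReal_le_ofReal_iff hX).1 h4
  set R : ℝ := (X + δ) ^ (1 / q) with hR
  have hR0 : 0 < R := by positivity
  have hRq : R ^ q = X + δ := by
    rw [hR, ← Real.rpow_mul (by positivity), one_div_mul_cancel hq.ne', Real.rpow_one]
  have key := gauge_le_of_sum (q := q) hp hR0 (ι := ι ⊕ Unit) (g := Sum.elim g (fun _ => r))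
    (b := Sum.elim b' (fun _ => β)) ?_ ?_ ?_ ?_
  · have e : ∑ i, Sum.elim g (fun _ : Unit => r) i = f := by
      rw [Fintype.sum_sum_type]; simp [hr]
    rw [e] at key
    rw [← hRq]
    exact Real.rpow_le_rpow (gauge_nonneg _) key hq.le
  · rintro (i | i); exacts [hbp i, hβ0]
  · rintro (i | i); exacts [h2 i, hrt]
  · rintro (i | i)
    · refine (h3 i).trans (ENNReal.ofReal_le_ofReal ?_)
      exact Real.rpow_le_rpow (h1 i) (hbb i) hp.le
    · exact hrn
  · rw [Fintype.sum_sum_type, hRq]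
    simp only [Sum.elim_inl, Sum.elim_inr, hbq, hβq, Finset.sum_add_distrib, Finset.sum_const,
      Finset.card_univ, nsmul_eq_mul, Fintype.card_unit, Nat.cast_one, one_mul]
    have : (Fintype.card ι : ℝ) * κ ≤ δ / 2 := by
      rw [hκ, mul_div_assoc', div_le_iff₀ (by positivity)]
      nlinarith
    linarith

theorem gauge_lower {p q : ℝ} (hp : 0 < p) (hpq : p < q) (hq1 : q < 1) :
    ∃ C : ℝ, 0 < C ∧ ∀ f : ℂ → ℂ, ExpTypePi f → ∫⁻ x : ℝ, ‖f x‖ₑ ^ p < ⊤ → Aq p q f ≠ ⊤ →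
      gauge (qConvexHull q (Bp p)) f ^ q ≤ C * (Aq p q f).toReal := by
  have hq : 0 < q := hp.trans hpq
  have hpi := Real.pi_pos
  obtain ⟨N, hN1, hN⟩ : ∃ N : ℕ, 1 ≤ N ∧ 2 ≤ ((N:ℝ) + 1) * p := by
    obtain ⟨N, hN⟩ := exists_nat_ge (2 / p)
    refine ⟨N + 1, by omega, ?_⟩
    rw [div_le_iff₀ hp] at hN
    push_cast
    nlinarith
  set D : ℝ := Real.exp (4 + 2 * π) * (N:ℝ) ^ N with hD
  have hNp : (0:ℝ) < N := by exact_mod_cast hN1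
  have hD0 : 0 < D := by positivity
  have hC1 : 0 < C1 p q D := by unfold C1; positivity
  refine ⟨3 * (C1 p q D * 2 ^ (q / p)), by positivity, fun f hf hfin hA => ?_⟩
  obtain ⟨M, hM, hb⟩ := exists_bound hf hp hfin
  refine gauge_of_approx hp hpq hq1 hf (by positivity) fun η hη => ?_
  obtain ⟨ρ, hρ1, hρ2, hρ⟩ := dil_approx hp (hpq.trans hq1).le hf.1.continuous hfin hη
  have hρ0 : 0 < ρ := by linarith
  refine ⟨fun x : ℝ => f (ρ * x), ?_, hρ⟩
  have hfρ : Differentiable ℂ fun z : ℂ => f (ρ * z) := hf.1.comp (by fun_prop)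
  have hbρ : ∀ z : ℂ, ‖f (ρ * z)‖ ≤ M * Real.exp ((π * ρ) * |z.im|) := fun z => by
    have := hb (ρ * z)
    simpa [abs_mul, abs_of_pos hρ0, mul_assoc] using this
  have hfinρ : ∫⁻ x : ℝ, ‖(fun z : ℂ => f (ρ * z)) x‖ₑ ^ p < ⊤ := by
    have hm : Measurable fun x : ℝ => ‖f x‖ₑ ^ p :=
      ((hf.1.continuous.comp continuous_ofReal).measurable.enorm).pow_const p
    have := lint_dil hm hρ0
    simp only [ofReal_mul] at this
    simp only [this]
    exact ENNReal.mul_lt_top (by simpa using hρ0) hfin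
  refine (dec_main hp hpq hq1 hN1 hN hfρ hM (by nlinarith) hbρ hfinρ).mono ?_
  have h1 : Aq p q (fun z => f (ρ * z)) ≤ ENNReal.ofReal (2 ^ (q / p)) * Aq p q f := by
    refine (Aq_dil hq hf.1.continuous hρ0 hρ2.le).trans ?_
    gcongr ENNReal.ofReal ?_ * _
    rw [Real.rpow_neg hρ0.le, ← Real.inv_rpow hρ0.le]
    apply Real.rpow_le_rpow (by positivity) _ (by positivity)
    rw [inv_le_comm₀ hρ0 (by norm_num)]; linarith
  calc _ ≤ 3 * (ENNReal.ofReal (C1 p q D) * (ENNReal.ofReal (2 ^ (q / p)) * Aq p q f)) := by gcongr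
    _ = _ := by
      rw [ENNReal.ofReal_mul (by positivity), ENNReal.ofReal_toReal hA, ENNReal.ofReal_mul (by norm_num),
        ENNReal.ofReal_mul hC1.le]
      simp only [mul_assoc]
      norm_num

theorem q_env {p q : ℝ} (hp0 : 0 < p) (hpq : p < q) (hq1 : q < 1) :
    ∃ c C : ℝ, 0 < c ∧ 0 < C ∧ ∀ f : ℂ → ℂ,
      ExpTypePi f → (∫⁻ x : ℝ, ‖f x‖ₑ ^ p) < ⊤ →
      ENNReal.ofReal (c * gauge (qConvexHull q (Bp p)) f) ≤ Aq p q f ^ (1 / q) ∧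
      Aq p q f ^ (1 / q) ≤ ENNReal.ofReal (C * gauge (qConvexHull q (Bp p)) f) := by
  have hq : 0 < q := hp0.trans hpq
  obtain ⟨C, hC, hup⟩ := gauge_upper hp0 hpq hq1
  obtain ⟨C', hC', hlo⟩ := gauge_lower hp0 hpq hq1
  refine ⟨(C' ^ (1 / q))⁻¹, C, by positivity, hC, fun f hf hfin => ⟨?_, hup f hf hfin⟩⟩
  have hA : Aq p q f ≠ ⊤ := by
    intro h
    have := hup f hf hfin
    rw [h, ENNReal.top_rpow_of_pos (by positivity)] at this
    exact absurd this (by simp)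
  have h1 := hlo f hf hfin hA
  have h2 : gauge (qConvexHull q (Bp p)) f ≤ C' ^ (1 / q) * (Aq p q f).toReal ^ (1 / q) := by
    rw [← Real.mul_rpow hC'.le ENNReal.toReal_nonneg, one_div]
    exact (Real.le_rpow_inv_iff_of_pos (gauge_nonneg _) (by positivity) hq).2 h1
  rw [← ENNReal.ofReal_toReal hA, ENNReal.ofReal_rpow_of_nonneg ENNReal.toReal_nonneg (by positivity)]
  apply ENNReal.ofReal_le_ofReal
  rwa [inv_mul_le_iff₀ (by positivity)]

end

/-- **`q`-envelope theorem, dense-subspace form.** For `0 < p < q < 1`, the Minkowski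
functional of the `q`-convex hull of the unit ball of `Eᵖ` is equivalent, on `Eᵖ`, to
the quasi-norm `(∫_ℂ e^{-qπ|Im z|} |Im z|^{q/p-2} |f(z)|^q dA(z))^{1/q}`. -/
theorem q_envelope_of_Ep (p q : ℝ) (hp0 : 0 < p) (hpq : p < q) (hq1 : q < 1)
    (B : Set (ℂ → ℂ))
    (hB : B = {f : ℂ → ℂ | ExpTypePi f ∧ (∫⁻ x : ℝ, (‖f x‖₊ : ℝ≥0∞) ^ p) ≤ 1}) :
    ∃ c C : ℝ, 0 < c ∧ 0 < C ∧ ∀ f : ℂ → ℂ,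
      ExpTypePi f → (∫⁻ x : ℝ, (‖f x‖₊ : ℝ≥0∞) ^ p) < ⊤ →
      ENNReal.ofReal (c * gauge (qConvexHull q B) f) ≤
        (∫⁻ z : ℂ, ENNReal.ofReal
            (Real.exp (-q * Real.pi * |z.im|) * |z.im| ^ (q / p - 2)) *
          (‖f z‖₊ : ℝ≥0∞) ^ q) ^ (1 / q) ∧
      (∫⁻ z : ℂ, ENNReal.ofReal
            (Real.exp (-q * Real.pi * |z.im|) * |z.im| ^ (q / p - 2)) *
          (‖f z‖₊ : ℝ≥0∞) ^ q) ^ (1 / q) ≤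
        ENNReal.ofReal (C * gauge (qConvexHull q B) f) := by
  subst hB
  exact q_env hp0 hpq hq1
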